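/- arXiv:2603.25098 — 3 statements merged into one kernel-verified Lean document; each statement's English description precedes it below -/
import Mathlib

section
/- Let k be a nonarchimedean local field and let n ≥ 3 and m ≥ 2 be integers. Then there exist a group homomorphism ρ : F_m → GL_n(k) of the free group F_m with free basis a_1, …, a_m and a real number δ > 0 such that every homomorphism ρ' : F_m → GL_n(k) satisfying ‖ρ'(a_i) − ρ(a_i)‖ < δ for all i = 1, …, m has the following two properties: (1) ρ' is a quasi-isometric embedding, i.e. there exist constants c, θ > 0 such that ‖ρ'(γ)‖ · ‖ρ'(γ)⁻¹‖ ≥ c · e^{θ|γ|} for every γ ∈ F_m; (2) ρ'(a_1) is conjugate in GL_n(k) to a diagonal matrix diag(λ_1, …, λ_n) in which the largest and the second largest values among the absolute values |λ_1|, …, |λ_n| are equal (so ρ'(a_1) has two eigenvalues of equal maximal absolute value). -/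
noncomputable section

/-- The sup-of-entries norm of a square matrix over a normed field. -/
def matSup {k : Type*} [NormedField k] {n : ℕ} (A : Matrix (Fin n) (Fin n) k) : ℝ :=
  ⨆ i, ⨆ j, ‖A i j‖

/-- If conjugation and displacement along a linear section `D` are jointly infinitesimally
surjective at `D d`, then every element close to `D d` is conjugate to some `D e` with `e` close
to `d`. -/
theorem eventually_conj_of_surjective {k R F : Type*} [NontriviallyNormedField k]
    [NormedRing R] [NormedAlgebra k R] [CompleteSpace R] [NormedAddCommGroup F] [NormedSpace k F]
    [CompleteSpace F] (D : F →L[k] R) (d : F)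
    (hsurj : ∀ Z : R, ∃ (X : R) (f : F), D d * X - X * D d - D f = Z)
    {U : Set F} (hU : U ∈ nhds d) :
    ∀ᶠ A in nhds (D d), ∃ P : Rˣ, ∃ e ∈ U, A = P * D e * ((P⁻¹ : Rˣ) : R) := by
  let a : R × R × F := (D d, 1, d)
  let π₁ : R × R × F →L[k] R := ContinuousLinearMap.fst k _ _
  let π₂ : R × R × F →L[k] R :=
    (ContinuousLinearMap.fst k _ _).comp (ContinuousLinearMap.snd k _ _)
  let π₃ : R × R × F →L[k] F :=
    (ContinuousLinearMap.snd k _ _).comp (ContinuousLinearMap.snd k _ _)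
  have hf := (π₁.hasStrictFDerivAt (x := a)).prodMk
    (((π₁.hasStrictFDerivAt (x := a)).mul' (π₂.hasStrictFDerivAt (x := a))).sub
      ((π₂.hasStrictFDerivAt (x := a)).mul' ((D.comp π₃).hasStrictFDerivAt (x := a))))
  have hmap := hf.map_nhds_eq_of_surj (by
    rw [LinearMap.range_eq_top]
    rintro ⟨B, Y⟩
    obtain ⟨X, f, hXf⟩ := hsurj (Y - B)
    refine ⟨(B, X, f), Prod.ext rfl ?_⟩
    simp only [ContinuousLinearMap.coe_coe, ContinuousLinearMap.prod_apply]
    rw [← sub_add_cancel Y B, ← hXf]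
    simp [a, π₁, π₂, π₃]
    abel)
  have hnear : ∀ᶠ p in nhds a, IsUnit (π₂ p) ∧ π₃ p ∈ U :=
    ((π₂.continuous.tendsto a).eventually (Units.isOpen.mem_nhds isUnit_one)).and
      ((π₃.continuous.tendsto a).eventually hU)
  have himg := Filter.image_mem_map hnear (m := fun p => (π₁ p, (⇑π₁ * ⇑π₂ - ⇑π₂ * ⇑(D.comp π₃)) p))
  rw [hmap] at himg
  have hcont : Filter.Tendsto (fun A : R => (A, (0 : R))) (nhds (D d))
      (nhds (π₁ a, (⇑π₁ * ⇑π₂ - ⇑π₂ * ⇑(D.comp π₃)) a)) := by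
    have : (π₁ a, (⇑π₁ * ⇑π₂ - ⇑π₂ * ⇑(D.comp π₃)) a) = (D d, (0 : R)) := by
      simp [a, π₁, π₂, π₃]
    rw [this]
    exact Continuous.tendsto (by fun_prop) _
  filter_upwards [hcont himg] with A hA
  obtain ⟨⟨A', P, e⟩, ⟨⟨P, rfl⟩, he⟩, heq⟩ := hA
  simp only [ContinuousLinearMap.coe_comp, ContinuousLinearMap.coe_fst',
    ContinuousLinearMap.coe_snd', Function.comp_apply, Pi.sub_apply, Pi.mul_apply, Prod.mk.injEq,
    π₁, π₂, π₃] at heq he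
  obtain ⟨rfl, h2⟩ := heq
  exact ⟨P, e, he, (Units.eq_mul_inv_iff_mul_eq P).2 (sub_eq_zero.1 h2)⟩

section DiagonalPerturbation

attribute [local instance] Matrix.linftyOpNormedRing Matrix.linftyOpNormedAlgebra

/-- Matrices close to a diagonal matrix with distinct entries are diagonalizable, with diagonal
entries close to the original ones. -/
theorem eventually_conj_diagonal {k : Type*} [NontriviallyNormedField k] [CompleteSpace k]
    {n : ℕ} {d : Fin n → k} (hd : Function.Injective d) {U : Set (Fin n → k)} (hU : U ∈ nhds d) :
    ∀ᶠ A in nhds (Matrix.diagonal d), ∃ P : (Matrix (Fin n) (Fin n) k)ˣ, ∃ e ∈ U,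
      A = (P : Matrix (Fin n) (Fin n) k) * Matrix.diagonal e *
        ((P⁻¹ : _) : Matrix (Fin n) (Fin n) k) := by
  have : CompleteSpace (Matrix (Fin n) (Fin n) k) := inferInstance
  refine @eventually_conj_of_surjective k (Matrix (Fin n) (Fin n) k) (Fin n → k) _ _ _ this _ _ _
    (Matrix.diagonalLinearMap (Fin n) k k).toContinuousLinearMap d (fun Z => ?_) U hU
  refine ⟨Matrix.of fun i j => Z i j / (d i - d j), fun i => - Z i i, ?_⟩
  change Matrix.diagonal d * _ - _ * Matrix.diagonal d - Matrix.diagonal _ = Z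
  ext i j
  by_cases hij : i = j
  · subst hij; simp
  · have : d i - d j ≠ 0 := sub_ne_zero.2 (hd.ne hij)
    simp [hij]
    field_simp

end DiagonalPerturbation

theorem norm_apply_le_matSup {k : Type*} [NormedField k] {n : ℕ} (A : Matrix (Fin n) (Fin n) k)
    (i j : Fin n) : ‖A i j‖ ≤ matSup A :=
  (le_ciSup (Set.finite_range fun j => ‖A i j‖).bddAbove j).trans
    (le_ciSup (f := fun i => ⨆ j, ‖A i j‖) (Set.finite_range _).bddAbove i)

theorem matSup_nonneg {k : Type*} [NormedField k] {n : ℕ} (A : Matrix (Fin n) (Fin n) k) :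
    0 ≤ matSup A :=
  Real.iSup_nonneg fun _ => Real.iSup_nonneg fun _ => norm_nonneg _

/-- A neighbourhood of a matrix contains a ball for `matSup`. -/
theorem exists_matSup_ball_of_eventually {k : Type*} [NormedField k] {n : ℕ}
    {A : Matrix (Fin n) (Fin n) k} {p : Matrix (Fin n) (Fin n) k → Prop}
    (h : ∀ᶠ B in nhds A, p B) : ∃ δ > 0, ∀ B, matSup (B - A) < δ → p B := by
  obtain ⟨δ, hδ, H⟩ := (Metric.eventually_nhds_iff (α := Fin n → Fin n → k)).1 h
  refine ⟨δ, hδ, fun B hB => H ?_⟩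
  refine (dist_pi_lt_iff hδ).2 fun i => (dist_pi_lt_iff hδ).2 fun j => ?_
  rw [dist_eq_norm]
  exact (norm_apply_le_matSup (B - A) i j).trans_lt hB

/-- Matrix inversion is continuous at units, entrywise. -/
theorem eventually_norm_inv_sub_lt {k : Type*} [NormedField k] {n : ℕ}
    (A : (Matrix (Fin n) (Fin n) k)ˣ) {ε : ℝ} (hε : 0 < ε) :
    ∀ᶠ B in nhds (A : Matrix (Fin n) (Fin n) k), ∀ i j,
      ‖(B⁻¹ - (A : Matrix (Fin n) (Fin n) k)⁻¹) i j‖ < ε := by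
  have hdet : (A : Matrix (Fin n) (Fin n) k).det ≠ 0 :=
    ((Matrix.isUnit_iff_isUnit_det _).1 A.isUnit).ne_zero
  have hc : ContinuousAt (fun B : Matrix (Fin n) (Fin n) k => B.det⁻¹ • B.adjugate) A :=
    ((Continuous.matrix_det continuous_id).continuousAt.inv₀ hdet).smul
      (Continuous.matrix_adjugate continuous_id).continuousAt
  have hinv : ∀ B : Matrix (Fin n) (Fin n) k, B⁻¹ = B.det⁻¹ • B.adjugate := fun B => by
    rw [Matrix.inv_def, Ring.inverse_eq_inv']
  refine Filter.eventually_all.2 fun i => Filter.eventually_all.2 fun j => ?_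
  have hij : ContinuousAt (fun B : Matrix (Fin n) (Fin n) k => (B.det⁻¹ • B.adjugate) i j) A :=
    (continuous_apply_apply i j).continuousAt.comp hc
  filter_upwards [Metric.tendsto_nhds.1 hij ε hε] with B hB
  rw [dist_eq_norm] at hB
  simpa only [hinv, Matrix.sub_apply] using hB

section Ultrametric

variable {k : Type*} [NormedField k] [IsUltrametricDist k] {n : ℕ}

theorem norm_mulVec_le_of_entries {A : Matrix (Fin n) (Fin n) k} {C : ℝ} (hC : 0 ≤ C)
    (hA : ∀ i j, ‖A i j‖ ≤ C) (x : Fin n → k) : ‖A.mulVec x‖ ≤ C * ‖x‖ := by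
  refine (pi_norm_le_iff_of_nonneg (by positivity)).2 fun i => ?_
  change ‖∑ j, A i j * x j‖ ≤ _
  refine IsUltrametricDist.norm_sum_le_of_forall_le_of_nonneg (by positivity) fun j _ => ?_
  rw [norm_mul]
  exact mul_le_mul (hA i j) (norm_le_pi_norm x j) (norm_nonneg _) hC

theorem norm_dotProduct_le_of_entries {φ : Fin n → k} {B : ℝ} (hφ : ‖φ‖ ≤ B) (x : Fin n → k) :
    ‖φ ⬝ᵥ x‖ ≤ B * ‖x‖ := by
  have hB : 0 ≤ B := (norm_nonneg _).trans hφ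
  change ‖∑ j, φ j * x j‖ ≤ _
  refine IsUltrametricDist.norm_sum_le_of_forall_le_of_nonneg (by positivity) fun j _ => ?_
  rw [norm_mul]
  exact mul_le_mul ((norm_le_pi_norm φ j).trans hφ) (norm_le_pi_norm x j) (norm_nonneg _) hB

theorem norm_eq_of_norm_sub_lt {E : Type*} [SeminormedAddCommGroup E] [IsUltrametricDist E]
    {x u : E} (h : ‖x - u‖ < ‖x‖) : ‖u‖ = ‖x‖ := by
  refine le_antisymm ?_ ?_
  · have := IsUltrametricDist.norm_add_le_max x (u - x)
    rwa [add_sub_cancel, norm_sub_rev, max_eq_left h.le] at this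
  · have := IsUltrametricDist.norm_add_le_max (x - u) u
    rw [sub_add_cancel] at this
    exact (le_max_iff.1 this).resolve_left h.not_ge

/-- The vectors that are `η`-close, relative to their norm, to a multiple of an element of `W`. -/
def directionCone (η : ℝ) (W : Set (Fin n → k)) : Set (Fin n → k) :=
  {x | ∃ w ∈ W, ∃ α : k, ‖x - α • w‖ ≤ η * ‖x‖}

omit [IsUltrametricDist k] in
theorem mem_directionCone_self {η : ℝ} (hη : 0 ≤ η) {W : Set (Fin n → k)} {w : Fin n → k}
    (hw : w ∈ W) : w ∈ directionCone η W :=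
  ⟨w, hw, 1, by simpa using mul_nonneg hη (norm_nonneg w)⟩

/-- A large multiple of a rank one matrix, up to a bounded error, expands a cone transverse to its
kernel and maps it close to its image. -/
theorem mulVec_mem_directionCone_of_rank_one {T : k} {v φ : Fin n → k} {W : Set (Fin n → k)}
    {g : Matrix (Fin n) (Fin n) k} {B C ε η : ℝ} (hC : 0 ≤ C) (hη : 0 < η) (hη1 : η < 1)
    (hv : ‖v‖ = 1) (hφ : ‖φ‖ ≤ B) (hB : B * η < ε) (hCT : C ≤ η * (ε * ‖T‖))
    (hg : ∀ i j, ‖(g - T • Matrix.vecMulVec v φ) i j‖ ≤ C)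
    (hW : ∀ w ∈ W, ‖w‖ = 1 ∧ ε ≤ ‖φ ⬝ᵥ w‖) {x : Fin n → k} (hx : x ∈ directionCone η W) :
    g.mulVec x ∈ directionCone η {v} ∧ ε * ‖T‖ * ‖x‖ ≤ ‖g.mulVec x‖ := by
  rcases eq_or_ne x 0 with rfl | hx0
  · simp [directionCone]
  obtain ⟨w, hw, α, hα⟩ := hx
  have hx0' : 0 < ‖x‖ := norm_pos_iff.2 hx0
  have hε : 0 < ε := lt_of_le_of_lt (mul_nonneg ((norm_nonneg _).trans hφ) hη.le) hB
  have hαx : ‖α‖ = ‖x‖ := by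
    have := norm_eq_of_norm_sub_lt (hα.trans_lt (mul_lt_of_lt_one_left hx0' hη1))
    rwa [norm_smul, (hW w hw).1, mul_one] at this
  have hφx : ε * ‖x‖ ≤ ‖φ ⬝ᵥ x‖ := by
    have h1 : ε * ‖x‖ ≤ ‖φ ⬝ᵥ (α • w)‖ := by
      rw [dotProduct_smul, norm_smul, hαx, mul_comm]
      exact mul_le_mul_of_nonneg_left (hW w hw).2 hx0'.le
    have h2 : ‖φ ⬝ᵥ x - φ ⬝ᵥ (α • w)‖ < ε * ‖x‖ := by
      rw [← dotProduct_sub]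
      have hB0 : 0 ≤ B := (norm_nonneg _).trans hφ
      calc _ ≤ B * ‖x - α • w‖ := norm_dotProduct_le_of_entries hφ _
        _ ≤ B * (η * ‖x‖) := by gcongr
        _ = B * η * ‖x‖ := by ring
        _ < ε * ‖x‖ := by gcongr
    rw [norm_sub_rev] at h2
    rwa [norm_eq_of_norm_sub_lt (h2.trans_le h1)]
  have hR : ‖g.mulVec x - (T * (φ ⬝ᵥ x)) • v‖ ≤ C * ‖x‖ := by
    have := norm_mulVec_le_of_entries hC hg x
    rwa [Matrix.sub_mulVec, Matrix.smul_mulVec, Matrix.vecMulVec_mulVec, op_smul_eq_smul,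
      smul_smul] at this
  have hmain : ‖(T * (φ ⬝ᵥ x)) • v‖ = ‖T‖ * ‖φ ⬝ᵥ x‖ := by rw [norm_smul, hv, norm_mul, mul_one]
  have hT : 0 ≤ ‖T‖ := norm_nonneg T
  have hbig : ε * ‖T‖ * ‖x‖ ≤ ‖T‖ * ‖φ ⬝ᵥ x‖ := by nlinarith
  have hRη : C * ‖x‖ ≤ η * (ε * ‖T‖ * ‖x‖) := by nlinarith
  have hnorm : ε * ‖T‖ * ‖x‖ ≤ ‖g.mulVec x‖ := by
    rcases hT.eq_or_lt with h | h
    · simp [← h]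
    · have hpos : 0 < ε * ‖T‖ * ‖x‖ := by positivity
      have hlt : ‖(T * (φ ⬝ᵥ x)) • v - g.mulVec x‖ < ‖(T * (φ ⬝ᵥ x)) • v‖ := by
        rw [norm_sub_rev, hmain]
        nlinarith
      rw [norm_eq_of_norm_sub_lt hlt, hmain]
      exact hbig
  exact ⟨⟨v, rfl, _, hR.trans (hRη.trans (by gcongr))⟩, hnorm⟩

/-- A large multiple of a norm-nonincreasing matrix, up to a bounded error, expands a cone around
vectors whose norm is preserved. -/
theorem mulVec_mem_directionCone_of_norm_eq {T : k} {p : Matrix (Fin n) (Fin n) k}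
    {W W' : Set (Fin n → k)} {g : Matrix (Fin n) (Fin n) k} {C η : ℝ} (hC : 0 ≤ C)
    (hη : 0 ≤ η) (hη1 : η < 1) (hp : ∀ i j, ‖p i j‖ ≤ 1) (hCT : C ≤ η * ‖T‖)
    (hg : ∀ i j, ‖(g - T • p) i j‖ ≤ C)
    (hW : ∀ w ∈ W, ‖w‖ = 1 ∧ ‖p.mulVec w‖ = 1 ∧ p.mulVec w ∈ W') {x : Fin n → k}
    (hx : x ∈ directionCone η W) :
    g.mulVec x ∈ directionCone η W' ∧ ‖T‖ * ‖x‖ ≤ ‖g.mulVec x‖ := by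
  obtain ⟨w, hw, α, hα⟩ := hx
  obtain ⟨hw1, hpw, hpW⟩ := hW w hw
  have hR : ‖g.mulVec x - (T * α) • p.mulVec w‖ ≤ η * (‖T‖ * ‖x‖) := by
    have h1 := norm_mulVec_le_of_entries hC hg x
    have h2 := norm_mulVec_le_of_entries zero_le_one hp (x - α • w)
    have : g.mulVec x - (T * α) • p.mulVec w
        = (g - T • p).mulVec x + T • p.mulVec (x - α • w) := by
      rw [Matrix.sub_mulVec, Matrix.smul_mulVec, Matrix.mulVec_sub, Matrix.mulVec_smul, smul_sub,
        smul_smul]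
      abel
    rw [this]
    refine (IsUltrametricDist.norm_add_le_max _ _).trans (max_le ?_ ?_)
    · calc _ ≤ C * ‖x‖ := h1
        _ ≤ η * ‖T‖ * ‖x‖ := by gcongr
        _ = _ := by ring
    · rw [norm_smul]
      nlinarith [norm_nonneg T]
  have hnorm : ‖T‖ * ‖x‖ ≤ ‖g.mulVec x‖ := by
    rcases (mul_nonneg (norm_nonneg T) (norm_nonneg x)).eq_or_lt with h | h
    · simp [← h]
    · have hx0 : 0 < ‖x‖ := pos_of_mul_pos_right h (norm_nonneg T)
      have hαx : ‖α‖ = ‖x‖ := by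
        have := norm_eq_of_norm_sub_lt (hα.trans_lt (mul_lt_of_lt_one_left hx0 hη1))
        rwa [norm_smul, hw1, mul_one] at this
      have hm : ‖(T * α) • p.mulVec w‖ = ‖T‖ * ‖x‖ := by
        rw [norm_smul, hpw, norm_mul, mul_one, hαx]
      rw [norm_sub_rev] at hR
      have := norm_eq_of_norm_sub_lt
        (hR.trans_lt ((mul_lt_of_lt_one_left h hη1).trans_eq hm.symm))
      rw [this, hm]
  exact ⟨⟨_, hpW, T * α, hR.trans (by gcongr)⟩, hnorm⟩

/-- Ping-pong: if every letter expands the cones attached to the letters that may follow it in a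
reduced word, the norm grows exponentially in the word length. -/
theorem pow_norm_le_matSup_of_pingpong {α : Type*} [DecidableEq α]
    (ρ : FreeGroup α →* (Matrix (Fin n) (Fin n) k)ˣ) (S : α × Bool → Set (Fin n → k)) {K : ℝ}
    (hK : 0 ≤ K) (hn : 0 < n) (hS : ∀ s, ∃ x ∈ S s, x ≠ 0)
    (hstep : ∀ s t, (t.1 = s.1 → t.2 = s.2) → ∀ x ∈ S s,
      (ρ (FreeGroup.mk [t]) : Matrix (Fin n) (Fin n) k).mulVec x ∈ S t ∧
        K * ‖x‖ ≤ ‖(ρ (FreeGroup.mk [t]) : Matrix (Fin n) (Fin n) k).mulVec x‖)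
    (γ : FreeGroup α) :
    K ^ FreeGroup.norm γ ≤ matSup (ρ γ : Matrix (Fin n) (Fin n) k) := by
  have key : ∀ (L : List (α × Bool)) (t : α × Bool), FreeGroup.IsReduced (t :: L) →
      ∃ x : Fin n → k, x ≠ 0 ∧
        (ρ (FreeGroup.mk (t :: L)) : Matrix (Fin n) (Fin n) k).mulVec x ∈ S t ∧
        K ^ (L.length + 1) * ‖x‖ ≤
          ‖(ρ (FreeGroup.mk (t :: L)) : Matrix (Fin n) (Fin n) k).mulVec x‖ := by
    intro L
    induction L with
    | nil =>
      intro t _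
      obtain ⟨x, hx, hx0⟩ := hS t
      have := hstep t t (fun _ => rfl) x hx
      exact ⟨x, hx0, this.1, by simpa using this.2⟩
    | cons s L ih =>
      intro t ht
      obtain ⟨hts, hsL⟩ := List.isChain_cons_cons.1 ht
      obtain ⟨x, hx0, hxS, hxn⟩ := ih s hsL
      have h := hstep s t hts _ hxS
      have hmk : (FreeGroup.mk (t :: s :: L) : FreeGroup α)
          = FreeGroup.mk [t] * FreeGroup.mk (s :: L) := by simp
      rw [Matrix.mulVec_mulVec, ← Units.val_mul, ← map_mul, ← hmk] at h
      refine ⟨x, hx0, h.1, le_trans ?_ h.2⟩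
      rw [List.length_cons, pow_succ', mul_assoc]
      exact mul_le_mul_of_nonneg_left hxn hK
  rcases hγ : γ.toWord with _ | ⟨t, L⟩
  · rw [FreeGroup.toWord_eq_nil_iff] at hγ
    subst hγ
    simpa using norm_apply_le_matSup (1 : Matrix (Fin n) (Fin n) k) ⟨0, hn⟩ ⟨0, hn⟩
  · obtain ⟨x, hx0, -, hx⟩ := key L t (hγ ▸ FreeGroup.isReduced_toWord)
    rw [← hγ, FreeGroup.mk_toWord] at hx
    have hlen : FreeGroup.norm γ = L.length + 1 := by rw [FreeGroup.norm, hγ, List.length_cons]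
    rw [hlen]
    exact le_of_mul_le_mul_right (hx.trans (norm_mulVec_le_of_entries (matSup_nonneg _)
      (norm_apply_le_matSup _) x)) (norm_pos_iff.2 hx0)

end Ultrametric

section Construction

variable {k : Type*} [NormedField k] {r μ : ℕ}

/-- The vector `(1, x, 1, 0, …, 0)`. -/
def spaceVec (r : ℕ) (x : k) : Fin (r + 3) → k := Pi.single 0 1 + Pi.single 1 x + Pi.single 2 1

/-- The vector `(1, x, 0, 0, …, 0)`. -/
def planeVec (r : ℕ) (x : k) : Fin (r + 3) → k := Pi.single 0 1 + Pi.single 1 x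

/-- The linear form `(-y - 1, 1, 1, 0, …, 0)`, which vanishes on `spaceVec r y`. -/
def spaceForm (r : ℕ) (y : k) : Fin (r + 3) → k :=
  Pi.single 0 (-y - 1) + Pi.single 1 1 + Pi.single 2 1

theorem fin_one_ne_zero_add_three : (1 : Fin (r + 3)) ≠ 0 := by simp

theorem fin_two_ne_zero_add_three : (2 : Fin (r + 3)) ≠ 0 := by
  simp [Fin.ext_iff, Nat.mod_eq_of_lt (by omega : 2 < r + 3)]

theorem fin_two_ne_one_add_three : (2 : Fin (r + 3)) ≠ 1 := by
  simp [Fin.ext_iff, Nat.mod_eq_of_lt (by omega : 2 < r + 3)]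

theorem spaceForm_dotProduct_spaceVec (x y : k) : spaceForm r y ⬝ᵥ spaceVec r x = x - y := by
  simp [spaceForm, spaceVec, fin_two_ne_zero_add_three,
    fin_two_ne_one_add_three, fin_one_ne_zero_add_three.symm, fin_two_ne_zero_add_three.symm,
    fin_two_ne_one_add_three.symm]
  ring

theorem spaceForm_dotProduct_planeVec (x y : k) :
    spaceForm r y ⬝ᵥ planeVec r x = x - y - 1 := by
  simp [spaceForm, planeVec, fin_one_ne_zero_add_three.symm, fin_two_ne_zero_add_three.symm,
    fin_two_ne_one_add_three.symm]
  ring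

theorem spaceForm_dotProduct_single (y : k) :
    spaceForm r y ⬝ᵥ Pi.single (2 : Fin (r + 3)) 1 = 1 := by
  simp [spaceForm, fin_two_ne_zero_add_three, fin_two_ne_one_add_three]

theorem norm_spaceVec {x : k} (hx : ‖x‖ ≤ 1) : ‖spaceVec r x‖ = 1 := by
  refine le_antisymm ((pi_norm_le_iff_of_nonneg zero_le_one).2 fun i => ?_) ?_
  · by_cases h0 : i = 0
    · subst h0
      simp [spaceVec, fin_one_ne_zero_add_three.symm, fin_two_ne_zero_add_three.symm]
    by_cases h1 : i = 1
    · subst h1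
      simpa [spaceVec, fin_two_ne_one_add_three.symm] using hx
    by_cases h2 : i = 2 <;> simp [spaceVec, h0, h1, h2, fin_two_ne_zero_add_three,
      fin_two_ne_one_add_three]
  · simpa [spaceVec, fin_one_ne_zero_add_three.symm, fin_two_ne_zero_add_three.symm]
      using norm_le_pi_norm (spaceVec r x) 0

theorem norm_planeVec {x : k} (hx : ‖x‖ ≤ 1) : ‖planeVec r x‖ = 1 := by
  refine le_antisymm ((pi_norm_le_iff_of_nonneg zero_le_one).2 fun i => ?_) ?_
  · by_cases h0 : i = 0
    · subst h0
      simp [planeVec, fin_one_ne_zero_add_three.symm]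
    by_cases h1 : i = 1
    · subst h1
      simpa [planeVec] using hx
    simp [planeVec, h0, h1]
  · simpa [planeVec, fin_one_ne_zero_add_three.symm] using norm_le_pi_norm (planeVec r x) 0

theorem norm_spaceForm_le [IsUltrametricDist k] {y : k} (hy : ‖y‖ ≤ 1) :
    ‖spaceForm r y‖ ≤ 1 := by
  refine (pi_norm_le_iff_of_nonneg zero_le_one).2 fun i => ?_
  by_cases h0 : i = 0
  · subst h0
    have := IsUltrametricDist.norm_add_le_max (-y) (-1)
    rw [norm_neg, norm_neg, norm_one, max_eq_right hy, ← sub_eq_add_neg] at this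
    simpa [spaceForm, fin_one_ne_zero_add_three.symm, fin_two_ne_zero_add_three.symm] using this
  by_cases h1 : i = 1
  · subst h1
    simp [spaceForm, fin_two_ne_one_add_three.symm]
  by_cases h2 : i = 2 <;> simp [spaceForm, h0, h1, h2, fin_two_ne_zero_add_three,
    fin_two_ne_one_add_three]

/-- The projection onto the line of `spaceVec r x` along the kernel of `spaceForm r y`. -/
def lineProj (r : ℕ) (x y : k) : Matrix (Fin (r + 3)) (Fin (r + 3)) k :=
  Matrix.vecMulVec (spaceVec r x) ((x - y)⁻¹ • spaceForm r y)

theorem lineProj_mul_self {x y : k} (h : x ≠ y) :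
    lineProj r x y * lineProj r x y = lineProj r x y := by
  rw [lineProj, Matrix.vecMulVec_mul_vecMulVec, smul_dotProduct, spaceForm_dotProduct_spaceVec,
    smul_eq_mul, inv_mul_cancel₀ (sub_ne_zero.2 h), one_smul]

theorem lineProj_mul_swap (x y : k) : lineProj r x y * lineProj r y x = 0 := by
  rw [lineProj, lineProj, Matrix.vecMulVec_mul_vecMulVec, smul_dotProduct,
    spaceForm_dotProduct_spaceVec, sub_self, smul_zero, zero_smul]
  ext; simp [Matrix.vecMulVec_apply]

/-- The element with eigenvalues `T`, `1`, `T⁻¹` on the line of `spaceVec r x`, the intersection of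
the kernels of `spaceForm r x` and `spaceForm r y`, and the line of `spaceVec r y`. -/
def loxodromic (r : ℕ) (T x y : k) : Matrix (Fin (r + 3)) (Fin (r + 3)) k :=
  T • lineProj r x y + (1 - lineProj r x y - lineProj r y x) + T⁻¹ • lineProj r y x

theorem loxodromic_mul_swap {T x y : k} (hT : T ≠ 0) (h : x ≠ y) :
    loxodromic r T x y * loxodromic r T y x = 1 := by
  simp only [loxodromic, mul_add, add_mul, mul_sub, sub_mul, smul_mul_assoc, mul_smul_comm,
    lineProj_mul_self h, lineProj_mul_self h.symm, lineProj_mul_swap, mul_one, one_mul, smul_smul,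
    smul_add, smul_sub,
    mul_inv_cancel₀ hT, inv_mul_cancel₀ hT, smul_zero]
  module

/-- The diagonal entries `T, T + 1, T⁻¹, q ^ 3, …, q ^ (r + 2)`. -/
def pivotDiag (r : ℕ) (q T : k) : Fin (r + 3) → k := fun i =>
  if i = 0 then T else if i = 1 then T + 1 else if i = 2 then T⁻¹ else q ^ (i : ℕ)

/-- The leading part of the matrix attached to a letter. -/
def leadingPart (r : ℕ) (ξ : Fin (μ + 2) × Bool → k) (t : Fin (μ + 2) × Bool) :
    Matrix (Fin (r + 3)) (Fin (r + 3)) k :=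
  if t.1 = 0 then
    if t.2 then Matrix.diagonal fun i => if i = 0 ∨ i = 1 then 1 else 0
    else Matrix.vecMulVec (Pi.single 2 1) (Pi.single 2 1)
  else lineProj r (ξ t) (ξ (t.1, !t.2))

/-- The attracting directions of a letter. -/
def attractingSet (r : ℕ) (ξ : Fin (μ + 2) × Bool → k) (t : Fin (μ + 2) × Bool) :
    Set (Fin (r + 3) → k) :=
  if t.1 = 0 then
    if t.2 then {w | ∃ s : Fin (μ + 2) × Bool, s.1 ≠ 0 ∧ w = planeVec r (ξ s)}
    else {Pi.single 2 1}
  else {spaceVec r (ξ t)}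

variable [IsUltrametricDist k] {ξ : Fin (μ + 2) × Bool → k} {ε : ℝ}

theorem mulVec_mem_attracting_cone (hξ : ∀ s, ‖ξ s‖ < 1) (hε : 0 < ε) (hε1 : ε < 1)
    (hsep : ∀ s t, s ≠ t → ε ≤ ‖ξ s - ξ t‖) {T : k} {C : ℝ} (hC : 0 ≤ C)
    (hCT : C ≤ ε ^ 4 * ‖T‖) {s t : Fin (μ + 2) × Bool} (hst : t.1 = s.1 → t.2 = s.2)
    {g : Matrix (Fin (r + 3)) (Fin (r + 3)) k}
    (hg : ∀ i j, ‖(g - T • leadingPart r ξ t) i j‖ ≤ C) {x : Fin (r + 3) → k}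
    (hx : x ∈ directionCone (ε ^ 3) (attractingSet r ξ s)) :
    g.mulVec x ∈ directionCone (ε ^ 3) (attractingSet r ξ t) ∧ ε * ‖T‖ * ‖x‖ ≤ ‖g.mulVec x‖ := by
  have hη : 0 < ε ^ 3 := by positivity
  have hη1 : ε ^ 3 < 1 := pow_lt_one₀ hε.le hε1 (by norm_num)
  have hT : 0 ≤ ‖T‖ := norm_nonneg T
  have hη2 : ε ^ 3 < ε := by simpa using pow_lt_pow_right_of_lt_one₀ hε hε1 (by norm_num : 1 < 3)
  have hnorm : ∀ w ∈ attractingSet r ξ s, ‖w‖ = 1 := by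
    intro w hw
    unfold attractingSet at hw
    split_ifs at hw
    · obtain ⟨s', -, rfl⟩ := hw
      exact norm_planeVec (hξ s').le
    · rw [Set.mem_singleton_iff.1 hw, Pi.norm_single, norm_one]
    · rw [Set.mem_singleton_iff.1 hw, norm_spaceVec (hξ s).le]
  have hdiff : ∀ s t, ‖ξ s - ξ t‖ < 1 := fun s t => by
    have := IsUltrametricDist.norm_add_le_max (ξ s) (-ξ t)
    rw [norm_neg, ← sub_eq_add_neg] at this
    exact this.trans_lt (max_lt (hξ s) (hξ t))
  by_cases ht0 : t.1 = 0
  · by_cases ht1 : t.2 = true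
    · have hlead : leadingPart r ξ t = Matrix.diagonal fun i => if i = 0 ∨ i = 1 then 1 else 0 := by
        simp [leadingPart, ht0, ht1]
      rw [hlead] at hg
      have hproj : ∀ w : Fin (r + 3) → k,
          (Matrix.diagonal fun i : Fin (r + 3) => if i = 0 ∨ i = 1 then (1 : k) else 0).mulVec w
            = fun i => if i = 0 ∨ i = 1 then w i else 0 := fun w => by
        ext i; simp [Matrix.mulVec_diagonal]
      have key : ∀ w ∈ attractingSet r ξ s,
          (fun i => if i = 0 ∨ i = 1 then w i else 0) ∈ attractingSet r ξ t := by
        intro w hw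
        simp only [attractingSet, ht0, ht1, if_true]
        by_cases hs0 : s.1 = 0
        · have hs1 : s.2 = true := (hst (ht0.trans hs0.symm)) ▸ ht1
          simp only [attractingSet, hs0, hs1, if_true] at hw
          obtain ⟨s', hs', rfl⟩ := hw
          refine ⟨s', hs', ?_⟩
          ext i
          by_cases h0 : i = 0 <;> by_cases h1 : i = 1 <;> simp [planeVec, h0, h1]
        · simp only [attractingSet, hs0, if_false, Set.mem_singleton_iff] at hw
          subst hw
          refine ⟨s, hs0, ?_⟩
          ext i
          by_cases h0 : i = 0
          · subst h0; simp [planeVec, spaceVec, fin_two_ne_zero_add_three.symm]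
          by_cases h1 : i = 1
          · subst h1; simp [planeVec, spaceVec, fin_two_ne_one_add_three.symm]
          simp [planeVec, h0, h1]
      refine (mulVec_mem_directionCone_of_norm_eq hC hη.le hη1 (fun i j => ?_) ?_ hg
        (fun w hw => ⟨hnorm w hw, ?_, ?_⟩) hx).imp id fun h => ?_
      · rw [Matrix.diagonal_apply]
        split_ifs <;> simp
      · nlinarith [pow_pos hε 3]
      · have := key w hw
        rw [hproj]
        simp only [attractingSet, ht0, ht1, if_true] at this
        obtain ⟨s', -, hs'⟩ := this
        rw [hs', norm_planeVec (hξ s').le]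
      · rw [hproj]
        exact key w hw
      · nlinarith [mul_nonneg hT (norm_nonneg x)]
    · have hlead : leadingPart r ξ t = Matrix.vecMulVec (Pi.single 2 1) (Pi.single 2 1) := by
        simp [leadingPart, ht0, ht1]
      have hatt : attractingSet r ξ t = {Pi.single 2 1} := by simp [attractingSet, ht0, ht1]
      rw [hlead] at hg
      rw [hatt]
      refine mulVec_mem_directionCone_of_rank_one (B := 1) hC hη hη1 ?_ ?_ (by simpa using hη2)
        (by nlinarith) hg (fun w hw => ⟨hnorm w hw, hε1.le.trans_eq ?_⟩) hx
      · rw [Pi.norm_single, norm_one]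
      · rw [Pi.norm_single, norm_one]
      · by_cases hs0 : s.1 = 0
        · have hs1 : ¬ s.2 = true := (hst (ht0.trans hs0.symm)) ▸ ht1
          simp only [attractingSet, hs0, hs1, if_true] at hw
          simp_all
        · simp only [attractingSet, hs0, if_false, Set.mem_singleton_iff] at hw
          subst hw
          simp [spaceVec, fin_two_ne_zero_add_three, fin_two_ne_one_add_three]
  · have hatt : attractingSet r ξ t = {spaceVec r (ξ t)} := by simp [attractingSet, ht0]
    have hlead : leadingPart r ξ t = Matrix.vecMulVec (spaceVec r (ξ t))
        ((ξ t - ξ (t.1, !t.2))⁻¹ • spaceForm r (ξ (t.1, !t.2))) := by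
      simp [leadingPart, ht0, lineProj]
    have hne : t ≠ (t.1, !t.2) := fun h => by simpa using congrArg Prod.snd h
    have hpos : 0 < ‖ξ t - ξ (t.1, !t.2)‖ := hε.trans_le (hsep _ _ hne)
    rw [hlead] at hg
    rw [hatt]
    refine mulVec_mem_directionCone_of_rank_one (B := ε⁻¹) hC hη hη1 (norm_spaceVec (hξ t).le)
      ?_ ?_ (by nlinarith) hg (fun w hw => ⟨hnorm w hw, ?_⟩) hx
    · rw [norm_smul, norm_inv]
      calc _ ≤ ε⁻¹ * 1 := by
            gcongr
            · exact hsep _ _ hne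
            · exact norm_spaceForm_le (hξ _).le
        _ = ε⁻¹ := mul_one _
    · have : ε⁻¹ * ε ^ 3 = ε ^ 2 := by field_simp
      rw [this]
      nlinarith
    · rw [smul_dotProduct, norm_smul, norm_inv]
      have h1 : 1 ≤ ‖ξ t - ξ (t.1, !t.2)‖⁻¹ := (one_le_inv₀ hpos).2 (hdiff _ _).le
      suffices h : ε ≤ ‖spaceForm r (ξ (t.1, !t.2)) ⬝ᵥ w‖ from
        h.trans (le_mul_of_one_le_left (norm_nonneg _) h1)
      by_cases hs0 : s.1 = 0
      · by_cases hs1 : s.2 = true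
        · simp only [attractingSet, hs0, hs1, if_true] at hw
          obtain ⟨s', -, rfl⟩ := hw
          rw [spaceForm_dotProduct_planeVec, norm_sub_rev]
          have : ‖(1 : k)‖ = ‖1 - (ξ s' - ξ (t.1, !t.2))‖ :=
            (norm_eq_of_norm_sub_lt (by
              rw [sub_sub_cancel, norm_one]
              exact hdiff s' (t.1, !t.2))).symm
          rw [← this, norm_one]
          exact hε1.le
        · simp only [attractingSet, hs0, hs1, if_true] at hw
          have hw' : w = Pi.single 2 1 := by simpa using hw
          rw [hw', spaceForm_dotProduct_single, norm_one]
          exact hε1.le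
      · simp only [attractingSet, hs0, if_false, Set.mem_singleton_iff] at hw
        subst hw
        rw [spaceForm_dotProduct_spaceVec]
        refine hsep _ _ fun h => ?_
        have h1 := hst (by rw [h])
        rw [h] at h1
        simp at h1

theorem norm_add_le_of_le_of_isUltrametricDist {E : Type*} [SeminormedAddCommGroup E]
    [IsUltrametricDist E] {x y : E} {C : ℝ} (hx : ‖x‖ ≤ C) (hy : ‖y‖ ≤ C) : ‖x + y‖ ≤ C :=
  (IsUltrametricDist.norm_add_le_max x y).trans (max_le hx hy)

theorem norm_lineProj_apply_le {x y : k} (hx : ‖x‖ ≤ 1) (hy : ‖y‖ ≤ 1) (hε : 0 < ε)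
    (hxy : ε ≤ ‖x - y‖) (i j : Fin (r + 3)) : ‖lineProj r x y i j‖ ≤ ε⁻¹ := by
  rw [lineProj, Matrix.vecMulVec_apply, Pi.smul_apply, smul_eq_mul, norm_mul, norm_mul, norm_inv]
  have h1 : ‖spaceVec r x i‖ ≤ 1 := (norm_le_pi_norm _ i).trans_eq (norm_spaceVec hx)
  have h2 : ‖spaceForm r y j‖ ≤ 1 := (norm_le_pi_norm _ j).trans (norm_spaceForm_le hy)
  calc _ ≤ 1 * (ε⁻¹ * 1) := by gcongr
    _ = ε⁻¹ := by ring

theorem norm_loxodromic_sub_apply_le {T x y : k} (hx : ‖x‖ ≤ 1) (hy : ‖y‖ ≤ 1) (hε : 0 < ε)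
    (hε1 : ε < 1) (hxy : ε ≤ ‖x - y‖) (hT : 1 ≤ ‖T‖) (i j : Fin (r + 3)) :
    ‖(loxodromic r T x y - T • lineProj r x y) i j‖ ≤ ε⁻¹ := by
  have h1 := norm_lineProj_apply_le hx hy hε hxy i j
  have h2 := norm_lineProj_apply_le hy hx hε (by rwa [norm_sub_rev]) i j
  have hone : ‖(1 : Matrix (Fin (r + 3)) (Fin (r + 3)) k) i j‖ ≤ ε⁻¹ := by
    have : 1 ≤ ε⁻¹ := (one_le_inv₀ hε).2 hε1.le
    rw [Matrix.one_apply]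
    split_ifs
    · simpa using this
    · simpa using hε.le
  have h3 : ‖T⁻¹ * lineProj r y x i j‖ ≤ ε⁻¹ := by
    rw [norm_mul, norm_inv]
    calc _ ≤ 1 * ε⁻¹ := by gcongr; exact inv_le_one_of_one_le₀ hT
      _ = ε⁻¹ := one_mul _
  have : (loxodromic r T x y - T • lineProj r x y) i j
      = (1 : Matrix (Fin (r + 3)) (Fin (r + 3)) k) i j + -lineProj r x y i j
        + -lineProj r y x i j + T⁻¹ * lineProj r y x i j := by
    simp [loxodromic]
    ring
  rw [this]
  refine norm_add_le_of_le_of_isUltrametricDist (norm_add_le_of_le_of_isUltrametricDist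
    (norm_add_le_of_le_of_isUltrametricDist hone ?_) ?_) h3 <;> rwa [norm_neg]

theorem norm_add_one_eq {T : k} (hT : 1 < ‖T‖) : ‖T + 1‖ = ‖T‖ :=
  norm_eq_of_norm_sub_lt (by simpa using hT)

omit [IsUltrametricDist k] in
theorem pivotDiag_cases {q T : k} (P : Fin (r + 3) → k → Prop) (h0 : P 0 T) (h1 : P 1 (T + 1))
    (h2 : P 2 T⁻¹) (h : ∀ i : Fin (r + 3), i ≠ 0 → i ≠ 1 → i ≠ 2 → 3 ≤ (i : ℕ) → P i (q ^ (i : ℕ)))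
    (i : Fin (r + 3)) : P i (pivotDiag r q T i) := by
  unfold pivotDiag
  split_ifs with h0' h1' h2'
  · exact h0' ▸ h0
  · exact h1' ▸ h1
  · exact h2' ▸ h2
  · refine h i h0' h1' h2' ?_
    simp only [Fin.ext_iff, Fin.val_zero, Fin.val_one] at h0' h1' h2'
    have : ((2 : Fin (r + 3)) : ℕ) = 2 := Nat.mod_eq_of_lt (by omega : 2 < r + 3)
    omega

theorem pivotDiag_ne_zero {q T : k} (hq : 1 < ‖q‖) (hT : 1 < ‖T‖) (i : Fin (r + 3)) :
    pivotDiag r q T i ≠ 0 := by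
  have hT0 : T ≠ 0 := norm_pos_iff.1 (by linarith)
  have hq0 : q ≠ 0 := norm_pos_iff.1 (by linarith)
  have hT1 : T + 1 ≠ 0 := norm_pos_iff.1 (by rw [norm_add_one_eq hT]; linarith)
  exact pivotDiag_cases (fun _ x => x ≠ 0) hT0 hT1 (inv_ne_zero hT0)
    (fun i _ _ _ _ => pow_ne_zero _ hq0) i

theorem norm_pivotDiag_le {q T : k} (hq : 1 < ‖q‖) (hT : ‖q‖ ^ (r + 3) < ‖T‖)
    (i : Fin (r + 3)) : ‖pivotDiag r q T i‖ ≤ ‖T‖ := by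
  have hT1 : 1 < ‖T‖ := (one_le_pow₀ hq.le).trans_lt hT
  refine pivotDiag_cases (fun _ x => ‖x‖ ≤ ‖T‖) le_rfl (norm_add_one_eq hT1).le ?_
    (fun i _ _ _ _ => ?_) i
  · rw [norm_inv]
    exact (inv_le_one_of_one_le₀ hT1.le).trans hT1.le
  · rw [norm_pow]
    exact (pow_le_pow_right₀ hq.le i.2.le).trans hT.le

theorem pivotDiag_injective {q T : k} (hq : 1 < ‖q‖) (hT : ‖q‖ ^ (r + 3) < ‖T‖) :
    Function.Injective (pivotDiag r q T) := by
  have hT1 : 1 < ‖T‖ := (one_le_pow₀ hq.le).trans_lt hT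
  have hinv : ‖T⁻¹‖ < 1 := by rw [norm_inv]; exact inv_lt_one_of_one_lt₀ hT1
  have hadd := norm_add_one_eq hT1
  have hpow : ∀ i : Fin (r + 3), ‖q ^ (i : ℕ)‖ < ‖T‖ := fun i => by
    rw [norm_pow]
    exact (pow_le_pow_right₀ hq.le i.2.le).trans_lt hT
  have hpow1 : ∀ i : Fin (r + 3), 1 ≤ ‖q ^ (i : ℕ)‖ := fun i => by
    rw [norm_pow]
    exact one_le_pow₀ hq.le
  have hne : ∀ {a b : k}, ‖a‖ ≠ ‖b‖ → a ≠ b := fun h hab => h (by rw [hab])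
  intro i j
  refine pivotDiag_cases (fun i x => x = pivotDiag r q T j → i = j) ?_ ?_ ?_ ?_ i
  · refine pivotDiag_cases (fun j y => T = y → 0 = j) (fun _ => rfl) (fun h => ?_) (fun h => ?_)
      (fun j _ _ _ _ h => ?_) j
    · simp at h
    · exact absurd h (hne (by linarith))
    · exact absurd h (hne (hpow j).ne')
  · refine pivotDiag_cases (fun j y => T + 1 = y → 1 = j) (fun h => ?_) (fun _ => rfl)
      (fun h => ?_) (fun j _ _ _ _ h => ?_) j
    · simp at h
    · exact absurd h (hne (by linarith))
    · exact absurd h (hne (by rw [hadd]; exact (hpow j).ne'))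
  · refine pivotDiag_cases (fun j y => T⁻¹ = y → 2 = j) (fun h => ?_) (fun h => ?_)
      (fun _ => rfl) (fun j _ _ _ _ h => ?_) j
    · exact absurd h (hne (by linarith))
    · exact absurd h (hne (by linarith))
    · exact absurd h (hne (by linarith [hpow1 j]))
  · intro i _ _ _ _
    refine pivotDiag_cases (fun j y => q ^ (i : ℕ) = y → i = j) (fun h => ?_) (fun h => ?_)
      (fun h => ?_) (fun j _ _ _ _ h => ?_) j
    · exact absurd h (hne (hpow i).ne)
    · exact absurd h (hne (by rw [hadd]; exact (hpow i).ne))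
    · exact absurd h (hne (by linarith [hpow1 i]))
    · have := congrArg norm h
      rw [norm_pow, norm_pow] at this
      exact Fin.ext (pow_right_injective₀ (by linarith) hq.ne' this)

omit [IsUltrametricDist k] in
theorem norm_diagonal_pivotDiag_sub_apply_le {q T : k} (hq : 1 < ‖q‖)
    (hT : ‖q‖ ^ (r + 3) < ‖T‖) (ξ : Fin (μ + 2) × Bool → k) (i j : Fin (r + 3)) :
    ‖(Matrix.diagonal (pivotDiag r q T) - T • leadingPart r ξ (0, true)) i j‖
      ≤ ‖q‖ ^ (r + 3) := by
  have hone : 1 ≤ ‖q‖ ^ (r + 3) := one_le_pow₀ hq.le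
  rcases eq_or_ne i j with rfl | hij
  · have hinv : ‖T‖⁻¹ ≤ 1 := inv_le_one_of_one_le₀ (hone.trans hT.le)
    simp only [leadingPart, if_true, Matrix.sub_apply, Matrix.smul_apply,
      Matrix.diagonal_apply_eq, smul_eq_mul]
    refine pivotDiag_cases (fun i x => ‖x - T * (if i = 0 ∨ i = 1 then 1 else 0)‖ ≤ ‖q‖ ^ (r + 3))
      ?_ ?_ ?_ (fun i h0 h1 _ _ => ?_) i
    · simp
    · simpa using hone
    · simpa [fin_two_ne_zero_add_three, fin_two_ne_one_add_three] using hinv.trans hone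
    · simpa [h0, h1] using pow_le_pow_right₀ hq.le i.2.le
  · simp [leadingPart, hij]

theorem norm_diagonal_inv_pivotDiag_sub_apply_le {q T : k} (hq : 1 < ‖q‖) (hT : 1 < ‖T‖)
    (ξ : Fin (μ + 2) × Bool → k) (i j : Fin (r + 3)) :
    ‖(Matrix.diagonal (pivotDiag r q T)⁻¹ - T • leadingPart r ξ (0, false)) i j‖ ≤ 1 := by
  have hlead : leadingPart r ξ (0, false) = Matrix.diagonal (Pi.single 2 1) := by
    ext i j
    simp only [leadingPart, if_true, Bool.false_eq_true, if_false, Matrix.vecMulVec_apply,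
      Matrix.diagonal_apply, Pi.single_apply]
    by_cases hi : i = 2 <;> by_cases hj : j = 2 <;> simp_all [eq_comm]
  rw [hlead]
  rcases eq_or_ne i j with rfl | hij
  · simp only [Matrix.sub_apply, Matrix.smul_apply, Matrix.diagonal_apply_eq, smul_eq_mul,
      Pi.inv_apply]
    refine pivotDiag_cases
      (fun i x => ‖x⁻¹ - T * (Pi.single 2 1 : Fin (r + 3) → k) i‖ ≤ 1)
      ?_ ?_ ?_ (fun i _ _ h2 _ => ?_) i
    · simpa [fin_two_ne_zero_add_three.symm] using inv_le_one_of_one_le₀ hT.le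
    · simpa [fin_two_ne_one_add_three.symm, norm_add_one_eq hT] using inv_le_one_of_one_le₀ hT.le
    · simp
    · simpa [h2] using inv_le_one_of_one_le₀ (one_le_pow₀ hq.le)
  · simp [hij]

/-- The images of the generators, with the size of the error to their leading parts. -/
theorem exists_generators {q T : k} (hq : 1 < ‖q‖) (hT : ‖q‖ ^ (r + 3) < ‖T‖)
    (hξ : ∀ s, ‖ξ s‖ < 1) (hε : 0 < ε) (hε1 : ε < 1) (hsep : ∀ s t, s ≠ t → ε ≤ ‖ξ s - ξ t‖) :
    ∃ A : Fin (μ + 2) → (Matrix (Fin (r + 3)) (Fin (r + 3)) k)ˣ,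
      (A 0 : Matrix (Fin (r + 3)) (Fin (r + 3)) k) = Matrix.diagonal (pivotDiag r q T) ∧
      ∀ l i j,
        ‖((A l : Matrix (Fin (r + 3)) (Fin (r + 3)) k) - T • leadingPart r ξ (l, true)) i j‖
          ≤ max ε⁻¹ (‖q‖ ^ (r + 3)) ∧
        ‖(((A l)⁻¹ : Matrix (Fin (r + 3)) (Fin (r + 3)) k) - T • leadingPart r ξ (l, false)) i j‖
          ≤ max ε⁻¹ (‖q‖ ^ (r + 3)) := by
  have hT1 : 1 < ‖T‖ := (one_le_pow₀ hq.le).trans_lt hT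
  have hT0 : T ≠ 0 := norm_pos_iff.1 (by linarith)
  have hd := pivotDiag_ne_zero (r := r) hq hT1
  have hsplit : ∀ l : Fin (μ + 2), ∃ B : (Matrix (Fin (r + 3)) (Fin (r + 3)) k)ˣ,
      (l = 0 → (B : Matrix (Fin (r + 3)) (Fin (r + 3)) k)
        = Matrix.diagonal (pivotDiag r q T)) ∧
      ∀ i j,
        ‖((B : Matrix (Fin (r + 3)) (Fin (r + 3)) k) - T • leadingPart r ξ (l, true)) i j‖
          ≤ max ε⁻¹ (‖q‖ ^ (r + 3)) ∧
        ‖((B : Matrix (Fin (r + 3)) (Fin (r + 3)) k)⁻¹ - T • leadingPart r ξ (l, false)) i j‖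
          ≤ max ε⁻¹ (‖q‖ ^ (r + 3)) := by
    intro l
    by_cases hl : l = 0
    · subst hl
      refine ⟨⟨Matrix.diagonal (pivotDiag r q T), Matrix.diagonal (pivotDiag r q T)⁻¹,
        by simp [Matrix.diagonal_mul_diagonal, hd], by simp [Matrix.diagonal_mul_diagonal, hd]⟩,
        fun _ => rfl, fun i j => ?_⟩
      rw [← Matrix.coe_units_inv]
      exact ⟨(norm_diagonal_pivotDiag_sub_apply_le hq hT ξ i j).trans (le_max_right _ _),
        ((norm_diagonal_inv_pivotDiag_sub_apply_le hq hT1 ξ i j).trans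
          (one_le_pow₀ hq.le)).trans (le_max_right _ _)⟩
    · have hne : ((l, true) : Fin (μ + 2) × Bool) ≠ (l, false) := by simp
      have hne' : ξ (l, true) ≠ ξ (l, false) :=
        sub_ne_zero.1 (norm_pos_iff.1 (hε.trans_le (hsep _ _ hne)))
      refine ⟨⟨loxodromic r T (ξ (l, true)) (ξ (l, false)),
        loxodromic r T (ξ (l, false)) (ξ (l, true)), loxodromic_mul_swap hT0 hne',
        loxodromic_mul_swap hT0 hne'.symm⟩, fun h => absurd h hl, fun i j => ?_⟩
      have h1 : leadingPart r ξ (l, true) = lineProj r (ξ (l, true)) (ξ (l, false)) := by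
        simp [leadingPart, hl]
      have h2 : leadingPart r ξ (l, false) = lineProj r (ξ (l, false)) (ξ (l, true)) := by
        simp [leadingPart, hl]
      rw [← Matrix.coe_units_inv, h1, h2]
      exact ⟨(norm_loxodromic_sub_apply_le (hξ _).le (hξ _).le hε hε1 (hsep _ _ hne) hT1.le
          i j).trans (le_max_left _ _),
        (norm_loxodromic_sub_apply_le (hξ _).le (hξ _).le hε hε1 (hsep _ _ hne.symm) hT1.le
          i j).trans (le_max_left _ _)⟩
  choose A hA0 hA using hsplit
  exact ⟨A, hA0 0 rfl, hA⟩

/-- Matrices close to a unit have bounded distance to it, and so do their inverses. -/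
theorem eventually_error_le {n : ℕ} {A : (Matrix (Fin n) (Fin n) k)ˣ}
    {L L' : Matrix (Fin n) (Fin n) k} {C : ℝ} (hC : 1 ≤ C)
    (hA : ∀ i j, ‖((A : Matrix (Fin n) (Fin n) k) - L) i j‖ ≤ C ∧
      ‖((A : Matrix (Fin n) (Fin n) k)⁻¹ - L') i j‖ ≤ C) :
    ∀ᶠ B in nhds (A : Matrix (Fin n) (Fin n) k), ∀ i j,
      ‖(B - L) i j‖ ≤ C ∧ ‖(B⁻¹ - L') i j‖ ≤ C := by
  have h1 : ∀ᶠ B in nhds (A : Matrix (Fin n) (Fin n) k), ∀ i j,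
      ‖(B - (A : Matrix (Fin n) (Fin n) k)) i j‖ < 1 := by
    refine Filter.eventually_all.2 fun i => Filter.eventually_all.2 fun j => ?_
    have hij : ContinuousAt (fun B : Matrix (Fin n) (Fin n) k => B i j) A :=
      (continuous_apply_apply i j).continuousAt
    filter_upwards [Metric.tendsto_nhds.1 hij 1 one_pos] with B hB
    rwa [dist_eq_norm] at hB
  filter_upwards [h1, eventually_norm_inv_sub_lt A one_pos] with B hB hB' i j
  constructor
  · rw [← sub_add_sub_cancel B (A : Matrix (Fin n) (Fin n) k) L]
    exact norm_add_le_of_le_of_isUltrametricDist ((hB i j).le.trans hC) (hA i j).1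
  · rw [← sub_add_sub_cancel B⁻¹ (A : Matrix (Fin n) (Fin n) k)⁻¹ L']
    exact norm_add_le_of_le_of_isUltrametricDist ((hB' i j).le.trans hC) (hA i j).2

end Construction

/-- A finite family of distinct elements of the open unit ball, with a uniform separation. -/
theorem exists_separated_family {k ι : Type*} [NormedField k] [Finite ι] {q : k} (hq : 1 < ‖q‖) :
    ∃ (ξ : ι → k) (ε : ℝ), (∀ s, ‖ξ s‖ < 1) ∧ 0 < ε ∧ ε < 1 ∧
      ∀ s t, s ≠ t → ε ≤ ‖ξ s - ξ t‖ := by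
  obtain ⟨f, hf⟩ : ∃ f : ι → ℕ, Function.Injective f := Countable.exists_injective_nat ι
  have hq1 : ‖q‖⁻¹ < 1 := inv_lt_one_of_one_lt₀ hq
  have hq0 : 0 < ‖q‖⁻¹ := inv_pos.2 (by linarith)
  let ξ : ι → k := fun s => q⁻¹ ^ (f s + 1)
  have hξ : Function.Injective ξ := fun s t h => by
    have := congrArg norm h
    simp only [ξ, norm_pow, norm_inv] at this
    exact hf (Nat.succ_injective (pow_right_injective₀ hq0 hq1.ne this))
  have hev : ∀ᶠ ε in nhdsWithin (0 : ℝ) (Set.Ioi 0),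
      ε < 1 ∧ ∀ s t, s ≠ t → ε ≤ ‖ξ s - ξ t‖ := by
    refine Filter.Eventually.filter_mono nhdsWithin_le_nhds ?_
    refine (eventually_lt_nhds one_pos).and (Filter.eventually_all.2 fun s =>
      Filter.eventually_all.2 fun t => ?_)
    by_cases hst : s = t
    · exact Filter.Eventually.of_forall fun _ h => absurd hst h
    · filter_upwards [eventually_le_nhds (norm_pos_iff.2 (sub_ne_zero.2 (hξ.ne hst)))] with ε hε _
      exact hε
  obtain ⟨ε, ⟨h1, h2⟩, h0⟩ := (hev.and self_mem_nhdsWithin).exists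
  refine ⟨ξ, ε, fun s => ?_, h0, h1, h2⟩
  simp only [ξ, norm_pow, norm_inv]
  exact pow_lt_one₀ hq0.le hq1 (Nat.succ_ne_zero _)

/-- over a nonarchimedean local field `k`, for `n ≥ 3` and `m ≥ 2` there is a
representation `ρ : F_m → GL_n(k)` and `δ > 0` such that every `ρ'` with
`‖ρ'(a_i) − ρ(a_i)‖ < δ` for all `i` is a quasi-isometric embedding and sends `a_1` to a
matrix conjugate to a diagonal matrix having two diagonal entries of equal maximal
absolute value. -/
theorem stmt0 {k : Type*} [NormedField k] [CompleteSpace k] [LocallyCompactSpace k]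
    (hna : IsNonarchimedean fun x : k => ‖x‖) (hnt : ∃ x : k, 1 < ‖x‖)
    (n m : ℕ) (hn : 3 ≤ n) (hm : 2 ≤ m) :
    ∃ (ρ : FreeGroup (Fin m) →* (Matrix (Fin n) (Fin n) k)ˣ) (δ : ℝ), 0 < δ ∧
      ∀ ρ' : FreeGroup (Fin m) →* (Matrix (Fin n) (Fin n) k)ˣ,
        (∀ i : Fin m,
          matSup ((ρ' (FreeGroup.of i) : Matrix (Fin n) (Fin n) k)
            - (ρ (FreeGroup.of i) : Matrix (Fin n) (Fin n) k)) < δ) →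
        -- (1) quasi-isometric embedding
        ((∃ c θ : ℝ, 0 < c ∧ 0 < θ ∧ ∀ γ : FreeGroup (Fin m),
            c * Real.exp (θ * (FreeGroup.norm γ : ℝ)) ≤
              matSup (ρ' γ : Matrix (Fin n) (Fin n) k) *
                matSup (((ρ' γ)⁻¹ : _) : Matrix (Fin n) (Fin n) k)) ∧
        -- (2) ρ'(a₁) is conjugate to a diagonal matrix whose two largest diagonal
        -- entries (in absolute value) are equal
        (∃ (P : (Matrix (Fin n) (Fin n) k)ˣ) (d : Fin n → k),
            (ρ' (FreeGroup.of ⟨0, by omega⟩) : Matrix (Fin n) (Fin n) k) =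
              (P : Matrix (Fin n) (Fin n) k) * Matrix.diagonal d *
                ((P⁻¹ : _) : Matrix (Fin n) (Fin n) k) ∧
            ∃ i j : Fin n, i ≠ j ∧ ‖d i‖ = ‖d j‖ ∧ ∀ l : Fin n, ‖d l‖ ≤ ‖d i‖)) := by
  have : IsUltrametricDist k := IsUltrametricDist.isUltrametricDist_of_isNonarchimedean_norm hna
  obtain ⟨r, rfl⟩ : ∃ r, n = r + 3 := ⟨n - 3, by omega⟩
  obtain ⟨μ, rfl⟩ : ∃ μ, m = μ + 2 := ⟨m - 2, by omega⟩
  obtain ⟨q, hq⟩ := hnt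
  obtain ⟨ξ, ε, hξ, hε, hε1, hsep⟩ := exists_separated_family (ι := Fin (μ + 2) × Bool) hq
  set C : ℝ := max ε⁻¹ (‖q‖ ^ (r + 3)) with hC
  have hC1 : 1 ≤ C := (one_le_pow₀ hq.le).trans (le_max_right _ _)
  obtain ⟨T, hCT⟩ : ∃ T : k, C < ε ^ 4 * ‖T‖ := by
    obtain ⟨N, hN⟩ := pow_unbounded_of_one_lt (C / ε ^ 4) hq
    refine ⟨q ^ N, ?_⟩
    rwa [div_lt_iff₀ (by positivity), mul_comm, ← norm_pow] at hN
  have hT0 : 0 ≤ ‖T‖ := norm_nonneg T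
  have hT : ‖q‖ ^ (r + 3) < ‖T‖ := by
    have : ε ^ 4 ≤ 1 := pow_le_one₀ hε.le hε1.le
    have : ‖q‖ ^ (r + 3) ≤ C := le_max_right _ _
    nlinarith
  have hK : 1 < ε * ‖T‖ := by
    have h3 : ε ^ 3 ≤ 1 := pow_le_one₀ hε.le hε1.le
    have : ε ^ 4 * ‖T‖ = ε ^ 3 * (ε * ‖T‖) := by ring
    nlinarith [mul_nonneg hε.le hT0]
  have hT1 : 1 < ‖T‖ := by nlinarith
  obtain ⟨A, hA0, hA⟩ := exists_generators hq hT hξ hε hε1 hsep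
  have hdiag : ∀ᶠ B in nhds (Matrix.diagonal (pivotDiag r q T)),
      ∃ P : (Matrix (Fin (r + 3)) (Fin (r + 3)) k)ˣ,
        ∃ e ∈ {e | ∀ i, ‖e i‖ = ‖pivotDiag r q T i‖},
        B = (P : Matrix (Fin (r + 3)) (Fin (r + 3)) k) * Matrix.diagonal e *
          ((P⁻¹ : _) : Matrix (Fin (r + 3)) (Fin (r + 3)) k) := by
    let _ : NontriviallyNormedField k := { ‹NormedField k› with non_trivial := ⟨q, hq⟩ }
    refine eventually_conj_diagonal (pivotDiag_injective hq hT) (Filter.eventually_all.2 fun i => ?_)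
    have hi : ContinuousAt (fun e : Fin (r + 3) → k => e i) (pivotDiag r q T) :=
      (continuous_apply i).continuousAt
    filter_upwards [Metric.tendsto_nhds.1 hi _
      (norm_pos_iff.2 (pivotDiag_ne_zero hq hT1 i))] with e he
    rw [dist_comm, dist_eq_norm] at he
    exact norm_eq_of_norm_sub_lt he
  have hball : ∀ l : Fin (μ + 2), ∃ δ > 0, ∀ B, matSup (B - (A l : Matrix _ _ k)) < δ →
      (∀ i j, ‖(B - T • leadingPart r ξ (l, true)) i j‖ ≤ C ∧
        ‖(B⁻¹ - T • leadingPart r ξ (l, false)) i j‖ ≤ C) ∧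
      (l = 0 → ∃ P : (Matrix (Fin (r + 3)) (Fin (r + 3)) k)ˣ,
        ∃ e ∈ {e | ∀ i, ‖e i‖ = ‖pivotDiag r q T i‖},
        B = (P : Matrix (Fin (r + 3)) (Fin (r + 3)) k) * Matrix.diagonal e *
          ((P⁻¹ : _) : Matrix (Fin (r + 3)) (Fin (r + 3)) k)) := by
    intro l
    refine exists_matSup_ball_of_eventually ((eventually_error_le hC1 (hA l)).and ?_)
    by_cases hl : l = 0
    · subst hl
      rw [hA0]
      filter_upwards [hdiag] with B hB _ using hB
    · exact Filter.Eventually.of_forall fun _ h => absurd h hl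
  choose δ hδ hδA using hball
  obtain ⟨l₀, hl₀⟩ := Finite.exists_min δ
  refine ⟨FreeGroup.lift A, δ l₀, hδ l₀, fun ρ' hρ' => ?_⟩
  have hρ : ∀ l, _ := fun l => hδA l (ρ' (FreeGroup.of l)) (by
    have := (hρ' l).trans_le (hl₀ l)
    rwa [FreeGroup.lift_apply_of] at this)
  have hletter : ∀ (t : Fin (μ + 2) × Bool) (i j : Fin (r + 3)),
      ‖((ρ' (FreeGroup.mk [t]) : Matrix (Fin (r + 3)) (Fin (r + 3)) k)
        - T • leadingPart r ξ t) i j‖ ≤ C := by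
    rintro ⟨l, _ | _⟩ i j
    · have : (FreeGroup.mk [(l, false)] : FreeGroup (Fin (μ + 2))) = (FreeGroup.of l)⁻¹ := rfl
      rw [this, map_inv, Matrix.coe_units_inv]
      exact ((hρ l).1 i j).2
    · exact ((hρ l).1 i j).1
  have hnonempty : ∀ s, ∃ x ∈ directionCone (ε ^ 3) (attractingSet r ξ s), x ≠ 0 := by
    intro s
    have hη : 0 ≤ ε ^ 3 := by positivity
    suffices h : ∃ w ∈ attractingSet r ξ s, w ≠ 0 by
      obtain ⟨w, hw, hw0⟩ := h
      exact ⟨w, mem_directionCone_self hη hw, hw0⟩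
    have hne : ∀ {w : Fin (r + 3) → k}, ‖w‖ = 1 → w ≠ 0 := fun h =>
      norm_pos_iff.1 (h ▸ one_pos)
    unfold attractingSet
    split_ifs
    · exact ⟨_, ⟨(1, true), by simp, rfl⟩, hne (norm_planeVec (hξ _).le)⟩
    · exact ⟨_, rfl, by simp⟩
    · exact ⟨_, rfl, hne (norm_spaceVec (hξ _).le)⟩
  have hgrowth := pow_norm_le_matSup_of_pingpong ρ' _ (by linarith) (by omega) hnonempty
    fun s t hst x hx => mulVec_mem_attracting_cone hξ hε hε1 hsep (by linarith) hCT.le hst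
      (hletter t) hx
  constructor
  · refine ⟨1, Real.log (ε * ‖T‖), one_pos, Real.log_pos hK, fun γ => ?_⟩
    have h1 := hgrowth γ
    have h2 := hgrowth γ⁻¹
    rw [FreeGroup.norm_inv_eq, map_inv] at h2
    have h3 : 1 ≤ (ε * ‖T‖) ^ FreeGroup.norm γ := one_le_pow₀ hK.le
    rw [one_mul, mul_comm, Real.exp_nat_mul, Real.exp_log (by linarith)]
    exact h1.trans (le_mul_of_one_le_right (matSup_nonneg _) (h3.trans h2))
  · obtain ⟨P, e, he, hPe⟩ := (hρ 0).2 rfl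
    refine ⟨P, e, hPe, 0, 1, fin_one_ne_zero_add_three.symm, ?_, fun l => ?_⟩
    · rw [he, he]
      simp [pivotDiag, norm_add_one_eq hT1]
    · rw [he, he]
      exact (norm_pivotDiag_le hq hT l).trans_eq (by simp [pivotDiag])
end
end

section
/- There exist matrices A, B ∈ GL_3(ℝ) with det A = det B = 1, both diagonalizable over ℂ, such that A has two eigenvalues of equal absolute value which is strictly larger than the absolute value of its third eigenvalue, together with open neighborhoods Ω_1 of A and Ω_2 of B in GL_3(ℂ), with the following property: for every A' ∈ Ω_1 and B' ∈ Ω_2, the unique monoid homomorphism φ : ℤ ∗ ℕ → GL_3(ℂ) from the monoid coproduct of the group (ℤ, +) and the monoid (ℕ, +), sending the generator t of ℤ to A' and the generator s of ℕ to B', is injective (so the subsemigroup of GL_3(ℂ) generated by {A', A'⁻¹, B'} is isomorphic to the free product ℤ ∗ ℤ⁺), and there exist c, θ > 0 such that ‖φ(w)‖ · ‖φ(w)⁻¹‖ ≥ c · e^{θ·ℓ(w)} for every w ∈ ℤ ∗ ℕ, where ℓ(w) is the least number m such that w is a product of m elements of {t, t⁻¹, s} (and ℓ of the identity is 0). -/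
noncomputable section

/-- Euclidean norm on `Fin n → ℂ`. -/
def eN {n : ℕ} (v : Fin n → ℂ) : ℝ :=
  Real.sqrt (∑ i, ‖v i‖ ^ 2)

/-- Operator norm of a complex matrix with respect to the Euclidean norm. -/
def opN {n : ℕ} (A : Matrix (Fin n) (Fin n) ℂ) : ℝ :=
  sInf {c : ℝ | 0 ≤ c ∧ ∀ v : Fin n → ℂ, eN (A.mulVec v) ≤ c * eN v}

/-- Word length with respect to a set `S`: the least `m` such that `g` is a product of `m`
elements of `S` (`0` for the identity). -/
def wlen {G : Type*} [Monoid G] (S : Set G) (g : G) : ℕ :=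
  sInf {m : ℕ | ∃ l : List G, l.length = m ∧ (∀ x ∈ l, x ∈ S) ∧ l.prod = g}


namespace PingPong

/-- The element `tⁿ s t^m₁ s ⋯ s t^mₖ` of a group, for an exponent `n` and a list `m₁, …, mₖ`. -/
def word {G : Type*} [Group G] (t s : G) : ℤ → List ℤ → G
  | n, [] => t ^ n
  | n, m :: l => t ^ n * (s * word t s m l)

/-- A weighted length of the word `tⁿ s t^m₁ s ⋯ s t^mₖ`, in which the letter `s` counts ten
times. -/
def weight : ℤ → List ℤ → ℕ
  | n, [] => n.natAbs
  | n, m :: l => n.natAbs + (10 + weight m l)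

theorem map_word {G H : Type*} [Group G] [Group H] (f : G →* H) (t s : G) (n : ℤ) (l : List ℤ) :
    f (word t s n l) = word (f t) (f s) n l := by
  induction l generalizing n with
  | nil => simp [word]
  | cons m l ih => simp [word, ih]

theorem word_inv_left {G : Type*} [Group G] (t s : G) (n : ℤ) (l : List ℤ) :
    word t⁻¹ s n l = word t s (-n) (l.map Neg.neg) := by
  induction l generalizing n with
  | nil => simp [word]
  | cons m l ih => simp [word, ih]

theorem weight_neg (n : ℤ) (l : List ℤ) : weight (-n) (l.map Neg.neg) = weight n l := by
  induction l generalizing n with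
  | nil => simp [weight]
  | cons m l ih => simp [weight, ih]

/-- Complex `3 × 3` matrices. -/
abbrev Mat := Matrix (Fin 3) (Fin 3) ℂ

/-- The vector on whose neighbourhood the ping-pong is played. -/
def axis : Fin 3 → ℂ := ![2, 1, 2]

/-- The linear form with the same coordinates as `axis`. -/
def form (v : Fin 3 → ℂ) : ℂ := 2 * v 0 + v 1 + 2 * v 2

/-- `v` is a small perturbation of `z • axis`, with `z ≠ 0`. -/
def Near (z : ℂ) (v : Fin 3 → ℂ) : Prop :=
  z ≠ 0 ∧ ∀ i, ‖v i - z * axis i‖ ≤ ‖z‖ / 100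

/-- `v` is non-zero and far from the kernel of `form`. -/
def Far (v : Fin 3 → ℂ) : Prop :=
  form v ≠ 0 ∧ ∀ i, ‖v i‖ ≤ ‖form v‖

/-- The conditions on `t` and `s` under which the ping-pong argument works. -/
structure Good (d : Fin 3 → ℂ) (t s : Matˣ) : Prop where
  diag : (t : Mat) = Matrix.diagonal d
  ne : d 2 ≠ 0
  h10 : ‖d 1‖ ≤ ‖d 0‖
  h20 : 100 * ‖d 2‖ ≤ ‖d 0‖
  h21 : 50 * ‖d 2‖ ≤ ‖d 1‖
  entries : ∀ i j, ‖(s : Mat) i j - 1000 * axis i * axis j‖ ≤ 3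
  det : ‖(s : Mat).det‖ ≤ 2

theorem Near.bounds {z : ℂ} {v : Fin 3 → ℂ} (h : Near z v) :
    0 < ‖z‖ ∧ 1.99 * ‖z‖ ≤ ‖v 0‖ ∧ ‖v 0‖ ≤ 2.01 * ‖z‖ ∧ ‖v 1‖ ≤ 1.01 * ‖z‖ ∧
      1.99 * ‖z‖ ≤ ‖v 2‖ ∧ ‖v 2‖ ≤ 2.01 * ‖z‖ := by
  obtain ⟨hz, h⟩ := h
  have h0 := h 0
  have h1 := h 1
  have h2 := h 2
  simp only [axis, Matrix.cons_val] at h0 h1 h2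
  have e2 : ‖z * 2‖ = 2 * ‖z‖ := by simp [mul_comm]
  have e1 : ‖z * 1‖ = ‖z‖ := by simp
  have a0 := abs_le.1 (abs_norm_sub_norm_le (v 0) (z * 2))
  have a1 := abs_le.1 (abs_norm_sub_norm_le (v 1) (z * 1))
  have a2 := abs_le.1 (abs_norm_sub_norm_le (v 2) (z * 2))
  rw [e2] at a0 a2
  rw [e1] at a1
  refine ⟨norm_pos_iff.2 hz, ?_, ?_, ?_, ?_, ?_⟩ <;> linarith [a0.1, a0.2, a1.1, a1.2, a2.1, a2.2]

theorem near_axis : Near 1 axis := ⟨one_ne_zero, fun i => by simp⟩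

theorem Good.near_mulVec {d : Fin 3 → ℂ} {t s : Matˣ} (h : Good d t s) {v : Fin 3 → ℂ}
    (hv : Far v) : Near (1000 * form v) ((s : Mat).mulVec v) := by
  refine ⟨mul_ne_zero (by norm_num) hv.1, fun i => ?_⟩
  have key : (s : Mat).mulVec v i - 1000 * form v * axis i
      = ∑ j, ((s : Mat) i j - 1000 * axis i * axis j) * v j := by
    simp only [Matrix.mulVec, dotProduct, Fin.sum_univ_three, form]
    have a0 : axis 0 = 2 := rfl
    have a1 : axis 1 = 1 := rfl
    have a2 : axis 2 = 2 := rfl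
    rw [a0, a1, a2]
    ring
  rw [key]
  calc ‖∑ j, ((s : Mat) i j - 1000 * axis i * axis j) * v j‖
      ≤ ∑ _j : Fin 3, 3 * ‖form v‖ := by
        refine norm_sum_le_of_le _ fun j _ => ?_
        rw [norm_mul]
        exact mul_le_mul (h.entries i j) (hv.2 j) (norm_nonneg _) (by norm_num)
    _ ≤ ‖1000 * form v‖ / 100 := by
        simp only [Finset.sum_const, Finset.card_univ, Fintype.card_fin, norm_mul, nsmul_eq_mul]
        norm_num
        linarith [norm_nonneg (form v)]

theorem coe_zpow_eq_diagonal {t : Matˣ} {d : Fin 3 → ℂ} (ht : (t : Mat) = Matrix.diagonal d)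
    (hd : ∀ i, d i ≠ 0) (n : ℤ) : ((t ^ n : Matˣ) : Mat) = Matrix.diagonal fun i => d i ^ n := by
  have hpow : ∀ k : ℕ, ((t ^ k : Matˣ) : Mat) = Matrix.diagonal fun i => d i ^ k := fun k => by
    rw [Units.val_pow_eq_pow_val, ht, Matrix.diagonal_pow]
    rfl
  rcases Int.eq_nat_or_neg n with ⟨k, rfl | rfl⟩
  · simpa using hpow k
  · rw [zpow_neg]
    refine Units.inv_eq_of_mul_eq_one_right ?_
    rw [zpow_natCast, hpow, Matrix.diagonal_mul_diagonal, ← Matrix.diagonal_one]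
    congr 1
    ext i
    simp [hd i]

theorem Good.ne_zero {d : Fin 3 → ℂ} {t s : Matˣ} (h : Good d t s) (i : Fin 3) : d i ≠ 0 := by
  have h2 := norm_pos_iff.2 h.ne
  rw [← norm_pos_iff]
  fin_cases i
  · exact lt_of_lt_of_le (by positivity) h.h20
  · exact lt_of_lt_of_le (by positivity) h.h21
  · exact h2

theorem Good.zpow_mulVec {d : Fin 3 → ℂ} {t s : Matˣ} (h : Good d t s) (n : ℤ)
    (v : Fin 3 → ℂ) (i : Fin 3) : ((t ^ n : Matˣ) : Mat).mulVec v i = d i ^ n * v i := by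
  rw [coe_zpow_eq_diagonal h.diag h.ne_zero, Matrix.mulVec_diagonal]

theorem Good.norm_det_zpow {d : Fin 3 → ℂ} {t s : Matˣ} (h : Good d t s) (n : ℤ) :
    ‖((t ^ n : Matˣ) : Mat).det‖ = ‖d 0‖ ^ n * ‖d 1‖ ^ n * ‖d 2‖ ^ n := by
  rw [coe_zpow_eq_diagonal h.diag h.ne_zero, Matrix.det_diagonal, Fin.prod_univ_three]
  simp

/-- Lower bound for `form` in terms of the coordinate `0`. -/
theorem norm_form_ge_zero (v : Fin 3 → ℂ) : 2 * ‖v 0‖ - ‖v 1‖ - 2 * ‖v 2‖ ≤ ‖form v‖ := by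
  have h1 := norm_sub_norm_le (2 * v 0) (-(v 1 + 2 * v 2))
  have h2 := norm_add_le (v 1) (2 * v 2)
  rw [norm_neg, sub_neg_eq_add, ← add_assoc] at h1
  simp only [norm_mul, Complex.norm_ofNat] at h1 h2
  unfold form
  linarith

/-- Lower bound for `form` in terms of the coordinate `2`. -/
theorem norm_form_ge_two (v : Fin 3 → ℂ) : 2 * ‖v 2‖ - ‖v 1‖ - 2 * ‖v 0‖ ≤ ‖form v‖ := by
  have := norm_form_ge_zero ![v 2, v 1, v 0]
  simp only [form, Matrix.cons_val] at this ⊢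
  rw [show 2 * v 0 + v 1 + 2 * v 2 = 2 * v 2 + v 1 + 2 * v 0 by ring]
  exact this

theorem norm_form_ge_of_near {z : ℂ} {v : Fin 3 → ℂ} (h : Near z v) : 8 * ‖z‖ ≤ ‖form v‖ := by
  obtain ⟨hz, h⟩ := h
  have h0 := h 0
  have h1 := h 1
  have h2 := h 2
  simp only [axis, Matrix.cons_val] at h0 h1 h2
  have e : form v - 9 * z = form ![v 0 - z * 2, v 1 - z * 1, v 2 - z * 2] := by
    simp only [form, Matrix.cons_val]; ring
  have a : ‖form v - 9 * z‖ ≤ 2 * ‖v 0 - z * 2‖ + ‖v 1 - z * 1‖ + 2 * ‖v 2 - z * 2‖ := by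
    rw [e]
    simp only [form, Matrix.cons_val]
    refine (norm_add₃_le).trans ?_
    simp
  have b := norm_sub_norm_le (9 * z) (form v)
  rw [norm_sub_rev] at b
  simp only [norm_mul, Complex.norm_ofNat] at b
  linarith [norm_nonneg z]

theorem forall_fin_three {p : Fin 3 → Prop} (h0 : p 0) (h1 : p 1) (h2 : p 2) : ∀ i, p i := by
  intro i
  fin_cases i
  exacts [h0, h1, h2]

theorem Good.far_zpow {d : Fin 3 → ℂ} {t s : Matˣ} (h : Good d t s) (n : ℤ) {z : ℂ}
    {v : Fin 3 → ℂ} (hv : Near z v) :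
    Far (((t ^ n : Matˣ) : Mat).mulVec v) ∧
      2 ^ n.natAbs * (‖z‖ ^ 3 * ‖((t ^ n : Matˣ) : Mat).det‖) ≤
        ‖form (((t ^ n : Matˣ) : Mat).mulVec v)‖ ^ 3 := by
  obtain ⟨hz, l0, u0, u1, l2, u2⟩ := hv.bounds
  have hf := norm_form_ge_of_near hv
  rw [h.norm_det_zpow]
  set w := ((t ^ n : Matˣ) : Mat).mulVec v with hw
  have w0 : ‖w 0‖ = ‖d 0‖ ^ n * ‖v 0‖ := by rw [hw, h.zpow_mulVec]; simp
  have w1 : ‖w 1‖ = ‖d 1‖ ^ n * ‖v 1‖ := by rw [hw, h.zpow_mulVec]; simp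
  have w2 : ‖w 2‖ = ‖d 2‖ ^ n * ‖v 2‖ := by rw [hw, h.zpow_mulVec]; simp
  have p0 := norm_pos_iff.2 (h.ne_zero 0)
  have p1 := norm_pos_iff.2 (h.ne_zero 1)
  have p2 := norm_pos_iff.2 (h.ne_zero 2)
  have h10 := h.h10
  have h20 := h.h20
  have h21 := h.h21
  have main : ∀ r : ℝ, 0 < r → 2.5 * (r * ‖z‖) ≤ ‖form w‖ →
      ‖w 0‖ ≤ 2.1 * (r * ‖z‖) → ‖w 1‖ ≤ 2.1 * (r * ‖z‖) → ‖w 2‖ ≤ 2.1 * (r * ‖z‖) →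
      2 ^ n.natAbs * (‖d 0‖ ^ n * ‖d 1‖ ^ n * ‖d 2‖ ^ n) ≤ r ^ 3 →
      Far w ∧ 2 ^ n.natAbs * (‖z‖ ^ 3 * (‖d 0‖ ^ n * ‖d 1‖ ^ n * ‖d 2‖ ^ n)) ≤ ‖form w‖ ^ 3 := by
    intro r hr hF e0 e1 e2 hdet
    have hrz : 0 < r * ‖z‖ := by positivity
    refine ⟨⟨norm_pos_iff.1 (by linarith), forall_fin_three (by linarith) (by linarith)
      (by linarith)⟩, ?_⟩
    calc 2 ^ n.natAbs * (‖z‖ ^ 3 * (‖d 0‖ ^ n * ‖d 1‖ ^ n * ‖d 2‖ ^ n))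
        = ‖z‖ ^ 3 * (2 ^ n.natAbs * (‖d 0‖ ^ n * ‖d 1‖ ^ n * ‖d 2‖ ^ n)) := by ring
      _ ≤ ‖z‖ ^ 3 * r ^ 3 := by gcongr
      _ = (r * ‖z‖) ^ 3 := by ring
      _ ≤ ‖form w‖ ^ 3 := by gcongr; linarith
  rcases lt_trichotomy n 0 with hn | hn | hn
  · obtain ⟨k, hk, rfl⟩ : ∃ k : ℕ, 0 < k ∧ n = -(k : ℤ) := ⟨n.natAbs, by omega, by omega⟩
    simp only [zpow_neg, zpow_natCast, Int.natAbs_neg, Int.natAbs_natCast] at *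
    have q2 : 0 < (‖d 2‖ ^ k)⁻¹ := by positivity
    have b0 : (‖d 0‖ ^ k)⁻¹ ≤ (‖d 2‖ ^ k)⁻¹ / 100 := by
      rw [← one_div, ← one_div, div_div]
      refine one_div_le_one_div_of_le (by positivity) ?_
      calc ‖d 2‖ ^ k * 100 ≤ ‖d 2‖ ^ k * 100 ^ k := by
            gcongr; exact le_self_pow₀ (by norm_num) hk.ne'
        _ = (100 * ‖d 2‖) ^ k := by rw [mul_pow, mul_comm]
        _ ≤ ‖d 0‖ ^ k := by gcongr
    have b1 : (‖d 1‖ ^ k)⁻¹ ≤ (‖d 2‖ ^ k)⁻¹ / 50 := by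
      rw [← one_div, ← one_div, div_div]
      refine one_div_le_one_div_of_le (by positivity) ?_
      calc ‖d 2‖ ^ k * 50 ≤ ‖d 2‖ ^ k * 50 ^ k := by
            gcongr; exact le_self_pow₀ (by norm_num) hk.ne'
        _ = (50 * ‖d 2‖) ^ k := by rw [mul_pow, mul_comm]
        _ ≤ ‖d 1‖ ^ k := by gcongr
    have e0 : ‖w 0‖ ≤ (‖d 2‖ ^ k)⁻¹ / 100 * (2.01 * ‖z‖) := by rw [w0]; gcongr
    have e1 : ‖w 1‖ ≤ (‖d 2‖ ^ k)⁻¹ / 50 * (1.01 * ‖z‖) := by rw [w1]; gcongr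
    have e2 : ‖w 2‖ ≤ (‖d 2‖ ^ k)⁻¹ * (2.01 * ‖z‖) := by rw [w2]; gcongr
    have e2' : (‖d 2‖ ^ k)⁻¹ * (1.99 * ‖z‖) ≤ ‖w 2‖ := by rw [w2]; gcongr
    have hF := norm_form_ge_two w
    have hrz : 0 < (‖d 2‖ ^ k)⁻¹ * ‖z‖ := by positivity
    refine main (‖d 2‖ ^ k)⁻¹ q2 (by linarith) (by linarith) (by linarith) (by linarith) ?_
    have : 2 ^ k * (‖d 2‖ ^ k * ‖d 2‖ ^ k) ≤ ‖d 0‖ ^ k * ‖d 1‖ ^ k := by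
      calc 2 ^ k * (‖d 2‖ ^ k * ‖d 2‖ ^ k) = (2 * (‖d 2‖ * ‖d 2‖)) ^ k := by
            rw [mul_pow, mul_pow]
        _ ≤ (‖d 0‖ * ‖d 1‖) ^ k := pow_le_pow_left₀ (by positivity) (by nlinarith) k
        _ = ‖d 0‖ ^ k * ‖d 1‖ ^ k := mul_pow _ _ _
    calc 2 ^ k * ((‖d 0‖ ^ k)⁻¹ * (‖d 1‖ ^ k)⁻¹ * (‖d 2‖ ^ k)⁻¹)
        = (2 ^ k * (‖d 2‖ ^ k * ‖d 2‖ ^ k)) *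
          ((‖d 0‖ ^ k * ‖d 1‖ ^ k)⁻¹ * (‖d 2‖ ^ k)⁻¹ ^ 3) := by field_simp
      _ ≤ (‖d 0‖ ^ k * ‖d 1‖ ^ k) * ((‖d 0‖ ^ k * ‖d 1‖ ^ k)⁻¹ * (‖d 2‖ ^ k)⁻¹ ^ 3) := by gcongr
      _ = (‖d 2‖ ^ k)⁻¹ ^ 3 := by field_simp
  · subst hn
    simp only [zpow_zero, one_mul] at w0 w1 w2
    have hwv : w = v := by simp [hw]
    rw [← hwv] at hf
    refine main 1 one_pos ?_ ?_ ?_ ?_ (by simp) <;> linarith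
  · obtain ⟨k, hk, rfl⟩ : ∃ k : ℕ, 0 < k ∧ n = k := ⟨n.natAbs, by omega, by omega⟩
    simp only [zpow_natCast, Int.natAbs_natCast] at *
    have q0 : 0 < ‖d 0‖ ^ k := by positivity
    have b1 : ‖d 1‖ ^ k ≤ ‖d 0‖ ^ k := by gcongr
    have b2 : ‖d 2‖ ^ k ≤ ‖d 0‖ ^ k / 100 := by
      rw [le_div_iff₀ (by norm_num)]
      calc ‖d 2‖ ^ k * 100 ≤ ‖d 2‖ ^ k * 100 ^ k := by
            gcongr; exact le_self_pow₀ (by norm_num) hk.ne'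
        _ = (100 * ‖d 2‖) ^ k := by rw [mul_pow, mul_comm]
        _ ≤ ‖d 0‖ ^ k := by gcongr
    have e0 : ‖w 0‖ ≤ ‖d 0‖ ^ k * (2.01 * ‖z‖) := by rw [w0]; gcongr
    have e0' : ‖d 0‖ ^ k * (1.99 * ‖z‖) ≤ ‖w 0‖ := by rw [w0]; gcongr
    have e1 : ‖w 1‖ ≤ ‖d 0‖ ^ k * (1.01 * ‖z‖) := by rw [w1]; gcongr
    have e2 : ‖w 2‖ ≤ ‖d 0‖ ^ k / 100 * (2.01 * ‖z‖) := by rw [w2]; gcongr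
    have hF := norm_form_ge_zero w
    have hrz : 0 < ‖d 0‖ ^ k * ‖z‖ := by positivity
    refine main (‖d 0‖ ^ k) q0 (by linarith) (by linarith) (by linarith) (by linarith) ?_
    have : 2 ^ k * ‖d 2‖ ^ k ≤ ‖d 0‖ ^ k := by
      rw [← mul_pow]
      gcongr
      linarith
    calc 2 ^ k * (‖d 0‖ ^ k * ‖d 1‖ ^ k * ‖d 2‖ ^ k)
        = ‖d 0‖ ^ k * ‖d 1‖ ^ k * (2 ^ k * ‖d 2‖ ^ k) := by ring
      _ ≤ ‖d 0‖ ^ k * ‖d 0‖ ^ k * ‖d 0‖ ^ k := by gcongr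
      _ = (‖d 0‖ ^ k) ^ 3 := by ring

theorem Good.zpow_mulVec_ne {d : Fin 3 → ℂ} {t s : Matˣ} (h : Good d t s) {n : ℤ} (hn : 0 < n)
    {z z' : ℂ} {v v' : Fin 3 → ℂ} (hv : Near z v) (hv' : Near z' v') :
    ((t ^ n : Matˣ) : Mat).mulVec v ≠ v' := by
  rintro rfl
  obtain ⟨hz, l0, u0, u1, l2, u2⟩ := hv.bounds
  obtain ⟨hz', l0', u0', u1', l2', u2'⟩ := hv'.bounds
  rw [h.zpow_mulVec] at l0' u0' l2' u2'
  obtain ⟨k, hk, rfl⟩ : ∃ k : ℕ, 0 < k ∧ n = k := ⟨n.natAbs, by omega, by omega⟩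
  simp only [zpow_natCast, norm_mul, norm_pow] at *
  have p0 := norm_pos_iff.2 (h.ne_zero 0)
  have q0 : 0 < ‖d 0‖ ^ k := by positivity
  have h20 := h.h20
  have b2 : ‖d 2‖ ^ k ≤ ‖d 0‖ ^ k / 100 := by
    rw [le_div_iff₀ (by norm_num)]
    calc ‖d 2‖ ^ k * 100 ≤ ‖d 2‖ ^ k * 100 ^ k := by
          gcongr; exact le_self_pow₀ (by norm_num) hk.ne'
      _ = (100 * ‖d 2‖) ^ k := by rw [mul_pow, mul_comm]
      _ ≤ ‖d 0‖ ^ k := by gcongr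
  have e2 : ‖d 2‖ ^ k * ‖v 2‖ ≤ ‖d 0‖ ^ k / 100 * (2.01 * ‖z‖) := by gcongr
  have e0 : ‖d 0‖ ^ k * (1.99 * ‖z‖) ≤ ‖d 0‖ ^ k * ‖v 0‖ := by gcongr
  have hrz : 0 < ‖d 0‖ ^ k * ‖z‖ := by positivity
  linarith

theorem Good.zpow_mulVec_inj {d : Fin 3 → ℂ} {t s : Matˣ} (h : Good d t s) {n m : ℤ}
    {z z' : ℂ} {v v' : Fin 3 → ℂ} (hv : Near z v) (hv' : Near z' v')
    (e : ((t ^ n : Matˣ) : Mat).mulVec v = ((t ^ m : Matˣ) : Mat).mulVec v') : n = m := by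
  have shift : ∀ {n m : ℤ} {v v' : Fin 3 → ℂ},
      ((t ^ n : Matˣ) : Mat).mulVec v = ((t ^ m : Matˣ) : Mat).mulVec v' →
      ((t ^ (n - m) : Matˣ) : Mat).mulVec v = v' := by
    intro n m v v' e
    rw [sub_eq_neg_add, zpow_add, Units.val_mul, ← Matrix.mulVec_mulVec, e, Matrix.mulVec_mulVec,
      ← Units.val_mul, ← zpow_add]
    simp
  rcases lt_trichotomy n m with hnm | hnm | hnm
  · exact absurd (shift e.symm) (h.zpow_mulVec_ne (by omega) hv' hv)
  · exact hnm
  · exact absurd (shift e) (h.zpow_mulVec_ne (by omega) hv hv')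

theorem Good.word_mulVec {d : Fin 3 → ℂ} {t s : Matˣ} (h : Good d t s) (n : ℤ) (l : List ℤ) :
    (∃ z v, Near z v ∧
      ((word t s n l : Matˣ) : Mat).mulVec axis = ((t ^ n : Matˣ) : Mat).mulVec v) ∧
    Far (((word t s n l : Matˣ) : Mat).mulVec axis) ∧
      2 ^ weight n l * ‖((word t s n l : Matˣ) : Mat).det‖ ≤ ‖form (((word t s n l : Matˣ) : Mat).mulVec axis)‖ ^ 3
    := by
  induction l generalizing n with
  | nil =>
    refine ⟨⟨1, axis, near_axis, rfl⟩, ?_⟩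
    simpa [word, weight] using h.far_zpow n near_axis
  | cons m l ih =>
    obtain ⟨-, hfar, hle⟩ := ih m
    have hnear := h.near_mulVec hfar
    have e : ((word t s n (m :: l) : Matˣ) : Mat).mulVec axis = ((t ^ n : Matˣ) : Mat).mulVec
        ((s : Mat).mulVec (((word t s m l : Matˣ) : Mat).mulVec axis)) := by
      simp [word, Matrix.mulVec_mulVec]
    refine ⟨⟨_, _, hnear, e⟩, ?_⟩
    obtain ⟨hfar', hle'⟩ := h.far_zpow n hnear
    rw [e]
    refine ⟨hfar', le_trans ?_ hle'⟩
    have hd := h.det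
    simp only [word, weight, Units.val_mul, Matrix.det_mul, norm_mul, Complex.norm_ofNat, pow_add]
    set D := ‖((t ^ n : Matˣ) : Mat).det‖
    set F := ‖form (((word t s m l : Matˣ) : Mat).mulVec axis)‖
    set W := ‖((word t s m l : Matˣ) : Mat).det‖
    have hF : 0 ≤ F ^ 3 := by positivity
    have : 2 ^ 10 * 2 ^ weight m l * (‖(s : Mat).det‖ * W) ≤ (1000 * F) ^ 3 := by
      calc 2 ^ 10 * 2 ^ weight m l * (‖(s : Mat).det‖ * W)
          = (2 ^ 10 * ‖(s : Mat).det‖) * (2 ^ weight m l * W) := by ring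
        _ ≤ (2 ^ 10 * 2) * F ^ 3 := by gcongr
        _ ≤ (1000 * F) ^ 3 := by rw [mul_pow]; linarith
    calc 2 ^ n.natAbs * (2 ^ 10 * 2 ^ weight m l) * (D * (‖(s : Mat).det‖ * W))
        = 2 ^ n.natAbs * ((2 ^ 10 * 2 ^ weight m l * (‖(s : Mat).det‖ * W)) * D) := by ring
      _ ≤ 2 ^ n.natAbs * ((1000 * F) ^ 3 * D) := by gcongr

theorem Good.mul_word_ne_one {d : Fin 3 → ℂ} {t s : Matˣ} (h : Good d t s) (n : ℤ)
    (l : List ℤ) : s * word t s n l ≠ 1 := by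
  intro e
  have hw : word t s 0 (n :: l) = 1 := by simp [word, e]
  have := (h.word_mulVec 0 (n :: l)).2.2
  rw [hw] at this
  have hf : form axis = 9 := by simp [form, axis]; norm_num
  simp only [weight, Int.natAbs_zero, zero_add, Units.val_one, Matrix.det_one, norm_one, mul_one,
    Matrix.one_mulVec, hf, Complex.norm_ofNat, pow_add] at this
  have h1 : (1 : ℝ) ≤ 2 ^ weight n l := one_le_pow₀ (by norm_num)
  norm_num at this
  linarith

theorem Good.word_injective {d : Fin 3 → ℂ} {t s : Matˣ} (h : Good d t s) {n m : ℤ}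
    {l l' : List ℤ} (e : word t s n l = word t s m l') : n = m ∧ l = l' := by
  induction l generalizing n m l' with
  | nil =>
    obtain ⟨z, v, hv, ev⟩ := (h.word_mulVec n []).1
    obtain ⟨z', v', hv', ev'⟩ := (h.word_mulVec m l').1
    have hnm := h.zpow_mulVec_inj hv hv' (by rw [← ev, ← ev', e])
    subst hnm
    cases l' with
    | nil => exact ⟨rfl, rfl⟩
    | cons k l' => exact absurd (by simpa [word] using e.symm) (h.mul_word_ne_one k l')
  | cons j l ih =>
    obtain ⟨z, v, hv, ev⟩ := (h.word_mulVec n (j :: l)).1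
    obtain ⟨z', v', hv', ev'⟩ := (h.word_mulVec m l').1
    have hnm := h.zpow_mulVec_inj hv hv' (by rw [← ev, ← ev', e])
    subst hnm
    cases l' with
    | nil => exact absurd (by simpa [word] using e) (h.mul_word_ne_one j l)
    | cons k l' =>
      have := ih (n := j) (m := k) (l' := l') (by simpa [word] using e)
      exact ⟨rfl, by rw [this.1, this.2]⟩

theorem opN_set_nonempty {n : ℕ} (M : Matrix (Fin n) (Fin n) ℂ) :
    {c : ℝ | 0 ≤ c ∧ ∀ v : Fin n → ℂ, eN (M.mulVec v) ≤ c * eN v}.Nonempty := by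
  have hE : ∀ v : Fin n → ℂ, eN v = ‖WithLp.toLp 2 v‖ := fun v => by
    simp [eN, EuclideanSpace.norm_eq]
  refine ⟨‖Matrix.toEuclideanCLM (n := Fin n) (𝕜 := ℂ) M‖, norm_nonneg _, fun v => ?_⟩
  rw [hE, hE, ← Matrix.toEuclideanCLM_toLp]
  exact ContinuousLinearMap.le_opNorm _ _

theorem opN_nonneg {n : ℕ} (M : Matrix (Fin n) (Fin n) ℂ) : 0 ≤ opN M :=
  Real.sInf_nonneg fun _ h => h.1

theorem norm_entry_le_opN {n : ℕ} (M : Matrix (Fin n) (Fin n) ℂ) (i j : Fin n) :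
    ‖M i j‖ ≤ opN M := by
  refine le_csInf (opN_set_nonempty M) fun c hc => ?_
  have h := hc.2 (Pi.single j 1)
  have h1 : eN (Pi.single j (1 : ℂ)) = 1 := by
    unfold eN
    rw [Finset.sum_eq_single j (fun k _ hk => by simp [hk]) (by simp)]
    simp
  rw [h1, mul_one, Matrix.mulVec_single_one] at h
  refine le_trans ?_ h
  unfold eN
  refine Real.le_sqrt_of_sq_le ?_
  exact Finset.single_le_sum (f := fun k => ‖M.col j k‖ ^ 2) (fun k _ => by positivity)
    (Finset.mem_univ i)

theorem norm_det_le_opN (M : Mat) : ‖M.det‖ ≤ 6 * opN M ^ 3 := by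
  have h : ‖M.det‖ ≤ _ := Matrix.det_le (A := M) (abv := NormedField.toAbsoluteValue ℂ)
    (x := opN M) (norm_entry_le_opN M)
  simpa [Nat.factorial] using h

theorem exists_norm_dotProduct_le {n : ℕ} (x y : Fin n → ℂ) :
    ∃ C : ℝ, 0 ≤ C ∧ ∀ M : Matrix (Fin n) (Fin n) ℂ, ‖x ⬝ᵥ M.mulVec y‖ ≤ C * opN M := by
  refine ⟨∑ i, ∑ j, ‖x i‖ * ‖y j‖, by positivity, fun M => ?_⟩
  simp only [dotProduct, Matrix.mulVec, Finset.mul_sum, Finset.sum_mul]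
  refine norm_sum_le_of_le _ fun i _ => norm_sum_le_of_le _ fun j _ => ?_
  rw [norm_mul, norm_mul]
  calc ‖x i‖ * (‖M i j‖ * ‖y j‖) = ‖x i‖ * ‖y j‖ * ‖M i j‖ := by ring
    _ ≤ ‖x i‖ * ‖y j‖ * opN M := by gcongr; exact norm_entry_le_opN M i j

theorem form_eq_dotProduct (v : Fin 3 → ℂ) : form v = axis ⬝ᵥ v := by
  simp [form, axis, dotProduct, Fin.sum_univ_three]

/-- The contragredient `M ↦ (M⁻¹)ᵀ`. -/
def contragredient : Matˣ →* Matˣ where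
  toFun u := ⟨((u⁻¹ : Matˣ) : Mat).transpose, (u : Mat).transpose,
    by rw [← Matrix.transpose_mul, Units.mul_inv, Matrix.transpose_one],
    by rw [← Matrix.transpose_mul, Units.inv_mul, Matrix.transpose_one]⟩
  map_one' := Units.ext (by simp)
  map_mul' u v := Units.ext (by
    change ((u * v)⁻¹ : Matˣ).val.transpose = (u⁻¹ : Matˣ).val.transpose * (v⁻¹ : Matˣ).val.transpose
    rw [mul_inv_rev, Units.val_mul, Matrix.transpose_mul])

/-- A signed permutation matrix exchanging the first two coordinates. -/
def flip : Matˣ where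
  val := !![0, 1, 0; 1, 0, 0; 0, 0, -1]
  inv := !![0, 1, 0; 1, 0, 0; 0, 0, -1]
  val_inv := by ext i j; fin_cases i <;> fin_cases j <;> simp [Matrix.mul_apply, Fin.sum_univ_three]
  inv_val := by ext i j; fin_cases i <;> fin_cases j <;> simp [Matrix.mul_apply, Fin.sum_univ_three]

/-- A homomorphism onto a ping-pong pair controlling the growth of words in `a` and `b`. -/
def Controlled (a b : Matˣ) : Prop :=
  ∃ (F : Matˣ →* Matˣ) (d : Fin 3 → ℂ) (t s : Matˣ) (C : ℝ), Good d t s ∧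
    (F a = t ∨ F a = t⁻¹) ∧ F b = s ∧ 0 ≤ C ∧
    ∀ M : Matˣ, ‖form ((F M : Mat).mulVec axis)‖ ^ 3 ≤
      C * ‖(F M : Mat).det‖ * (opN (M : Mat) * opN ((M⁻¹ : Matˣ) : Mat)) ^ 3

theorem Controlled.word {a b : Matˣ} (h : Controlled a b) :
    (∀ n m l l', word a b n l = word a b m l' → n = m ∧ l = l') ∧
      ∃ C : ℝ, 0 ≤ C ∧ ∀ n l, 2 ^ weight n l ≤
        C * (opN ((PingPong.word a b n l : Matˣ) : Mat) *
          opN (((PingPong.word a b n l)⁻¹ : Matˣ) : Mat)) ^ 3 := by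
  obtain ⟨F, d, t, s, C, hG, hFa, hFb, hC, hF⟩ := h
  have key : ∃ f : ℤ → ℤ, f.Injective ∧ (∀ n l, weight (f n) (l.map f) = weight n l) ∧
      ∀ n l, F (PingPong.word a b n l) = PingPong.word t s (f n) (l.map f) := by
    rcases hFa with hFa | hFa
    · exact ⟨id, Function.injective_id, by simp, fun n l => by simp [map_word, hFa, hFb]⟩
    · exact ⟨Neg.neg, neg_injective, weight_neg, fun n l => by
        rw [map_word, hFa, hFb, word_inv_left]⟩
  obtain ⟨f, hf, hfw, hff⟩ := key
  refine ⟨fun n m l l' e => ?_, C, hC, fun n l => ?_⟩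
  · have := hG.word_injective (by rw [← hff, ← hff, e] :
      PingPong.word t s (f n) (l.map f) = PingPong.word t s (f m) (l'.map f))
    exact ⟨hf this.1, List.map_injective_iff.2 hf this.2⟩
  · have h1 := (hG.word_mulVec (f n) (l.map f)).2.2
    have h2 := hF (PingPong.word a b n l)
    rw [hff] at h2
    rw [hfw] at h1
    have hdet : 0 < ‖((PingPong.word t s (f n) (l.map f) : Matˣ) : Mat).det‖ :=
      norm_pos_iff.2 ((Matrix.isUnit_iff_isUnit_det _).1 (Units.isUnit _)).ne_zero
    refine le_of_mul_le_mul_right ((h1.trans h2).trans_eq ?_) hdet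
    ring

theorem one_le_norm_det (M : Matˣ) :
    1 ≤ ‖(M : Mat).det‖ * (6 * opN ((M⁻¹ : Matˣ) : Mat) ^ 3) := by
  calc (1 : ℝ) = ‖(M : Mat).det‖ * ‖((M⁻¹ : Matˣ) : Mat).det‖ := by
        rw [← norm_mul, ← Matrix.det_mul, Units.mul_inv, Matrix.det_one, norm_one]
    _ ≤ _ := by gcongr; exact norm_det_le_opN _

/-- The other axis, which is attracting for the inverse of the second generator. -/
def coaxis : Fin 3 → ℂ := ![1, 2, -2]

theorem controlled_of_conj {a b P S : Matˣ} {d : Fin 3 → ℂ} (hd2 : d 2 ≠ 0)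
    (hd0 : 100 * ‖d 2‖ < ‖d 0‖) (hd1 : 100 * ‖d 2‖ < ‖d 1‖)
    (haP : (a : Mat) * P = P * Matrix.diagonal d) (hS : S = P⁻¹ * b * P)
    (hS1 : ∀ i j, ‖(S : Mat) i j - 1000 * axis i * axis j‖ ≤ 3)
    (hS2 : ∀ i j, ‖((S⁻¹ : Matˣ) : Mat) i j - 1000 * coaxis i * coaxis j‖ ≤ 3)
    (hS3 : ‖(S : Mat).det‖ ≤ 2) (hS4 : ‖((S⁻¹ : Matˣ) : Mat).det‖ ≤ 2) :
    Controlled a b := by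
  have haP' : ((P⁻¹ * a * P : Matˣ) : Mat) = Matrix.diagonal d := by
    rw [mul_assoc, Units.val_mul, Units.val_mul, haP, ← mul_assoc, Units.inv_mul, one_mul]
  have h2 := norm_nonneg (d 2)
  have conj_eq : ∀ M : Matˣ, (MulAut.conj P⁻¹).toMonoidHom M = P⁻¹ * M * P := fun M => by
    simp
  have det_conj : ∀ M : Matˣ, ((P⁻¹ * M * P : Matˣ) : Mat).det = (M : Mat).det := fun M => by
    rw [Units.val_mul, Units.val_mul, Matrix.det_mul_right_comm, ← Units.val_mul]
    simp
  by_cases hc : ‖d 1‖ ≤ ‖d 0‖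
  · obtain ⟨C, hC, hb⟩ := exists_norm_dotProduct_le
      (Matrix.vecMul axis ((P⁻¹ : Matˣ) : Mat)) ((P : Mat).mulVec axis)
    refine ⟨(MulAut.conj P⁻¹).toMonoidHom, d, P⁻¹ * a * P, S, C ^ 3 * 6,
      ⟨haP', hd2, hc, hd0.le, by linarith, hS1, hS3⟩, Or.inl (conj_eq a),
      (conj_eq b).trans hS.symm, by positivity, fun M => ?_⟩
    rw [conj_eq, det_conj]
    have e : form (((P⁻¹ * M * P : Matˣ) : Mat).mulVec axis) =
        Matrix.vecMul axis ((P⁻¹ : Matˣ) : Mat) ⬝ᵥ (M : Mat).mulVec ((P : Mat).mulVec axis) := by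
      rw [form_eq_dotProduct, ← Matrix.dotProduct_mulVec, Matrix.mulVec_mulVec,
        Matrix.mulVec_mulVec]
      rfl
    have h1 := one_le_norm_det M
    have hM := opN_nonneg (M : Mat)
    calc _ ≤ (C * opN (M : Mat)) ^ 3 := by rw [e]; gcongr; exact hb _
      _ = (C * opN (M : Mat)) ^ 3 * 1 := by ring
      _ ≤ (C * opN (M : Mat)) ^ 3 * (‖(M : Mat).det‖ * (6 * opN ((M⁻¹ : Matˣ) : Mat) ^ 3)) := by
        gcongr
      _ = _ := by ring
  · obtain ⟨C, hC, hb⟩ := exists_norm_dotProduct_le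
      (Matrix.vecMul coaxis ((P⁻¹ : Matˣ) : Mat)) ((P : Mat).mulVec coaxis)
    have hflip : ((flip⁻¹ : Matˣ) : Mat) = flip := rfl
    have hflip' : (flip : Mat) = !![0, 1, 0; 1, 0, 0; 0, 0, -1] := rfl
    set F : Matˣ →* Matˣ := (MulAut.conj flip).toMonoidHom.comp
      (contragredient.comp (MulAut.conj P⁻¹).toMonoidHom) with hFdef
    have F_eq : ∀ M : Matˣ, (F M : Mat) =
        flip * ((P⁻¹ * M * P : Matˣ)⁻¹ : Matˣ).val.transpose * flip := fun M => by
      have : F M = flip * contragredient (P⁻¹ * M * P) * flip⁻¹ := by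
        simp only [hFdef, MonoidHom.comp_apply, conj_eq]
        rfl
      rw [this, Units.val_mul, Units.val_mul, hflip]
      rfl
    have F_apply : ∀ M : Matˣ, (F M : Mat) = !![0, 1, 0; 1, 0, 0; 0, 0, -1] *
        ((P⁻¹ * M * P : Matˣ)⁻¹ : Matˣ).val.transpose * !![0, 1, 0; 1, 0, 0; 0, 0, -1] := F_eq
    have F_det : ∀ M : Matˣ, (F M : Mat).det = ((M⁻¹ : Matˣ) : Mat).det := fun M => by
      rw [F_apply, Matrix.det_mul, Matrix.det_mul, Matrix.det_transpose,
        show (P⁻¹ * M * P : Matˣ)⁻¹ = P⁻¹ * M⁻¹ * P by group, det_conj]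
      simp [Matrix.det_fin_three]
    have F_b : ∀ i j, ‖(F b : Mat) i j - 1000 * axis i * axis j‖ ≤ 3 := by
      rw [F_apply, ← hS]
      generalize S⁻¹ = R at hS2
      have e : !![0, 1, 0; 1, 0, 0; 0, 0, -1] * (R : Mat).transpose *
          !![0, 1, 0; 1, 0, 0; 0, 0, -1] = !![R.val 1 1, R.val 0 1, -R.val 2 1;
            R.val 1 0, R.val 0 0, -R.val 2 0; -R.val 1 2, -R.val 0 2, R.val 2 2] := by
        ext i j
        fin_cases i <;> fin_cases j <;>
          simp [Matrix.mul_apply, Matrix.vecMul, dotProduct, Fin.sum_univ_three]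
      rw [e]
      have neg_aux : ∀ {x y : ℂ}, ‖x - y‖ ≤ 3 → ‖-x - -y‖ ≤ 3 := fun {x y} hxy => by
        rwa [← neg_sub_neg, norm_sub_rev] at hxy
      intro i j
      fin_cases i <;> fin_cases j
      · convert hS2 1 1 using 3 <;> simp [axis, coaxis]
      · convert hS2 0 1 using 3 <;> simp [axis, coaxis]
      · convert neg_aux (hS2 2 1) using 3 <;> simp [axis, coaxis]
      · convert hS2 1 0 using 3 <;> simp [axis, coaxis]
      · convert hS2 0 0 using 3 <;> simp [axis, coaxis]
      · convert neg_aux (hS2 2 0) using 3 <;> simp [axis, coaxis]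
      · convert neg_aux (hS2 1 2) using 3 <;> simp [axis, coaxis]
      · convert neg_aux (hS2 0 2) using 3 <;> simp [axis, coaxis]
      · convert hS2 2 2 using 3 <;> simp [axis, coaxis]
    have F_a : ((F a)⁻¹ : Matˣ).val = Matrix.diagonal ![d 1, d 0, d 2] := by
      rw [← map_inv, F_apply]
      rw [show (P⁻¹ * a⁻¹ * P : Matˣ)⁻¹ = P⁻¹ * a * P by group, haP']
      ext i j
      fin_cases i <;> fin_cases j <;>
        simp [Matrix.mul_apply, Matrix.vecMul, dotProduct, Fin.sum_univ_three]
    have bdet : ((S⁻¹ : Matˣ) : Mat).det = ((b⁻¹ : Matˣ) : Mat).det := by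
      rw [hS, show (P⁻¹ * b * P : Matˣ)⁻¹ = P⁻¹ * b⁻¹ * P by group, det_conj]
    refine ⟨F, ![d 1, d 0, d 2], (F a)⁻¹, F b, C ^ 3 * 6,
      ⟨F_a, hd2, (not_le.1 hc).le, hd1.le, ?_, F_b, by rw [F_det, ← bdet]; exact hS4⟩,
      Or.inr (inv_inv _).symm, rfl, by positivity, fun M => ?_⟩
    · simp only [Matrix.cons_val]
      linarith
    rw [F_det]
    have flip_axis : (flip : Mat).mulVec axis = coaxis := by
      rw [hflip']
      ext i
      fin_cases i <;> simp [axis, coaxis, Matrix.mulVec, dotProduct, Fin.sum_univ_three]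
    have axis_flip : Matrix.vecMul axis (flip : Mat) = coaxis := by
      rw [hflip']
      ext i
      fin_cases i <;> simp [axis, coaxis, Matrix.vecMul, dotProduct, Fin.sum_univ_three]
    have e : form ((F M : Mat).mulVec axis) = Matrix.vecMul coaxis ((P⁻¹ : Matˣ) : Mat) ⬝ᵥ
        ((M⁻¹ : Matˣ) : Mat).mulVec ((P : Mat).mulVec coaxis) := by
      rw [form_eq_dotProduct, F_eq, ← Matrix.mulVec_mulVec, ← Matrix.mulVec_mulVec,
        flip_axis, Matrix.dotProduct_mulVec, axis_flip, Matrix.mulVec_transpose,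
        dotProduct_comm, ← Matrix.dotProduct_mulVec,
        show (P⁻¹ * M * P : Matˣ)⁻¹ = P⁻¹ * M⁻¹ * P by group, ← Matrix.dotProduct_mulVec,
        Matrix.mulVec_mulVec, Matrix.mulVec_mulVec]
      rfl
    have h1 := one_le_norm_det M⁻¹
    rw [inv_inv] at h1
    have hM := opN_nonneg ((M⁻¹ : Matˣ) : Mat)
    calc _ ≤ (C * opN ((M⁻¹ : Matˣ) : Mat)) ^ 3 := by rw [e]; gcongr; exact hb _
      _ = (C * opN ((M⁻¹ : Matˣ) : Mat)) ^ 3 * 1 := by ring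
      _ ≤ (C * opN ((M⁻¹ : Matˣ) : Mat)) ^ 3 *
          (‖((M⁻¹ : Matˣ) : Mat).det‖ * (6 * opN (M : Mat) ^ 3)) := by
        gcongr
      _ = _ := by ring

section Perturbation

open scoped Matrix.Norms.Operator
open Topology Filter

/-- The diagonal part of a matrix. -/
def diagonalPart : Mat →ₗ[ℂ] Mat :=
  Matrix.diagonalLinearMap (Fin 3) ℂ ℂ ∘ₗ Matrix.diagLinearMap (Fin 3) ℂ ℂ

theorem diagonalPart_apply (X : Mat) : diagonalPart X = Matrix.diagonal fun i => X i i := rfl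

/-- A matrix close to a diagonal matrix with distinct entries has an eigenbasis close to the
standard basis and eigenvalues close to the diagonal entries. -/
theorem eventually_eigenbasis {d : Fin 3 → ℂ} (hd : d.Injective) {W : Set Matˣ}
    (hW : W ∈ 𝓝 1) {V : Set (Fin 3 → ℂ)} (hV : V ∈ 𝓝 d) :
    ∀ᶠ A : Mat in 𝓝 (Matrix.diagonal d), ∃ P ∈ W, ∃ e ∈ V,
      A * (P : Mat) = P * Matrix.diagonal e := by
  set D : Mat := Matrix.diagonal d with hD
  set L : Mat →L[ℂ] Mat := LinearMap.toContinuousLinearMap diagonalPart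
  have hL : ∀ X, L X = Matrix.diagonal fun i => X i i := diagonalPart_apply
  have h1 : HasStrictFDerivAt (fun x : Mat × Mat => x.1) (ContinuousLinearMap.fst ℂ Mat Mat)
    (D, 0) := hasStrictFDerivAt_fst
  have h2 : HasStrictFDerivAt (fun x : Mat × Mat => x.2) (ContinuousLinearMap.snd ℂ Mat Mat)
    (D, 0) := hasStrictFDerivAt_snd
  have h3 := L.hasStrictFDerivAt.comp (D, (0 : Mat)) h2
  have h4 := (h2.sub h3).const_add 1
  have h5 := h3.const_add D
  have h6 := h1.prodMk ((h1.mul' h4).sub (h4.mul' h5))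
  have hf := h6.map_nhds_eq_of_surj (by
    rw [LinearMap.range_eq_top]
    rintro ⟨Y, Z⟩
    obtain ⟨X, hX⟩ : ∃ X : Mat, ∀ i j,
        X i j = if i = j then (Y - Z) i j else (Z - Y) i j / (d i - d j) :=
      ⟨Matrix.of fun i j => _, fun i j => rfl⟩
    refine ⟨(Y, X), Prod.ext rfl ?_⟩
    change D * (X - L X) + Y * (1 + (0 - L 0)) -
      ((1 + (0 - L 0)) * L X + (X - L X) * (D + L 0)) = Z
    rw [map_zero, sub_zero, add_zero, add_zero, mul_one, one_mul, hL]
    ext i j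
    by_cases hij : i = j
    · subst hij
      simp [hD, hX]
    · have := sub_ne_zero.2 (hd.ne hij)
      simp [hD, hX, hij]
      field_simp
      ring)
  have hU : ∀ᶠ x : Mat × Mat in 𝓝 (D, 0), ∃ P ∈ W, (P : Mat) = 1 + (x.2 - L x.2) := by
    have hW' : Units.val '' W ∈ 𝓝 ((1 : Matˣ) : Mat) :=
      Units.isOpenEmbedding_val.isOpenMap.image_mem_nhds hW
    have hc : Continuous fun x : Mat × Mat => 1 + (x.2 - L x.2) := by fun_prop
    have h0 : (1 : Mat) + ((0 : Mat) - L 0) = (1 : Matˣ) := by simp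
    rw [← h0] at hW'
    exact (hc.continuousAt (x := (D, 0))).preimage_mem_nhds hW'
  have hU' : ∀ᶠ x : Mat × Mat in 𝓝 (D, 0), d + (fun i => x.2 i i) ∈ V := by
    have hc : Continuous fun x : Mat × Mat => d + (fun i => x.2 i i) := by fun_prop
    have h0 : d + (fun i => (0 : Mat) i i) = d := add_zero d
    rw [← h0] at hV
    exact (hc.continuousAt (x := (D, 0))).preimage_mem_nhds hV
  have h0 : D * (1 + ((0 : Mat) - L 0)) - (1 + ((0 : Mat) - L 0)) * (D + L 0) = 0 := by simp
  have himg : (fun x : Mat × Mat =>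
      (x.1, x.1 * (1 + (x.2 - L x.2)) - (1 + (x.2 - L x.2)) * (D + L x.2))) ''
        {x | (∃ P ∈ W, (P : Mat) = 1 + (x.2 - L x.2)) ∧ d + (fun i => x.2 i i) ∈ V} ∈
      𝓝 (D, D * (1 + ((0 : Mat) - L 0)) - (1 + ((0 : Mat) - L 0)) * (D + L 0)) :=
    hf.ge (image_mem_map (hU.and hU'))
  rw [h0] at himg
  have hc : Continuous fun A : Mat => (A, (0 : Mat)) := by fun_prop
  filter_upwards [(hc.continuousAt (x := D)).preimage_mem_nhds himg]
  rintro A ⟨⟨A', X⟩, ⟨⟨P, hP, hPX⟩, he⟩, h⟩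
  change (A', A' * (1 + (X - L X)) - (1 + (X - L X)) * (D + L X)) = (A, 0) at h
  obtain ⟨rfl, hX⟩ := Prod.mk.inj h
  refine ⟨P, hP, d + fun i => X i i, he, ?_⟩
  have hPX' : (P : Mat) = 1 + (X - L X) := hPX
  have hDX : D + L X = Matrix.diagonal (d + fun i => X i i) := by
    rw [hL, hD, Matrix.diagonal_add]
    rfl
  rw [hPX', ← hDX]
  exact sub_eq_zero.1 hX

end Perturbation

/-- The diagonal entries of the base point for the first generator. -/
def diagA : Fin 3 → ℂ := ![10, -10, -1 / 100]

/-- The base point for the first generator. -/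
def matA : Matˣ where
  val := Matrix.diagonal diagA
  inv := Matrix.diagonal ![1 / 10, -1 / 10, -100]
  val_inv := by
    ext i j
    fin_cases i <;> fin_cases j <;> (simp [diagA]; try norm_num)
  inv_val := by
    ext i j
    fin_cases i <;> fin_cases j <;> (simp [diagA]; try norm_num)

/-- A vector orthogonal to `axis` and `coaxis`. -/
def midaxis : Fin 3 → ℂ := ![-2, 2, 1]

/-- The base point for the second generator, diagonal in the orthogonal basis `axis`, `coaxis`,
`midaxis`. -/
def matB : Matˣ where
  val := Matrix.of fun i j => 1000 * axis i * axis j + 1 / 81000 * coaxis i * coaxis j +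
    1 / 9 * midaxis i * midaxis j
  inv := Matrix.of fun i j => 1 / 81000 * axis i * axis j + 1000 * coaxis i * coaxis j +
    1 / 9 * midaxis i * midaxis j
  val_inv := by
    ext i j
    fin_cases i <;> fin_cases j <;>
      simp [Matrix.mul_apply, Fin.sum_univ_three, axis, coaxis, midaxis] <;> norm_num
  inv_val := by
    ext i j
    fin_cases i <;> fin_cases j <;>
      simp [Matrix.mul_apply, Fin.sum_univ_three, axis, coaxis, midaxis] <;> norm_num

theorem coe_matB : (matB : Mat) = Matrix.of fun i j => 1000 * axis i * axis j +
    1 / 81000 * coaxis i * coaxis j + 1 / 9 * midaxis i * midaxis j := rfl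

theorem coe_inv_matB : ((matB⁻¹ : Matˣ) : Mat) = Matrix.of fun i j => 1 / 81000 * axis i * axis j +
    1000 * coaxis i * coaxis j + 1 / 9 * midaxis i * midaxis j := rfl

/-- The eigenvectors of `matB`. -/
def basisB : Matˣ where
  val := !![2, 1, -2; 1, 2, 2; 2, -2, 1]
  inv := !![2 / 9, 1 / 9, 2 / 9; 1 / 9, 2 / 9, -2 / 9; -2 / 9, 2 / 9, 1 / 9]
  val_inv := by
    ext i j
    fin_cases i <;> fin_cases j <;> simp [Matrix.mul_apply, Fin.sum_univ_three] <;> norm_num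
  inv_val := by
    ext i j
    fin_cases i <;> fin_cases j <;> simp [Matrix.mul_apply, Fin.sum_univ_three] <;> norm_num

theorem matB_eq_conj : (matB : Mat) =
    (basisB : Mat) * Matrix.diagonal ![9000, 1 / 9000, 1] * ((basisB⁻¹ : Matˣ) : Mat) := by
  have h : ((basisB⁻¹ : Matˣ) : Mat) =
      !![2 / 9, 1 / 9, 2 / 9; 1 / 9, 2 / 9, -2 / 9; -2 / 9, 2 / 9, 1 / 9] := rfl
  have h' : (basisB : Mat) = !![2, 1, -2; 1, 2, 2; 2, -2, 1] := rfl
  rw [h, h', coe_matB]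
  ext i j
  fin_cases i <;> fin_cases j <;>
    simp [Matrix.mul_apply, Matrix.vecMul, dotProduct, Fin.sum_univ_three, Matrix.diagonal_apply,
      axis, coaxis, midaxis] <;> norm_num

theorem det_matB : (matB : Mat).det = 1 := by
  rw [matB_eq_conj, Matrix.det_mul_right_comm, ← Units.val_mul, mul_inv_cancel]
  simp [Fin.prod_univ_three]

theorem det_inv_matB : ((matB⁻¹ : Matˣ) : Mat).det = 1 := by
  have h : (matB : Mat).det * ((matB⁻¹ : Matˣ) : Mat).det = 1 := by
    rw [← Matrix.det_mul, Units.mul_inv, Matrix.det_one]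
  rwa [det_matB, one_mul] at h

theorem norm_matB_sub (i j : Fin 3) : ‖(matB : Mat) i j - 1000 * axis i * axis j‖ ≤ 2 := by
  rw [coe_matB]
  fin_cases i <;> fin_cases j <;> simp [axis, coaxis, midaxis] <;> norm_num

theorem norm_inv_matB_sub (i j : Fin 3) :
    ‖((matB⁻¹ : Matˣ) : Mat) i j - 1000 * coaxis i * coaxis j‖ ≤ 2 := by
  rw [coe_inv_matB]
  fin_cases i <;> fin_cases j <;> simp [axis, coaxis, midaxis] <;> norm_num

open Topology Filter

theorem eventually_near_matB : ∀ᶠ S : Matˣ in 𝓝 matB,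
    (∀ i j, ‖(S : Mat) i j - 1000 * axis i * axis j‖ ≤ 3) ∧
    (∀ i j, ‖((S⁻¹ : Matˣ) : Mat) i j - 1000 * coaxis i * coaxis j‖ ≤ 3) ∧
    ‖(S : Mat).det‖ ≤ 2 ∧ ‖((S⁻¹ : Matˣ) : Mat).det‖ ≤ 2 := by
  have cval : Continuous fun S : Matˣ => (S : Mat) := Units.continuous_val
  have cinv : Continuous fun S : Matˣ => ((S⁻¹ : Matˣ) : Mat) := Units.continuous_val.comp continuous_inv
  have aux : ∀ {f : Matˣ → ℂ} {r : ℝ}, Continuous f → ‖f matB‖ < r →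
      ∀ᶠ S in 𝓝 matB, ‖f S‖ ≤ r := fun hf hr =>
    (hf.norm.continuousAt.eventually (gt_mem_nhds hr)).mono fun _ h => le_of_lt h
  refine (eventually_all.2 fun i => eventually_all.2 fun j => ?_).and
    ((eventually_all.2 fun i => eventually_all.2 fun j => ?_).and (.and ?_ ?_))
  · exact aux (by fun_prop) ((norm_matB_sub i j).trans_lt (by norm_num))
  · exact aux (by fun_prop) ((norm_inv_matB_sub i j).trans_lt (by norm_num))
  · exact aux cval.matrix_det (by rw [det_matB]; norm_num)
  · exact aux cinv.matrix_det (by rw [det_inv_matB]; norm_num)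

theorem diagA_injective : diagA.Injective := by
  intro i j h
  fin_cases i <;> fin_cases j <;> simp [diagA] at h ⊢ <;> norm_num at h

theorem exists_open_controlled : ∃ Ω₁ Ω₂ : Set Matˣ, IsOpen Ω₁ ∧ IsOpen Ω₂ ∧ matA ∈ Ω₁ ∧
    matB ∈ Ω₂ ∧ ∀ a ∈ Ω₁, ∀ b ∈ Ω₂, Controlled a b := by
  have hc : Continuous fun x : Matˣ × Matˣ => x.1⁻¹ * x.2 * x.1 := by fun_prop
  have h1 : (1 : Matˣ)⁻¹ * matB * 1 = matB := by group
  have hnear := eventually_near_matB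
  rw [← h1] at hnear
  have hS := (hc.continuousAt (x := (1, matB))).eventually hnear
  rw [nhds_prod_eq, eventually_prod_iff] at hS
  obtain ⟨p, hp, q, hq, hpq⟩ := hS
  have hV : ∀ᶠ e : Fin 3 → ℂ in 𝓝 diagA, e 2 ≠ 0 ∧ 100 * ‖e 2‖ < ‖e 0‖ ∧ 100 * ‖e 2‖ < ‖e 1‖ := by
    have c : ∀ i, Continuous fun e : Fin 3 → ℂ => e i := continuous_apply
    refine IsOpen.mem_nhds ((isOpen_ne_fun (c 2) continuous_const).inter
      ((isOpen_lt (continuous_const.mul (c 2).norm) (c 0).norm).inter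
        (isOpen_lt (continuous_const.mul (c 2).norm) (c 1).norm))) ?_
    simp [diagA]
  have hA : ∀ᶠ a : Matˣ in 𝓝 matA, _ := (Units.continuous_val.continuousAt (x := matA)).eventually
    (eventually_eigenbasis diagA_injective hp hV)
  obtain ⟨Ω₁, hΩ₁, ho₁, hm₁⟩ := eventually_nhds_iff.1 hA
  obtain ⟨Ω₂, hΩ₂, ho₂, hm₂⟩ := eventually_nhds_iff.1 hq
  refine ⟨Ω₁, Ω₂, ho₁, ho₂, hm₁, hm₂, fun a ha b hb => ?_⟩
  obtain ⟨P, hP, e, ⟨he2, he0, he1⟩, hPe⟩ := hΩ₁ a ha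
  obtain ⟨h1, h2, h3, h4⟩ := hpq hP (hΩ₂ b hb)
  exact controlled_of_conj he2 he0 he1 hPe rfl h1 h2 h3 h4

open Monoid.Coprod Multiplicative

/-- The free product of the group `ℤ` and the monoid `ℕ`. -/
abbrev Words := Monoid.Coprod (Multiplicative ℤ) (Multiplicative ℕ)

/-- The normal form `tⁿ s t^m₁ s ⋯ s t^mₖ` in the free product. -/
def normalForm : ℤ → List ℤ → Words
  | n, [] => inl (ofAdd n)
  | n, m :: l => inl (ofAdd n) * (inr (ofAdd 1) * normalForm m l)

theorem inl_mul_normalForm (k n : ℤ) (l : List ℤ) :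
    inl (ofAdd k) * normalForm n l = normalForm (k + n) l := by
  cases l <;> simp [normalForm, ofAdd_add, mul_assoc]

theorem exists_normalForm (w : Words) : ∃ n l, w = normalForm n l := by
  induction w using Monoid.Coprod.induction_on' with
  | one => exact ⟨0, [], by simp [normalForm]⟩
  | inl_mul m x ih =>
    obtain ⟨n, l, rfl⟩ := ih
    exact ⟨toAdd m + n, l, inl_mul_normalForm (toAdd m) n l⟩
  | inr_mul m x ih =>
    obtain ⟨k, rfl⟩ := ofAdd.surjective m
    induction k with
    | zero => simpa using ih
    | succ k ihk =>
      obtain ⟨n, l, h⟩ := ihk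
      refine ⟨0, n :: l, ?_⟩
      rw [add_comm, ofAdd_add, map_mul, mul_assoc, h]
      simp [normalForm]

theorem map_normalForm {G : Type*} [Group G] (φ : Words →* G) (n : ℤ) (l : List ℤ) :
    φ (normalForm n l) = word (φ (inl (ofAdd 1))) (φ (inr (ofAdd 1))) n l := by
  have hz : ∀ n : ℤ, φ (inl (ofAdd n)) = φ (inl (ofAdd 1)) ^ n := fun n => by
    have h := map_zpow (φ.comp inl) (ofAdd 1) n
    rwa [← ofAdd_zsmul, zsmul_one] at h
  induction l generalizing n with
  | nil => simp [normalForm, word, hz n]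
  | cons m l ih => simp [normalForm, word, ih, hz n]

/-- The generators of the free product. -/
abbrev gens : Set Words :=
  {x | x = inl (ofAdd (1 : ℤ)) ∨ x = inl (ofAdd (-1 : ℤ)) ∨ x = inr (ofAdd (1 : ℕ))}

theorem exists_list_inl (n : ℤ) : ∃ L : List Words, L.length = n.natAbs ∧ (∀ x ∈ L, x ∈ gens) ∧
    L.prod = inl (ofAdd n) := by
  rcases Int.eq_nat_or_neg n with ⟨k, rfl | rfl⟩
  · refine ⟨List.replicate k (inl (ofAdd 1)), by simp,
      fun x hx => Or.inl (List.eq_of_mem_replicate hx), ?_⟩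
    rw [List.prod_replicate, ← map_pow, ← ofAdd_nsmul]
    simp
  · refine ⟨List.replicate k (inl (ofAdd (-1))), by simp,
      fun x hx => Or.inr (Or.inl (List.eq_of_mem_replicate hx)), ?_⟩
    rw [List.prod_replicate, ← map_pow, ← ofAdd_nsmul]
    simp

theorem exists_list_normalForm (n : ℤ) (l : List ℤ) : ∃ L : List Words,
    L.length ≤ weight n l ∧ (∀ x ∈ L, x ∈ gens) ∧ L.prod = normalForm n l := by
  obtain ⟨L, h1, h2, h3⟩ := exists_list_inl n
  induction l generalizing n L with
  | nil => exact ⟨L, h1.le, h2, h3⟩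
  | cons m l ih =>
    obtain ⟨K, k1, k2, k3⟩ := exists_list_inl m
    obtain ⟨M, m1, m2, m3⟩ := ih m K k1 k2 k3
    refine ⟨L ++ (inr (ofAdd 1) :: M), ?_, ?_, ?_⟩
    · simp only [List.length_append, List.length_cons, weight]
      omega
    · intro x hx
      rcases List.mem_append.1 hx with hx | hx
      · exact h2 x hx
      · rcases List.mem_cons.1 hx with rfl | hx
        · exact Or.inr (Or.inr rfl)
        · exact m2 x hx
    · rw [List.prod_append, List.prod_cons, h3, m3]
      rfl

theorem wlen_normalForm_le (n : ℤ) (l : List ℤ) : wlen gens (normalForm n l) ≤ weight n l := by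
  obtain ⟨L, h1, h2, h3⟩ := exists_list_normalForm n l
  unfold wlen
  exact le_trans (Nat.sInf_le ⟨L, rfl, h2, h3⟩) h1

theorem Controlled.injective_and_growth {a b : Matˣ} (h : Controlled a b) (φ : Words →* Matˣ)
    (ha : φ (inl (ofAdd 1)) = a) (hb : φ (inr (ofAdd 1)) = b) :
    Function.Injective φ ∧ ∃ c θ : ℝ, 0 < c ∧ 0 < θ ∧ ∀ w : Words,
      c * Real.exp (θ * (wlen gens w : ℝ)) ≤
        opN (φ w : Mat) * opN (((φ w)⁻¹ : Matˣ) : Mat) := by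
  obtain ⟨hinj, C, hC, hgrow⟩ := h.word
  refine ⟨fun v w e => ?_, 1 / (C + 1), Real.log 2 / 3, by positivity, by positivity, fun w => ?_⟩
  · obtain ⟨n, l, rfl⟩ := exists_normalForm v
    obtain ⟨m, l', rfl⟩ := exists_normalForm w
    rw [map_normalForm, map_normalForm, ha, hb] at e
    obtain ⟨rfl, rfl⟩ := hinj n m l l' e
    rfl
  · obtain ⟨n, l, rfl⟩ := exists_normalForm w
    have hg := hgrow n l
    rw [map_normalForm, ha, hb]
    set x := opN ((PingPong.word a b n l : Matˣ) : Mat) *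
      opN (((PingPong.word a b n l)⁻¹ : Matˣ) : Mat)
    have hx : 0 ≤ x := mul_nonneg (opN_nonneg _) (opN_nonneg _)
    set k := wlen gens (normalForm n l)
    have hk : k ≤ weight n l := wlen_normalForm_le n l
    refine le_of_pow_le_pow_left₀ three_ne_zero hx ?_
    have hexp : Real.exp (Real.log 2 / 3 * k) ^ 3 = 2 ^ k := by
      rw [← Real.exp_nat_mul, ← Real.rpow_natCast, Real.rpow_def_of_pos two_pos]
      congr 1
      push_cast
      ring
    have hc : (1 / (C + 1)) ^ 3 ≤ 1 / (C + 1) :=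
      pow_le_of_le_one (by positivity) ((div_le_one (by positivity)).2 (by linarith)) three_ne_zero
    have h2 : (2 : ℝ) ^ k ≤ (C + 1) * x ^ 3 :=
      calc (2 : ℝ) ^ k ≤ 2 ^ weight n l := by gcongr; norm_num
        _ ≤ C * x ^ 3 := hg
        _ ≤ (C + 1) * x ^ 3 := by gcongr; linarith
    calc _ = (1 / (C + 1)) ^ 3 * 2 ^ k := by rw [mul_pow, hexp]
      _ ≤ 1 / (C + 1) * ((C + 1) * x ^ 3) := by gcongr
      _ = x ^ 3 := by field_simp

end PingPong

/-- there exist real, determinant-one, diagonalizable matrices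
`A, B ∈ GL_3(ℂ)`, with `A` having two eigenvalues of equal maximal modulus, and open
neighborhoods `Ω₁ ∋ A`, `Ω₂ ∋ B`, such that for all `A' ∈ Ω₁`, `B' ∈ Ω₂` the monoid
homomorphism `ℤ ∗ ℕ → GL_3(ℂ)` sending the generators to `A'` and `B'` is injective and a
quasi-isometric embedding. -/
theorem stmt2 : ∃ A B : (Matrix (Fin 3) (Fin 3) ℂ)ˣ,
    (∀ i j, ((A : Matrix (Fin 3) (Fin 3) ℂ) i j).im = 0) ∧
    (∀ i j, ((B : Matrix (Fin 3) (Fin 3) ℂ) i j).im = 0) ∧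
    (A : Matrix (Fin 3) (Fin 3) ℂ).det = 1 ∧
    (B : Matrix (Fin 3) (Fin 3) ℂ).det = 1 ∧
    -- A is diagonalizable with two eigenvalues of equal modulus, strictly larger than
    -- the modulus of the third
    (∃ (P : (Matrix (Fin 3) (Fin 3) ℂ)ˣ) (dg : Fin 3 → ℂ),
      (A : Matrix (Fin 3) (Fin 3) ℂ) =
        (P : Matrix (Fin 3) (Fin 3) ℂ) * Matrix.diagonal dg *
          ((P⁻¹ : _) : Matrix (Fin 3) (Fin 3) ℂ) ∧
      ‖dg 0‖ = ‖dg 1‖ ∧ ‖dg 2‖ < ‖dg 0‖) ∧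
    -- B is diagonalizable
    (∃ (Q : (Matrix (Fin 3) (Fin 3) ℂ)ˣ) (dg : Fin 3 → ℂ),
      (B : Matrix (Fin 3) (Fin 3) ℂ) =
        (Q : Matrix (Fin 3) (Fin 3) ℂ) * Matrix.diagonal dg *
          ((Q⁻¹ : _) : Matrix (Fin 3) (Fin 3) ℂ)) ∧
    ∃ Ω₁ Ω₂ : Set (Matrix (Fin 3) (Fin 3) ℂ)ˣ,
      IsOpen Ω₁ ∧ IsOpen Ω₂ ∧ A ∈ Ω₁ ∧ B ∈ Ω₂ ∧
      ∀ A' ∈ Ω₁, ∀ B' ∈ Ω₂,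
        ∀ φ : Monoid.Coprod (Multiplicative ℤ) (Multiplicative ℕ) →*
            (Matrix (Fin 3) (Fin 3) ℂ)ˣ,
          φ (Monoid.Coprod.inl (Multiplicative.ofAdd (1 : ℤ))) = A' →
          φ (Monoid.Coprod.inr (Multiplicative.ofAdd (1 : ℕ))) = B' →
          Function.Injective φ ∧
          ∃ c θ : ℝ, 0 < c ∧ 0 < θ ∧
            ∀ w : Monoid.Coprod (Multiplicative ℤ) (Multiplicative ℕ),
              c * Real.exp (θ *
                (wlen {x | x = Monoid.Coprod.inl (Multiplicative.ofAdd (1 : ℤ)) ∨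
                    x = Monoid.Coprod.inl (Multiplicative.ofAdd (-1 : ℤ)) ∨
                    x = Monoid.Coprod.inr (Multiplicative.ofAdd (1 : ℕ))} w : ℝ)) ≤
                opN (φ w : Matrix (Fin 3) (Fin 3) ℂ) *
                  opN (((φ w)⁻¹ : _) : Matrix (Fin 3) (Fin 3) ℂ) := by
  obtain ⟨Ω₁, Ω₂, ho₁, ho₂, hm₁, hm₂, hΩ⟩ := PingPong.exists_open_controlled
  refine ⟨PingPong.matA, PingPong.matB, fun i j => ?_, fun i j => ?_, ?_, PingPong.det_matB,
    ⟨1, PingPong.diagA, ?_, ?_, ?_⟩, ⟨PingPong.basisB, _, PingPong.matB_eq_conj⟩,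
    Ω₁, Ω₂, ho₁, ho₂, hm₁, hm₂,
    fun a ha b hb φ hφa hφb => (hΩ a ha b hb).injective_and_growth φ hφa hφb⟩
  · change (Matrix.diagonal PingPong.diagA i j).im = 0
    fin_cases i <;> fin_cases j <;> simp [PingPong.diagA]
  · rw [PingPong.coe_matB]
    fin_cases i <;> fin_cases j <;> simp [PingPong.axis, PingPong.coaxis, PingPong.midaxis]
  · change (Matrix.diagonal PingPong.diagA).det = 1
    simp [PingPong.diagA, Fin.prod_univ_three]
    norm_num
  · simp [PingPong.matA]
  · simp [PingPong.diagA]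
  · simp [PingPong.diagA]
    norm_num
end
end

section
/- Let k be ℝ, ℂ, or a nonarchimedean local field, let n ≥ 3, h ∈ GL_n(k), κ_1, κ_n ∈ k^×, and A ∈ GL_{n−2}(k) with ‖A‖ < |κ_1| and ‖A⁻¹‖ < |κ_n|⁻¹, and let g := h·diag(κ_1, A, κ_n)·h⁻¹ have determinant 1. Then for every θ > 0 and every natural number p the following hold, with L := (4·C(h)⁴/θ²) · max{|κ_1|⁻¹·‖A‖, |κ_n|·‖A⁻¹‖}^p: (i) for all nonzero u, v ∈ k^n with [u], [v] ∈ M_θ^−(g) one has d_ℙ([g^p u], [g^p v]) ≤ L · d_ℙ([u], [v]), and for all nonzero u, v with [u], [v] ∈ M_θ^+(g) one has d_ℙ([g^{−p} u], [g^{−p} v]) ≤ L · d_ℙ([u], [v]); (ii) for every nonzero v with [v] ∈ M_θ^−(g), ‖g^p v‖ ≥ (2θ/C(h)²) · min{|κ_1|, |κ_n|⁻¹}^p · ‖v‖, and for every nonzero v with [v] ∈ M_θ^+(g), ‖g^{−p} v‖ ≥ (2θ/C(h)²) · min{|κ_1|, |κ_n|⁻¹}^p · ‖v‖. -/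
noncomputable section

/-- Projective distance between (the lines of) two nonzero vectors, with respect to a norm
function `N` on `Fin n → k`: the infimum of `N (ζ·u₀ − v₀)` over unit representatives
`u₀, v₀` of the two lines and scalars `ζ` of absolute value one. -/
def dPg {k : Type*} [NormedField k] {n : ℕ} (N : (Fin n → k) → ℝ) (u v : Fin n → k) : ℝ :=
  sInf {r : ℝ | ∃ a b ζ : k, N (a • u) = 1 ∧ N (b • v) = 1 ∧ ‖ζ‖ = 1 ∧
    r = N (ζ • a • u - b • v)}

/-- Distance from a projective point to the projectivization of a subspace. -/
def distPSg {k : Type*} [NormedField k] {n : ℕ} (N : (Fin n → k) → ℝ) (u : Fin n → k)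
    (W : Submodule k (Fin n → k)) : ℝ :=
  sInf {r : ℝ | ∃ w : Fin n → k, w ∈ W ∧ w ≠ 0 ∧ r = dPg N u w}

/-- Operator norm of a square matrix with respect to a norm function `N`. -/
def opNg {k : Type*} [NormedField k] {n : ℕ} (N : (Fin n → k) → ℝ)
    (A : Matrix (Fin n) (Fin n) k) : ℝ :=
  sInf {c : ℝ | 0 ≤ c ∧ ∀ v : Fin n → k, N (A.mulVec v) ≤ c * N v}

/-- The block diagonal matrix `diag(κ₁, A, κₙ)`. -/
def blockD {k : Type*} [Field k] {n : ℕ} (κ₁ κₙ : k)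
    (A : Matrix (Fin (n - 2)) (Fin (n - 2)) k) : Matrix (Fin n) (Fin n) k :=
  Matrix.of fun i j =>
    if _h1 : (i : ℕ) = 0 then (if (j : ℕ) = 0 then κ₁ else 0)
    else if _h2 : (i : ℕ) = n - 1 then (if (j : ℕ) = n - 1 then κₙ else 0)
    else if _h3 : ((j : ℕ) = 0 ∨ (j : ℕ) = n - 1) then 0
    else A ⟨(i : ℕ) - 1, by have := i.2; omega⟩ ⟨(j : ℕ) - 1, by have := j.2; omega⟩

section CoordNorm

open scoped Matrix

/-- A norm on `k ^ n` dominating the coordinates, with unit basis vectors, for which nonzero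
vectors can be normalized in a Lipschitz way. -/
structure IsCoordNorm {k : Type*} [NormedField k] {n : ℕ} (N : (Fin n → k) → ℝ) : Prop where
  add_le : ∀ x y, N (x + y) ≤ N x + N y
  smul : ∀ (c : k) x, N (c • x) = ‖c‖ * N x
  coord_le : ∀ x i, ‖x i‖ ≤ N x
  single : ∀ i, N (Pi.single i 1) = 1
  exists_normalize : ∀ x y, x ≠ 0 → y ≠ 0 →
    ∃ a b : k, N (a • x) = 1 ∧ N (b • y) = 1 ∧ N (a • x - b • y) * N x ≤ 2 * N (x - y)

namespace IsCoordNorm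

variable {k : Type*} [NormedField k] {n : ℕ} {N : (Fin n → k) → ℝ}

lemma map_zero (hN : IsCoordNorm N) : N 0 = 0 := by
  have := hN.smul 0 0
  simpa using this

lemma map_neg (hN : IsCoordNorm N) (x : Fin n → k) : N (-x) = N x := by
  have := hN.smul (-1) x
  simpa using this

lemma sub_le (hN : IsCoordNorm N) (x y : Fin n → k) : N (x - y) ≤ N x + N y := by
  have := hN.add_le x (-y)
  rwa [hN.map_neg, ← sub_eq_add_neg] at this

lemma nonneg (hN : IsCoordNorm N) (x : Fin n → k) : 0 ≤ N x := by
  have := hN.sub_le x x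
  rw [sub_self, hN.map_zero] at this
  linarith

lemma pos (hN : IsCoordNorm N) {x : Fin n → k} (hx : x ≠ 0) : 0 < N x := by
  obtain ⟨i, hi⟩ := Function.ne_iff.1 hx
  exact (norm_pos_iff.2 hi).trans_le (hN.coord_le x i)

lemma sum_le (hN : IsCoordNorm N) {ι : Type*} (s : Finset ι) (f : ι → Fin n → k) :
    N (∑ i ∈ s, f i) ≤ ∑ i ∈ s, N (f i) :=
  Finset.le_sum_of_subadditive N hN.map_zero.le hN.add_le s f

lemma opNg_nonneg (A : Matrix (Fin n) (Fin n) k) : 0 ≤ opNg N A :=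
  Real.sInf_nonneg fun _ h => h.1

lemma mulVec_le (hN : IsCoordNorm N) (A : Matrix (Fin n) (Fin n) k) (v : Fin n → k) :
    N (A *ᵥ v) ≤ opNg N A * N v := by
  have hne : {c : ℝ | 0 ≤ c ∧ ∀ v : Fin n → k, N (A *ᵥ v) ≤ c * N v}.Nonempty := by
    refine ⟨∑ j, N (A.col j), Finset.sum_nonneg fun _ _ => hN.nonneg _, fun v => ?_⟩
    have hv : A *ᵥ v = ∑ j, v j • A.col j := by
      ext i
      simp [Matrix.mulVec, dotProduct, mul_comm]
    rw [hv, Finset.sum_mul]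
    refine (hN.sum_le _ _).trans (Finset.sum_le_sum fun j _ => ?_)
    rw [hN.smul, mul_comm]
    exact mul_le_mul_of_nonneg_left (hN.coord_le v j) (hN.nonneg _)
  rcases eq_or_ne v 0 with rfl | hv
  · simp [hN.map_zero]
  · rw [← div_le_iff₀ (hN.pos hv)]
    exact le_csInf hne fun c hc => (div_le_iff₀ (hN.pos hv)).2 (hc.2 v)

lemma one_le_opNg_mul (hN : IsCoordNorm N) (hn : 0 < n) {A B : Matrix (Fin n) (Fin n) k}
    (hAB : A * B = 1) : 1 ≤ opNg N A * opNg N B := by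
  have e : A *ᵥ (B *ᵥ Pi.single ⟨0, hn⟩ 1) = Pi.single ⟨0, hn⟩ 1 := by
    rw [Matrix.mulVec_mulVec, hAB, Matrix.one_mulVec]
  have h1 := hN.mulVec_le A (B *ᵥ Pi.single ⟨0, hn⟩ 1)
  have h2 := hN.mulVec_le B (Pi.single ⟨0, hn⟩ 1)
  rw [e, hN.single] at h1
  rw [hN.single, mul_one] at h2
  exact h1.trans (mul_le_mul_of_nonneg_left h2 (opNg_nonneg A))

lemma dPg_bddBelow (hN : IsCoordNorm N) (u v : Fin n → k) :
    BddBelow {r : ℝ | ∃ a b ζ : k, N (a • u) = 1 ∧ N (b • v) = 1 ∧ ‖ζ‖ = 1 ∧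
      r = N (ζ • a • u - b • v)} :=
  ⟨0, by rintro _ ⟨a, b, ζ, -, -, -, rfl⟩; exact hN.nonneg _⟩

lemma dPg_nonneg (hN : IsCoordNorm N) (u v : Fin n → k) : 0 ≤ dPg N u v :=
  Real.sInf_nonneg (by rintro _ ⟨a, b, ζ, -, -, -, rfl⟩; exact hN.nonneg _)

lemma dPg_mul_le (hN : IsCoordNorm N) {x y : Fin n → k} (hx : x ≠ 0) (hy : y ≠ 0) :
    dPg N x y * N x ≤ 2 * N (x - y) := by
  obtain ⟨a, b, ha, hb, hab⟩ := hN.exists_normalize x y hx hy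
  refine le_trans (mul_le_mul_of_nonneg_right ?_ (hN.nonneg x)) hab
  exact csInf_le (hN.dPg_bddBelow x y) ⟨a, b, 1, ha, hb, norm_one, by rw [one_smul]⟩

lemma dPg_le_two (hN : IsCoordNorm N) {x y : Fin n → k} (hx : x ≠ 0) (hy : y ≠ 0) :
    dPg N x y ≤ 2 := by
  obtain ⟨a, b, ha, hb, -⟩ := hN.exists_normalize x y hx hy
  refine (csInf_le (hN.dPg_bddBelow x y) ⟨a, b, 1, ha, hb, norm_one, rfl⟩).trans ?_
  rw [one_smul]
  have := hN.sub_le (a • x) (b • y)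
  linarith

lemma dPg_smul_smul (N : (Fin n → k) → ℝ) {s t : k} (hs : s ≠ 0) (ht : t ≠ 0)
    (x y : Fin n → k) : dPg N (s • x) (t • y) = dPg N x y := by
  unfold dPg
  congr 1
  ext r
  constructor
  · rintro ⟨a, b, ζ, ha, hb, hζ, rfl⟩
    refine ⟨a * s, b * t, ζ, ?_, ?_, hζ, ?_⟩ <;> simp only [mul_smul] <;> assumption
  · rintro ⟨a, b, ζ, ha, hb, hζ, rfl⟩
    refine ⟨a * s⁻¹, b * t⁻¹, ζ, ?_, ?_, hζ, ?_⟩ <;>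
      simp only [smul_smul, inv_mul_cancel_right₀ hs, inv_mul_cancel_right₀ ht] <;> assumption

lemma le_mul_dPg (hN : IsCoordNorm N) {x y : Fin n → k} (hx : x ≠ 0) (hy : y ≠ 0) {d L : ℝ}
    (hL : 0 ≤ L)
    (h : ∀ a b : k, N (a • x) = 1 → N (b • y) = 1 → d ≤ L * N (a • x - b • y)) :
    d ≤ L * dPg N x y := by
  obtain ⟨a₀, b₀, ha₀, hb₀, -⟩ := hN.exists_normalize x y hx hy
  rcases hL.eq_or_lt with rfl | hL
  · simpa using h a₀ b₀ ha₀ hb₀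
  · rw [mul_comm, ← div_le_iff₀ hL]
    refine le_csInf ⟨_, a₀, b₀, 1, ha₀, hb₀, norm_one, rfl⟩ ?_
    rintro _ ⟨a, b, ζ, ha, hb, hζ, rfl⟩
    rw [div_le_iff₀ hL, mul_comm, smul_smul]
    refine h (ζ * a) b ?_ hb
    rw [mul_smul, hN.smul, hζ, ha, one_mul]

variable {h hi : Matrix (Fin n) (Fin n) k} {i₀ : Fin n} {θ : ℝ}

/-- A vector which is `θ`-far from the hyperplane `h (ker (proj i₀))` has a large
`i₀`-th coordinate in the basis given by the columns of `h`. -/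
lemma le_norm_coord (hN : IsCoordNorm N) (hhi : h * hi = 1) {i₁ : Fin n} (hi₁ : i₁ ≠ i₀)
    {v : Fin n → k} (hv : v ≠ 0)
    (hθ : θ ≤ distPSg N v ((LinearMap.ker (LinearMap.proj i₀ : (Fin n → k) →ₗ[k] k)).map
      (Matrix.mulVecLin h))) (hih : hi * h = 1) :
    θ * N v ≤ 2 * (opNg N h * ‖(hi *ᵥ v) i₀‖) := by
  have key : ∀ w : Fin n → k, w i₀ = 0 → h *ᵥ w ≠ 0 → θ ≤ dPg N v (h *ᵥ w) := by
    intro w hw hw0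
    refine hθ.trans (csInf_le ⟨0, ?_⟩ ⟨h *ᵥ w, ⟨w, hw, rfl⟩, hw0, rfl⟩)
    rintro _ ⟨w, -, -, rfl⟩
    exact hN.dPg_nonneg _ _
  set c := (hi *ᵥ v) i₀ with hc
  have hNc : N (h *ᵥ (c • Pi.single i₀ 1)) ≤ opNg N h * ‖c‖ := by
    have := hN.mulVec_le h (c • Pi.single i₀ 1)
    rwa [hN.smul, hN.single, mul_one] at this
  have hsplit : v - h *ᵥ (hi *ᵥ v - c • Pi.single i₀ 1) = h *ᵥ (c • Pi.single i₀ 1) := by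
    rw [Matrix.mulVec_sub, Matrix.mulVec_mulVec, hhi, Matrix.one_mulVec, sub_sub_cancel]
  by_cases hy : h *ᵥ (hi *ᵥ v - c • Pi.single i₀ 1) = 0
  · rw [hy, sub_zero] at hsplit
    have hne : h *ᵥ Pi.single i₁ 1 ≠ 0 := by
      intro h0
      have h1 : hi *ᵥ (h *ᵥ Pi.single i₁ 1) = (Pi.single i₁ 1 : Fin n → k) := by
        rw [Matrix.mulVec_mulVec, hih, Matrix.one_mulVec]
      rw [h0, Matrix.mulVec_zero] at h1
      simpa using congrFun h1 i₁
    have hθ2 : θ ≤ 2 :=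
      (key _ (Pi.single_eq_of_ne hi₁.symm _) hne).trans (hN.dPg_le_two hv hne)
    rw [← hsplit] at hNc
    have := mul_le_mul_of_nonneg_right hθ2 (hN.nonneg v)
    linarith
  · have h1 := key _ (by simp [hc]) hy
    have h2 := hN.dPg_mul_le hv hy
    rw [hsplit] at h2
    have := mul_le_mul_of_nonneg_right h1 (hN.nonneg v)
    linarith

variable {E : Matrix (Fin n) (Fin n) k} {μ : k}

lemma le_opNg_mul_conj (hN : IsCoordNorm N) (hih : hi * h = 1)
    (hE : ∀ w, (E *ᵥ w) i₀ = μ * w i₀) (v : Fin n → k) :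
    ‖μ‖ * ‖(hi *ᵥ v) i₀‖ ≤ opNg N hi * N ((h * E * hi) *ᵥ v) := by
  have h1 := hN.mulVec_le hi ((h * E * hi) *ᵥ v)
  rw [Matrix.mulVec_mulVec, ← mul_assoc, ← mul_assoc, hih, one_mul, ← Matrix.mulVec_mulVec] at h1
  refine le_trans ?_ h1
  have := hN.coord_le (E *ᵥ (hi *ᵥ v)) i₀
  rwa [hE, norm_mul] at this

lemma le_conj_mulVec (hN : IsCoordNorm N) (hθ : 0 < θ) (hhi : h * hi = 1) (hih : hi * h = 1)
    {i₁ : Fin n} (hi₁ : i₁ ≠ i₀) (hE : ∀ w, (E *ᵥ w) i₀ = μ * w i₀)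
    {C ρ : ℝ} (hC : C = 2 * opNg N h * opNg N hi) (hρ : ρ ≤ ‖μ‖) {v : Fin n → k} (hv : v ≠ 0)
    (hvθ : θ ≤ distPSg N v ((LinearMap.ker (LinearMap.proj i₀ : (Fin n → k) →ₗ[k] k)).map
      (Matrix.mulVecLin h))) :
    2 * θ / C ^ 2 * ρ * N v ≤ N ((h * E * hi) *ᵥ v) := by
  have h1 := hN.le_norm_coord hhi hi₁ hv hvθ hih
  have h2 := hN.le_opNg_mul_conj hih hE v
  have hc := hN.one_le_opNg_mul i₀.pos hhi
  have hH : 0 ≤ opNg N h := opNg_nonneg h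
  have hT := hN.nonneg ((h * E * hi) *ᵥ v)
  have hv0 := hN.nonneg v
  generalize N ((h * E * hi) *ᵥ v) = T at *
  generalize N v = V at *
  generalize opNg N h = H at *
  generalize opNg N hi = K at *
  generalize ‖(hi *ᵥ v) i₀‖ = f at *
  have hm : 0 ≤ ‖μ‖ := norm_nonneg μ
  generalize ‖μ‖ = m at *
  have hCp : 0 < C ^ 2 := by
    have : 0 < C := by rw [hC, mul_assoc]; linarith
    positivity
  have e : 2 * θ / C ^ 2 * ρ * V = 2 * (ρ * (θ * V)) / C ^ 2 := by ring
  rw [e, div_le_iff₀ hCp, hC]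
  have a1 : ρ * (θ * V) ≤ m * (θ * V) := mul_le_mul_of_nonneg_right hρ (by positivity)
  have a2 : m * (θ * V) ≤ m * (2 * (H * f)) := mul_le_mul_of_nonneg_left h1 hm
  have a3 : H * (m * f) ≤ H * (K * T) := mul_le_mul_of_nonneg_left h2 hH
  have a4 : 1 * (H * K * T) ≤ (H * K) * (H * K * T) :=
    mul_le_mul_of_nonneg_right hc (mul_nonneg (by linarith) hT)
  nlinarith

lemma dPg_conj_le (hN : IsCoordNorm N) (hθ : 0 < θ) (hhi : h * hi = 1) (hih : hi * h = 1)
    {i₁ : Fin n} (hi₁ : i₁ ≠ i₀) (hE : ∀ w, (E *ᵥ w) i₀ = μ * w i₀) {s : ℝ}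
    (hs : 0 ≤ s) (hEs : ∀ w, w i₀ = 0 → N (E *ᵥ w) ≤ s * N w) (hμ : μ ≠ 0)
    {C ρ : ℝ} (hC : C = 2 * opNg N h * opNg N hi) (hρ : s ≤ ρ * ‖μ‖)
    {u v : Fin n → k} (hu : u ≠ 0) (hv : v ≠ 0)
    (huθ : θ ≤ distPSg N u ((LinearMap.ker (LinearMap.proj i₀ : (Fin n → k) →ₗ[k] k)).map
      (Matrix.mulVecLin h)))
    (hvθ : θ ≤ distPSg N v ((LinearMap.ker (LinearMap.proj i₀ : (Fin n → k) →ₗ[k] k)).map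
      (Matrix.mulVecLin h))) :
    dPg N ((h * E * hi) *ᵥ u) ((h * E * hi) *ᵥ v) ≤ 4 * C ^ 4 / θ ^ 2 * ρ * dPg N u v := by
  have hμ0 : 0 < ‖μ‖ := norm_pos_iff.2 hμ
  have hρ0 : 0 ≤ ρ := nonneg_of_mul_nonneg_left (hs.trans hρ) hμ0
  refine hN.le_mul_dPg hu hv (by positivity) fun a b ha hb => ?_
  have ha0 : a ≠ 0 := by rintro rfl; simp [hN.map_zero] at ha
  have hb0 : b ≠ 0 := by rintro rfl; simp [hN.map_zero] at hb
  have hcoord : ∀ (c : k) (w : Fin n → k), w ≠ 0 → N (c • w) = 1 →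
      θ ≤ distPSg N w ((LinearMap.ker (LinearMap.proj i₀ : (Fin n → k) →ₗ[k] k)).map
        (Matrix.mulVecLin h)) → θ ≤ 2 * (opNg N h * ‖(hi *ᵥ (c • w)) i₀‖) := by
    intro c w hw hcw hwθ
    have h1 := mul_le_mul_of_nonneg_left (hN.le_norm_coord hhi hi₁ hw hwθ hih) (norm_nonneg c)
    rw [hN.smul] at hcw
    have e : (hi *ᵥ (c • w)) i₀ = c * (hi *ᵥ w) i₀ := by
      rw [Matrix.mulVec_smul, Pi.smul_apply, smul_eq_mul]
    rw [e, norm_mul]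
    calc θ = ‖c‖ * (θ * N w) := by rw [mul_left_comm, hcw, mul_one]
      _ ≤ _ := h1
      _ = _ := by ring
  have hfu := hcoord a u hu ha huθ
  have hfv := hcoord b v hv hb hvθ
  rw [← dPg_smul_smul N ha0 hb0, ← Matrix.mulVec_smul, ← Matrix.mulVec_smul]
  generalize a • u = u at *
  generalize b • v = v at *
  set T := h * E * hi with hT
  set f := (hi *ᵥ u) i₀ with hf
  set f' := (hi *ᵥ v) i₀ with hf'
  have hH : 0 ≤ opNg N h := opNg_nonneg h
  have hK : 0 ≤ opNg N hi := opNg_nonneg hi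
  have hc := hN.one_le_opNg_mul i₀.pos hhi
  have hf0 : f ≠ 0 := by
    intro h0
    rw [h0, norm_zero] at hfu
    linarith
  have hf'0 : f' ≠ 0 := by
    intro h0
    rw [h0, norm_zero] at hfv
    linarith
  rw [← dPg_smul_smul N (inv_ne_zero hf0) (inv_ne_zero hf'0), ← Matrix.mulVec_smul,
    ← Matrix.mulVec_smul]
  set x := f⁻¹ • u with hx
  set y := f'⁻¹ • v with hy
  have hx1 : (hi *ᵥ x) i₀ = 1 := by
    rw [hx, Matrix.mulVec_smul, Pi.smul_apply, smul_eq_mul, ← hf, inv_mul_cancel₀ hf0]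
  have hy1 : (hi *ᵥ y) i₀ = 1 := by
    rw [hy, Matrix.mulVec_smul, Pi.smul_apply, smul_eq_mul, ← hf', inv_mul_cancel₀ hf'0]
  have hTx := hN.le_opNg_mul_conj hih hE x
  have hTy := hN.le_opNg_mul_conj hih hE y
  rw [hx1, norm_one, mul_one, ← hT] at hTx
  rw [hy1, norm_one, mul_one, ← hT] at hTy
  have hne : ∀ z, ‖μ‖ ≤ opNg N hi * N z → z ≠ 0 := by
    rintro z hz rfl
    rw [hN.map_zero] at hz
    linarith
  have hd := hN.dPg_mul_le (hne _ hTx) (hne _ hTy)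
  have hTxy : N (T *ᵥ x - T *ᵥ y) ≤ opNg N h * (s * (opNg N hi * N (x - y))) := by
    rw [← Matrix.mulVec_sub, hT, ← Matrix.mulVec_mulVec, ← Matrix.mulVec_mulVec]
    refine (hN.mulVec_le _ _).trans (mul_le_mul_of_nonneg_left ?_ hH)
    refine (hEs _ ?_).trans (mul_le_mul_of_nonneg_left (hN.mulVec_le _ _) hs)
    rw [Matrix.mulVec_sub, Pi.sub_apply, hx1, hy1, sub_self]
  have hff : ‖f' - f‖ ≤ opNg N hi * N (u - v) := by
    have h1 := (hN.coord_le (hi *ᵥ (u - v)) i₀).trans (hN.mulVec_le _ _)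
    rw [Matrix.mulVec_sub, Pi.sub_apply] at h1
    rwa [norm_sub_rev]
  have hxy : N (x - y) ≤ ‖f‖⁻¹ * N (u - v) + ‖f‖⁻¹ * ‖f'‖⁻¹ * ‖f' - f‖ := by
    have e : x - y = f⁻¹ • (u - v) + (f⁻¹ * f'⁻¹ * (f' - f)) • v := by
      have e' : f⁻¹ * f'⁻¹ * (f' - f) = f⁻¹ - f'⁻¹ := by field_simp
      rw [e', hx, hy, smul_sub, sub_smul]
      abel
    rw [e]
    refine (hN.add_le _ _).trans_eq ?_
    rw [hN.smul, hN.smul, hb, norm_mul, norm_mul, norm_inv, norm_inv, mul_one]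
  have hδ := hN.nonneg (u - v)
  have hD := hN.dPg_nonneg (T *ᵥ x) (T *ᵥ y)
  have hfi : ∀ t : k, t ≠ 0 → θ ≤ 2 * (opNg N h * ‖t‖) → ‖t‖⁻¹ ≤ 2 * opNg N h / θ := by
    intro t ht hθt
    rw [inv_le_iff_one_le_mul₀ (norm_pos_iff.2 ht), div_mul_eq_mul_div, le_div_iff₀ hθ]
    linarith
  have hθc : θ ≤ 2 * (opNg N h * opNg N hi) := by
    have h1 := (hN.coord_le (hi *ᵥ u) i₀).trans (hN.mulVec_le _ _)
    rw [ha, mul_one] at h1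
    exact hfu.trans (by gcongr)
  have h1 := hfi f hf0 hfu
  have h2 := hfi f' hf'0 hfv
  have hε : 0 ≤ ‖f' - f‖ := norm_nonneg _
  have hxy0 := hN.nonneg (x - y)
  have hn1 : 0 ≤ ‖f‖⁻¹ := by positivity
  have hn2 : 0 ≤ ‖f'‖⁻¹ := by positivity
  rw [hC]
  generalize N (T *ᵥ x) = X at *
  generalize N (T *ᵥ x - T *ᵥ y) = XY at *
  generalize N (x - y) = xy at *
  generalize dPg N (T *ᵥ x) (T *ᵥ y) = d at *
  generalize N (u - v) = δ at *
  generalize opNg N h = H at *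
  generalize opNg N hi = K at *
  generalize ‖f‖⁻¹ = p at *
  generalize ‖f'‖⁻¹ = q at *
  generalize ‖f' - f‖ = ε at *
  generalize ‖μ‖ = m at *
  have b1 : xy ≤ 2 * H / θ * δ + 2 * H / θ * (2 * H / θ) * (K * δ) := by
    refine hxy.trans (add_le_add (by gcongr) (by gcongr))
  have b2 : xy ≤ 8 * H ^ 2 * K * δ / θ ^ 2 := by
    refine b1.trans ?_
    rw [le_div_iff₀ (by positivity)]
    have e : (2 * H / θ * δ + 2 * H / θ * (2 * H / θ) * (K * δ)) * θ ^ 2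
      = 2 * H * δ * θ + 4 * H ^ 2 * K * δ := by
      field_simp
      ring
    rw [e]
    have := mul_le_mul_of_nonneg_left hθc (show 0 ≤ 2 * H * δ by positivity)
    linarith
  have b3 : d * m ≤ 2 * (H * K) * K * s * xy := by
    have := mul_le_mul_of_nonneg_left hTx hD
    have := mul_le_mul_of_nonneg_left (hd.trans (mul_le_mul_of_nonneg_left hTxy two_pos.le)) hK
    linarith
  have b4 : d * m ≤ 2 * (H * K) * K * (ρ * m) * (8 * H ^ 2 * K * δ / θ ^ 2) :=
    b3.trans (by gcongr)
  have b5 : d ≤ 2 * (H * K) * K * ρ * (8 * H ^ 2 * K * δ / θ ^ 2) := by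
    refine le_of_mul_le_mul_right (b4.trans_eq ?_) hμ0
    ring
  have e : 2 * (H * K) * K * ρ * (8 * H ^ 2 * K * δ / θ ^ 2)
      = 16 * (H * K) ^ 3 * (ρ * δ / θ ^ 2) := by ring
  have e' : 4 * (2 * H * K) ^ 4 / θ ^ 2 * ρ * δ = 64 * (H * K) ^ 4 * (ρ * δ / θ ^ 2) := by ring
  rw [e']
  rw [e] at b5
  refine b5.trans (mul_le_mul_of_nonneg_right ?_ (by positivity))
  have : (H * K) ^ 3 ≤ (H * K) ^ 4 := pow_le_pow_right₀ hc (by norm_num)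
  have : 0 ≤ (H * K) ^ 4 := by positivity
  linarith

lemma pow_mulVec_coord (hE : ∀ w, (E *ᵥ w) i₀ = μ * w i₀) (p : ℕ) (w : Fin n → k) :
    (E ^ p *ᵥ w) i₀ = μ ^ p * w i₀ := by
  induction p with
  | zero => simp
  | succ p ih => rw [pow_succ', ← Matrix.mulVec_mulVec, hE, ih, pow_succ', mul_assoc]

lemma pow_mulVec_le (hE : ∀ w, (E *ᵥ w) i₀ = μ * w i₀) {s : ℝ} (hs : 0 ≤ s)
    (hEs : ∀ w, w i₀ = 0 → N (E *ᵥ w) ≤ s * N w) (p : ℕ) (w : Fin n → k) (hw : w i₀ = 0) :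
    N (E ^ p *ᵥ w) ≤ s ^ p * N w := by
  induction p with
  | zero => simp
  | succ p ih =>
    rw [pow_succ', ← Matrix.mulVec_mulVec, pow_succ', mul_assoc]
    refine (hEs _ ?_).trans (mul_le_mul_of_nonneg_left ih hs)
    rw [pow_mulVec_coord hE, hw, mul_zero]

end IsCoordNorm

lemma isCoordNorm_of_isNonarchimedean {k : Type*} [NormedField k]
    (hk : IsNonarchimedean fun x : k => ‖x‖) {m : ℕ} (hm : 0 < m) {N : (Fin m → k) → ℝ}
    (hN : ∀ v, N v = ⨆ i, ‖v i‖) : IsCoordNorm N := by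
  have : Nonempty (Fin m) := ⟨⟨0, hm⟩⟩
  have hcoord : ∀ v i, ‖v i‖ ≤ N v := fun v i => by
    rw [hN]
    exact le_ciSup (f := fun i => ‖v i‖) (Set.finite_range _).bddAbove i
  have hle : ∀ v c, (∀ i, ‖v i‖ ≤ c) → N v ≤ c := fun v c h => by
    rw [hN]
    exact ciSup_le h
  have hatt : ∀ v, ∃ i, ‖v i‖ = N v := fun v => by
    rw [hN]
    exact exists_eq_ciSup_of_finite (f := fun i => ‖v i‖)
  have hmax : ∀ x y, N (x + y) ≤ max (N x) (N y) := fun x y =>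
    hle _ _ fun i => (hk (x i) (y i)).trans (max_le_max (hcoord x i) (hcoord y i))
  have hsmul : ∀ (c : k) x, N (c • x) = ‖c‖ * N x := fun c x => by
    rw [hN, hN, Real.mul_iSup_of_nonneg (norm_nonneg c)]
    simp
  have hneg : ∀ x, N (-x) = N x := fun x => by simpa using hsmul (-1) x
  have hnorm : ∀ x, x ≠ 0 → ∃ a : k, a ≠ 0 ∧ ‖a‖ * N x = 1 := fun x hx => by
    obtain ⟨i, hi⟩ := hatt x
    obtain ⟨j, hj⟩ := Function.ne_iff.1 hx
    have hpos : 0 < N x := (norm_pos_iff.2 hj).trans_le (hcoord x j)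
    refine ⟨(x i)⁻¹, inv_ne_zero (norm_pos_iff.1 (hi ▸ hpos)), ?_⟩
    rw [norm_inv, hi, inv_mul_cancel₀ hpos.ne']
  have hnn : ∀ x, 0 ≤ N x := fun x => (norm_nonneg _).trans (hcoord x ⟨0, hm⟩)
  have hadd : ∀ x y, N (x + y) ≤ N x + N y := fun x y =>
    (hmax x y).trans (max_le_add_of_nonneg (hnn x) (hnn y))
  refine ⟨hadd, hsmul, hcoord, fun i => le_antisymm (hle _ _ fun j => ?_) ?_,
    fun x y hx hy => ?_⟩
  · rcases eq_or_ne j i with rfl | hj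
    · simp
    · simp [Pi.single_eq_of_ne hj]
  · simpa using hcoord (Pi.single i 1) i
  · obtain ⟨a, ha0, ha⟩ := hnorm x hx
    obtain ⟨b, hb0, hb⟩ := hnorm y hy
    by_cases hxy : N x = N y
    · refine ⟨a, a, by rw [hsmul, ha], by rw [hsmul, ← hxy, ha], ?_⟩
      rw [← smul_sub, hsmul, mul_right_comm, ha, one_mul]
      linarith [hnn (x - y)]
    · refine ⟨a, b, by rw [hsmul, ha], by rw [hsmul, hb], ?_⟩
      have h1 : N (a • x - b • y) ≤ 2 := by
        have := hadd (a • x) (-(b • y))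
        rw [hneg, hsmul, hsmul, ha, hb, ← sub_eq_add_neg] at this
        linarith
      have h2 : N x ≤ N (x - y) := by
        have h3 := hmax (x - y) y
        have h4 := hmax (-(x - y)) x
        rw [hneg] at h4
        simp only [sub_add_cancel, neg_sub] at h3 h4
        by_contra! hlt
        rcases le_max_iff.1 h3 with h3 | h3
        · linarith
        · rcases le_max_iff.1 h4 with h4 | h4
          · linarith
          · exact hxy (le_antisymm h3 h4)
      exact mul_le_mul h1 h2 (hnn x) two_pos.le

lemma isCoordNorm_euclidean {k : Type*} [NormedField k] (f : ℝ → k) (hf0 : f 0 = 0)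
    (hf : ∀ r s, ‖f r - f s‖ = |r - s|) {m : ℕ} {N : (Fin m → k) → ℝ}
    (hN : ∀ v, N v = Real.sqrt (∑ i, ‖v i‖ ^ 2)) : IsCoordNorm N := by
  have hN' : ∀ v, N v = ‖(WithLp.toLp 2 v : PiLp 2 fun _ : Fin m => k)‖ := fun v => by
    rw [hN, PiLp.norm_eq_of_L2]
  have hcoord : ∀ v i, ‖v i‖ ≤ N v := fun v i => by
    rw [hN']
    exact PiLp.norm_apply_le (WithLp.toLp 2 v : PiLp 2 fun _ : Fin m => k) i
  have hadd : ∀ x y, N (x + y) ≤ N x + N y := fun x y => by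
    rw [hN', hN', hN', WithLp.toLp_add]
    exact norm_add_le _ _
  have hsmul : ∀ (c : k) x, N (c • x) = ‖c‖ * N x := fun c x => by
    rw [hN', hN', WithLp.toLp_smul, norm_smul]
  have hnn : ∀ x, 0 ≤ N x := fun x => by
    rw [hN]
    exact Real.sqrt_nonneg _
  have hpos : ∀ x, x ≠ 0 → 0 < N x := fun x hx => by
    obtain ⟨j, hj⟩ := Function.ne_iff.1 hx
    exact (norm_pos_iff.2 hj).trans_le (hcoord x j)
  have hfn : ∀ r, ‖f r‖ = |r| := fun r => by simpa [hf0] using hf r 0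
  have hunit : ∀ x, x ≠ 0 → N (f (N x)⁻¹ • x) = 1 := fun x hx => by
    rw [hsmul, hfn, abs_of_pos (inv_pos.2 (hpos x hx)), inv_mul_cancel₀ (hpos x hx).ne']
  refine ⟨hadd, hsmul, hcoord, fun i => ?_, fun x y hx hy => ⟨f (N x)⁻¹, f (N y)⁻¹,
    hunit x hx, hunit y hy, ?_⟩⟩
  · rw [hN, Finset.sum_eq_single i]
    · simp
    · intro j _ hj
      simp [Pi.single_eq_of_ne hj]
    · simp
  · have e : f (N x)⁻¹ • x - f (N y)⁻¹ • y
        = f (N x)⁻¹ • (x - y) + (f (N x)⁻¹ - f (N y)⁻¹) • y := by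
      rw [smul_sub, sub_smul]
      abel
    have h1 := hpos x hx
    have h2 := hpos y hy
    have h3 : |N y - N x| ≤ N (x - y) := by
      rw [hN', hN', hN', WithLp.toLp_sub, norm_sub_rev]
      exact abs_norm_sub_norm_le _ _
    have h4 : |(N x)⁻¹ - (N y)⁻¹| = |N y - N x| / (N x * N y) := by
      rw [inv_sub_inv h1.ne' h2.ne', abs_div, abs_of_pos (mul_pos h1 h2)]
    have h5 := hadd (f (N x)⁻¹ • (x - y)) ((f (N x)⁻¹ - f (N y)⁻¹) • y)
    rw [← e, hsmul, hsmul, hf, hfn, abs_of_pos (inv_pos.2 h1), h4] at h5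
    calc _ ≤ _ := mul_le_mul_of_nonneg_right h5 h1.le
      _ = N (x - y) + |N y - N x| := by field_simp
      _ ≤ _ := by linarith

/-- Norms on `k ^ (m + 2)` and `k ^ m` for which scaling estimates can be checked separately on
the first, middle and last coordinates. -/
def BlockMono {k : Type*} [NormedField k] {m : ℕ} (N : (Fin (m + 2) → k) → ℝ)
    (N' : (Fin m → k) → ℝ) : Prop :=
  ∀ (s : ℝ) (x y : Fin (m + 2) → k), 0 ≤ s → ‖x 0‖ ≤ s * ‖y 0‖ →
    ‖x (Fin.last _)‖ ≤ s * ‖y (Fin.last _)‖ →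
    N' (fun i => x i.castSucc.succ) ≤ s * N' (fun i => y i.castSucc.succ) → N x ≤ s * N y

lemma blockMono_iSup {k : Type*} [NormedField k] {m : ℕ} {N : (Fin (m + 2) → k) → ℝ}
    {N' : (Fin m → k) → ℝ} (hN : ∀ v, N v = ⨆ i, ‖v i‖) (hN' : ∀ v, N' v = ⨆ i, ‖v i‖) :
    BlockMono N N' := by
  intro s x y hs h0 hl hm
  have hy : ∀ i, ‖y i‖ ≤ N y := fun i => by
    rw [hN]
    exact le_ciSup (f := fun i => ‖y i‖) (Set.finite_range _).bddAbove i
  rw [hN x]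
  refine ciSup_le fun i => ?_
  induction i using Fin.cases with
  | zero => exact h0.trans (mul_le_mul_of_nonneg_left (hy _) hs)
  | succ i =>
    induction i using Fin.lastCases with
    | last => exact hl.trans (mul_le_mul_of_nonneg_left (hy _) hs)
    | cast i =>
      have : Nonempty (Fin m) := ⟨i⟩
      have h1 : ‖x i.castSucc.succ‖ ≤ N' (fun i => x i.castSucc.succ) := by
        rw [hN']
        exact le_ciSup (f := fun i : Fin m => ‖x i.castSucc.succ‖) (Set.finite_range _).bddAbove i
      refine (h1.trans hm).trans (mul_le_mul_of_nonneg_left ?_ hs)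
      rw [hN']
      exact ciSup_le fun i => hy _

lemma blockMono_euclidean {k : Type*} [NormedField k] {m : ℕ} {N : (Fin (m + 2) → k) → ℝ}
    {N' : (Fin m → k) → ℝ} (hN : ∀ v, N v = Real.sqrt (∑ i, ‖v i‖ ^ 2))
    (hN' : ∀ v, N' v = Real.sqrt (∑ i, ‖v i‖ ^ 2)) : BlockMono N N' := by
  intro s x y hs h0 hl hm
  have hsq : ∀ v, N v ^ 2
      = ‖v 0‖ ^ 2 + (N' (fun i => v i.castSucc.succ) ^ 2 + ‖v (Fin.last _)‖ ^ 2) := fun v => by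
    rw [hN, hN', Real.sq_sqrt (by positivity), Real.sq_sqrt (by positivity), Fin.sum_univ_succ,
      Fin.sum_univ_castSucc, Fin.succ_last]
  have hn : ∀ v, 0 ≤ N v := fun v => by rw [hN]; positivity
  have hn' : ∀ v, 0 ≤ N' v := fun v => by rw [hN']; positivity
  refine le_of_sq_le_sq ?_ (mul_nonneg hs (hn y))
  have h1 := pow_le_pow_left₀ (norm_nonneg _) h0 2
  have h2 := pow_le_pow_left₀ (norm_nonneg _) hl 2
  have h3 := pow_le_pow_left₀ (hn' _) hm 2
  rw [mul_pow, hsq x, hsq y]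
  rw [mul_pow] at h1 h2 h3
  linarith

section blockD

variable {k : Type*} [Field k] {m : ℕ} (a b : k) (A : Matrix (Fin m) (Fin m) k)
  (w : Fin (m + 2) → k)

lemma blockD_mulVec_zero : (blockD (n := m + 2) a b A *ᵥ w) 0 = a * w 0 := by
  simp [blockD, Matrix.mulVec, dotProduct]

lemma blockD_mulVec_last :
    (blockD (n := m + 2) a b A *ᵥ w) (Fin.last _) = b * w (Fin.last _) := by
  rw [Matrix.mulVec, dotProduct, Finset.sum_eq_single (Fin.last _)]
  · simp [blockD]
  · intro j _ hj
    have : (j : ℕ) ≠ m + 1 := fun h => hj (Fin.ext h)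
    simp [blockD, this]
  · simp

lemma blockD_mulVec_mid (i : Fin m) :
    (blockD (n := m + 2) a b A *ᵥ w) i.castSucc.succ
      = (A *ᵥ fun i => w i.castSucc.succ) i := by
  have hi : (i : ℕ) ≠ m := i.2.ne
  have hj : ∀ j : Fin m, (j : ℕ) ≠ m := fun j => j.2.ne
  rw [Matrix.mulVec, dotProduct, Fin.sum_univ_succ, Fin.sum_univ_castSucc]
  simp [blockD, Matrix.mulVec, dotProduct, hi, hj]

lemma blockD_mul_blockD_eq_one {a' b' : k} {A' : Matrix (Fin m) (Fin m) k} (ha : a * a' = 1)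
    (hb : b * b' = 1) (hA : A * A' = 1) :
    blockD (n := m + 2) a b A * blockD (n := m + 2) a' b' A' = 1 := by
  refine Matrix.ext_of_mulVec_single fun j => ?_
  generalize (Pi.single j 1 : Fin (m + 2) → k) = w
  rw [← Matrix.mulVec_mulVec, Matrix.one_mulVec]
  ext i
  induction i using Fin.cases with
  | zero => rw [blockD_mulVec_zero, blockD_mulVec_zero, ← mul_assoc, ha, one_mul]
  | succ i =>
    induction i using Fin.lastCases with
    | last =>
      rw [Fin.succ_last, blockD_mulVec_last, blockD_mulVec_last, ← mul_assoc, hb, one_mul]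
    | cast i =>
      simp_rw [blockD_mulVec_mid]
      change (A *ᵥ (A' *ᵥ _)) i = _
      rw [Matrix.mulVec_mulVec, hA, Matrix.one_mulVec]

end blockD

lemma IsCoordNorm.blockD_mulVec_le {k : Type*} [NormedField k] {m : ℕ}
    {N : (Fin (m + 2) → k) → ℝ} {N' : (Fin m → k) → ℝ} (hN' : IsCoordNorm N')
    (hNN' : BlockMono N N') (a b : k) (A : Matrix (Fin m) (Fin m) k) {w : Fin (m + 2) → k}
    (ha : ‖a‖ ≤ opNg N' A ∨ w 0 = 0) (hb : ‖b‖ ≤ opNg N' A ∨ w (Fin.last _) = 0) :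
    N (blockD (n := m + 2) a b A *ᵥ w) ≤ opNg N' A * N w := by
  refine hNN' _ _ _ (IsCoordNorm.opNg_nonneg A) ?_ ?_ ?_
  · rw [blockD_mulVec_zero, norm_mul]
    rcases ha with ha | ha
    · exact mul_le_mul_of_nonneg_right ha (norm_nonneg _)
    · simp [ha]
  · rw [blockD_mulVec_last, norm_mul]
    rcases hb with hb | hb
    · exact mul_le_mul_of_nonneg_right hb (norm_nonneg _)
    · simp [hb]
  · simp_rw [blockD_mulVec_mid]
    exact hN'.mulVec_le A _

end CoordNorm

/-- Lemma on Lipschitz constants of proximal elements: for a local field `k`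
(ℝ, ℂ, or nonarchimedean, with its standard norms), `g = h·diag(κ₁, A, κₙ)·h⁻¹` of
determinant one with `‖A‖ < |κ₁|`, `‖A⁻¹‖ < |κₙ|⁻¹`: the restriction of `g^{±p}` to
`M_θ^∓(g)` is `L`-Lipschitz for the projective metric, and `‖g^{±p} v‖ ≥
(2θ/C(h)²)·min(|κ₁|, |κₙ|⁻¹)^p·‖v‖` there. -/
theorem stmt3 {k : Type*} [NormedField k] (N : ∀ m : ℕ, (Fin m → k) → ℝ)
    (hLF :
      -- nonarchimedean local field with the sup norms
      ((IsNonarchimedean fun x : k => ‖x‖) ∧ CompleteSpace k ∧ LocallyCompactSpace k ∧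
        (∃ x : k, 1 < ‖x‖) ∧ ∀ (m : ℕ) (v : Fin m → k), N m v = ⨆ i, ‖v i‖) ∨
      -- `k` is isometrically ℝ or ℂ, with the Euclidean norms
      (((∃ e : k ≃+* ℝ, ∀ x : k, ‖e x‖ = ‖x‖) ∨ (∃ e : k ≃+* ℂ, ∀ x : k, ‖e x‖ = ‖x‖)) ∧
        ∀ (m : ℕ) (v : Fin m → k), N m v = Real.sqrt (∑ i, ‖v i‖ ^ 2)))
    (n : ℕ) (hn : 3 ≤ n)
    (h : (Matrix (Fin n) (Fin n) k)ˣ) (κ₁ κₙ : k) (hκ₁ : κ₁ ≠ 0) (hκₙ : κₙ ≠ 0)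
    (A : (Matrix (Fin (n - 2)) (Fin (n - 2)) k)ˣ)
    (hA1 : opNg (N (n - 2)) (A : Matrix (Fin (n - 2)) (Fin (n - 2)) k) < ‖κ₁‖)
    (hA2 : opNg (N (n - 2)) ((A⁻¹ : _) : Matrix (Fin (n - 2)) (Fin (n - 2)) k) < ‖κₙ‖⁻¹)
    (g : (Matrix (Fin n) (Fin n) k)ˣ)
    (hg : (g : Matrix (Fin n) (Fin n) k) =
      (h : Matrix (Fin n) (Fin n) k) * blockD κ₁ κₙ (A : Matrix (Fin (n - 2)) (Fin (n - 2)) k) *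
        ((h⁻¹ : _) : Matrix (Fin n) (Fin n) k))
    (hdet : (g : Matrix (Fin n) (Fin n) k).det = 1)
    (θ : ℝ) (hθ : 0 < θ) (p : ℕ) (L C : ℝ)
    (hC : C = 2 * opNg (N n) (h : Matrix (Fin n) (Fin n) k) *
      opNg (N n) ((h⁻¹ : _) : Matrix (Fin n) (Fin n) k))
    (hL : L = 4 * C ^ 4 / θ ^ 2 *
      max (‖κ₁‖⁻¹ * opNg (N (n - 2)) (A : Matrix (Fin (n - 2)) (Fin (n - 2)) k))
        (‖κₙ‖ * opNg (N (n - 2)) ((A⁻¹ : _) : Matrix (Fin (n - 2)) (Fin (n - 2)) k)) ^ p)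
    (Vminus Vplus : Submodule k (Fin n → k))
    (hVm : Vminus = (LinearMap.ker
        (LinearMap.proj (⟨0, by omega⟩ : Fin n) : (Fin n → k) →ₗ[k] k)).map
      (Matrix.mulVecLin (h : Matrix (Fin n) (Fin n) k)))
    (hVp : Vplus = (LinearMap.ker
        (LinearMap.proj (⟨n - 1, by omega⟩ : Fin n) : (Fin n → k) →ₗ[k] k)).map
      (Matrix.mulVecLin (h : Matrix (Fin n) (Fin n) k))) :
    -- (i) Lipschitz estimates
    ((∀ u v : Fin n → k, u ≠ 0 → v ≠ 0 →
        θ ≤ distPSg (N n) u Vminus → θ ≤ distPSg (N n) v Vminus →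
        dPg (N n) (((g ^ p : _) : Matrix (Fin n) (Fin n) k).mulVec u)
            (((g ^ p : _) : Matrix (Fin n) (Fin n) k).mulVec v) ≤ L * dPg (N n) u v) ∧
      (∀ u v : Fin n → k, u ≠ 0 → v ≠ 0 →
        θ ≤ distPSg (N n) u Vplus → θ ≤ distPSg (N n) v Vplus →
        dPg (N n) (((g ^ (-(p : ℤ)) : _) : Matrix (Fin n) (Fin n) k).mulVec u)
            (((g ^ (-(p : ℤ)) : _) : Matrix (Fin n) (Fin n) k).mulVec v) ≤ L * dPg (N n) u v)) ∧
    -- (ii) lower norm bounds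
    ((∀ v : Fin n → k, v ≠ 0 → θ ≤ distPSg (N n) v Vminus →
        (2 * θ / C ^ 2) * min ‖κ₁‖ ‖κₙ‖⁻¹ ^ p * N n v ≤
          N n (((g ^ p : _) : Matrix (Fin n) (Fin n) k).mulVec v)) ∧
      (∀ v : Fin n → k, v ≠ 0 → θ ≤ distPSg (N n) v Vplus →
        (2 * θ / C ^ 2) * min ‖κ₁‖ ‖κₙ‖⁻¹ ^ p * N n v ≤
          N n (((g ^ (-(p : ℤ)) : _) : Matrix (Fin n) (Fin n) k).mulVec v))) := by
  obtain ⟨m, rfl⟩ : ∃ m, n = m + 2 := ⟨n - 2, by omega⟩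
  have hm : 0 < m := by omega
  change (Matrix (Fin m) (Fin m) k)ˣ at A
  change opNg (N m) _ < _ at hA1
  change opNg (N m) _ < _ at hA2
  change L = 4 * C ^ 4 / θ ^ 2 * max (‖κ₁‖⁻¹ * opNg (N m) _) (‖κₙ‖ * opNg (N m) _) ^ p at hL
  obtain ⟨hN, hN', hNN'⟩ :
      IsCoordNorm (N (m + 2)) ∧ IsCoordNorm (N m) ∧ BlockMono (N (m + 2)) (N m) := by
    rcases hLF with ⟨hna, -, -, -, hsup⟩ | ⟨hRC, heuc⟩
    · exact ⟨isCoordNorm_of_isNonarchimedean hna (by omega) (hsup _),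
        isCoordNorm_of_isNonarchimedean hna hm (hsup _), blockMono_iSup (hsup _) (hsup _)⟩
    · obtain ⟨f, hf0, hf⟩ : ∃ f : ℝ → k, f 0 = 0 ∧ ∀ r s, ‖f r - f s‖ = |r - s| := by
        rcases hRC with ⟨e, he⟩ | ⟨e, he⟩
        · refine ⟨fun r => e.symm r, map_zero _, fun r s => ?_⟩
          rw [← map_sub, ← he, RingEquiv.apply_symm_apply, Real.norm_eq_abs]
        · refine ⟨fun r => e.symm (r : ℂ), by simp, fun r s => ?_⟩
          rw [← map_sub, ← he, RingEquiv.apply_symm_apply, ← Complex.ofReal_sub,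
            Complex.norm_real, Real.norm_eq_abs]
      exact ⟨isCoordNorm_euclidean f hf0 hf (heuc _), isCoordNorm_euclidean f hf0 hf (heuc _),
        blockMono_euclidean (heuc _) (heuc _)⟩
  set α := opNg (N m) (A : Matrix (Fin m) (Fin m) k) with hα
  set β := opNg (N m) ((A⁻¹ : _) : Matrix (Fin m) (Fin m) k) with hβ
  have hα0 : 0 ≤ α := IsCoordNorm.opNg_nonneg _
  have hβ0 : 0 ≤ β := IsCoordNorm.opNg_nonneg _
  have hαβ : 1 ≤ α * β := hN'.one_le_opNg_mul hm A.mul_inv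
  have hn₁ : 0 < ‖κ₁‖ := norm_pos_iff.2 hκ₁
  have hnₙ : 0 < ‖κₙ‖ := norm_pos_iff.2 hκₙ
  have hκₙα : ‖κₙ‖ ≤ α := by
    have h1 : ‖κₙ‖ * β ≤ 1 := by
      rw [← mul_inv_cancel₀ hnₙ.ne']
      exact mul_le_mul_of_nonneg_left hA2.le hnₙ.le
    have h2 := mul_le_mul_of_nonneg_right hαβ hnₙ.le
    have h3 := mul_le_mul_of_nonneg_left h1 hα0
    linarith
  have hκ₁β : ‖κ₁⁻¹‖ ≤ β := by
    rw [norm_inv, inv_le_iff_one_le_mul₀ hn₁]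
    have := mul_le_mul_of_nonneg_right hA1.le hβ0
    linarith
  let D : (Matrix (Fin (m + 2)) (Fin (m + 2)) k)ˣ :=
    ⟨blockD κ₁ κₙ (A : Matrix (Fin m) (Fin m) k),
      blockD κ₁⁻¹ κₙ⁻¹ ((A⁻¹ : _) : Matrix (Fin m) (Fin m) k),
      blockD_mul_blockD_eq_one _ _ _ (mul_inv_cancel₀ hκ₁) (mul_inv_cancel₀ hκₙ) A.mul_inv,
      blockD_mul_blockD_eq_one _ _ _ (inv_mul_cancel₀ hκ₁) (inv_mul_cancel₀ hκₙ) A.inv_mul⟩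
  have hgD : g = h * D * h⁻¹ := Units.ext hg
  have hgp : ((g ^ p : _) : Matrix (Fin (m + 2)) (Fin (m + 2)) k)
      = (h : Matrix (Fin (m + 2)) (Fin (m + 2)) k)
        * (blockD κ₁ κₙ (A : Matrix (Fin m) (Fin m) k)) ^ p
        * ((h⁻¹ : _) : Matrix (Fin (m + 2)) (Fin (m + 2)) k) := by
    rw [hgD, conj_pow]
    rfl
  have hgn : ((g ^ (-(p : ℤ)) : _) : Matrix (Fin (m + 2)) (Fin (m + 2)) k)
      = (h : Matrix (Fin (m + 2)) (Fin (m + 2)) k)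
        * (blockD κ₁⁻¹ κₙ⁻¹ ((A⁻¹ : _) : Matrix (Fin m) (Fin m) k)) ^ p
        * ((h⁻¹ : _) : Matrix (Fin (m + 2)) (Fin (m + 2)) k) := by
    rw [hgD, conj_zpow, zpow_neg, zpow_natCast, ← inv_pow]
    rfl
  have hne : (Fin.last (m + 1)) ≠ 0 := Fin.last_pos.ne'
  have hcoord₁ := blockD_mulVec_zero κ₁ κₙ (A : Matrix (Fin m) (Fin m) k)
  have hcoordₙ := blockD_mulVec_last κ₁⁻¹ κₙ⁻¹ ((A⁻¹ : _) : Matrix (Fin m) (Fin m) k)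
  have hker₁ := fun (w : Fin (m + 2) → k) (hw : w 0 = 0) =>
    hN'.blockD_mulVec_le hNN' κ₁ κₙ (A : Matrix (Fin m) (Fin m) k) (Or.inr hw) (Or.inl hκₙα)
  have hkerₙ := fun (w : Fin (m + 2) → k) (hw : w (Fin.last _) = 0) =>
    hN'.blockD_mulVec_le hNN' κ₁⁻¹ κₙ⁻¹ ((A⁻¹ : _) : Matrix (Fin m) (Fin m) k)
      (Or.inl hκ₁β) (Or.inr hw)
  have hρ₁ : α ^ p ≤ max (‖κ₁‖⁻¹ * α) (‖κₙ‖ * β) ^ p * ‖κ₁ ^ p‖ := by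
    rw [norm_pow, ← mul_pow]
    refine pow_le_pow_left₀ hα0 ?_ p
    calc α = ‖κ₁‖⁻¹ * α * ‖κ₁‖ := by field_simp
      _ ≤ _ := mul_le_mul_of_nonneg_right (le_max_left _ _) hn₁.le
  have hρₙ : β ^ p ≤ max (‖κ₁‖⁻¹ * α) (‖κₙ‖ * β) ^ p * ‖κₙ⁻¹ ^ p‖ := by
    rw [norm_pow, norm_inv, ← mul_pow]
    refine pow_le_pow_left₀ hβ0 ?_ p
    calc β = ‖κₙ‖ * β * ‖κₙ‖⁻¹ := by field_simp
      _ ≤ _ := mul_le_mul_of_nonneg_right (le_max_right _ _) (by positivity)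
  have hmin : 0 ≤ min ‖κ₁‖ ‖κₙ‖⁻¹ := by positivity
  subst hVm hVp
  rw [hgp, hgn, hL]
  refine ⟨⟨fun u v hu hv huθ hvθ => ?_, fun u v hu hv huθ hvθ => ?_⟩,
    fun v hv hvθ => ?_, fun v hv hvθ => ?_⟩
  · exact hN.dPg_conj_le hθ h.mul_inv h.inv_mul hne (IsCoordNorm.pow_mulVec_coord hcoord₁ p)
      (pow_nonneg hα0 p) (IsCoordNorm.pow_mulVec_le hcoord₁ hα0 hker₁ p) (pow_ne_zero p hκ₁) hC hρ₁
      hu hv huθ hvθ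
  · exact hN.dPg_conj_le hθ h.mul_inv h.inv_mul hne.symm (IsCoordNorm.pow_mulVec_coord hcoordₙ p)
      (pow_nonneg hβ0 p) (IsCoordNorm.pow_mulVec_le hcoordₙ hβ0 hkerₙ p)
      (pow_ne_zero p (inv_ne_zero hκₙ)) hC hρₙ hu hv huθ hvθ
  · refine hN.le_conj_mulVec hθ h.mul_inv h.inv_mul hne (IsCoordNorm.pow_mulVec_coord hcoord₁ p)
      hC ?_ hv hvθ
    rw [norm_pow]
    exact pow_le_pow_left₀ hmin (min_le_left _ _) p
  · refine hN.le_conj_mulVec hθ h.mul_inv h.inv_mul hne.symm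
      (IsCoordNorm.pow_mulVec_coord hcoordₙ p) hC ?_ hv hvθ
    rw [norm_pow, norm_inv]
    exact pow_le_pow_left₀ hmin (min_le_right _ _) p
end
end
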